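/- Suppose some triangle ABC is N-tiled by a tile whose three angles α, β, γ are all rational multiples of π. Then N is a perfect square, or a sum of two perfect squares, or 2, 3, or 6 times a perfect square. In particular N is not 7, 11, 14, 19, or 31. -/

import Mathlib

open EuclideanGeometry Real

noncomputable section

/-- A point of the Euclidean plane. -/
abbrev Pt : Type := EuclideanSpace ℝ (Fin 2)

/-- A triangle, given by its three vertices. -/
abbrev Tri : Type := Fin 3 → Pt

/-- A genuine (nondegenerate) triangle. -/
def IsTriangle (T : Tri) : Prop := AffineIndependent ℝ T

/-- The closed triangle (convex hull of the vertices). -/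
def triSet (T : Tri) : Set Pt := convexHull ℝ (Set.range T)

/-- Two triangles are congruent iff corresponding distances agree
up to a permutation of the vertices. -/
def CongruentTri (T₁ T₂ : Tri) : Prop :=
  ∃ σ : Equiv.Perm (Fin 3), ∀ i j : Fin 3, dist (T₁ i) (T₁ j) = dist (T₂ (σ i)) (T₂ (σ j))

/-- An `N`-tiling of the triangle `ABC` by the tile `T`: a family of `N` triangles,
each congruent to `T`, with pairwise disjoint interiors, whose union is the
closed triangle `ABC`. -/
structure IsTiling (N : ℕ) (ABC T : Tri) (tiles : Fin N → Tri) : Prop where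
  congr : ∀ i, CongruentTri (tiles i) T
  disj : ∀ i j, i ≠ j → interior (triSet (tiles i)) ∩ interior (triSet (tiles j)) = ∅
  cover : (⋃ i, triSet (tiles i)) = triSet ABC

/-- The interior angle of the triangle `T` at its `k`-th vertex. -/
def triAngle (T : Tri) (k : Fin 3) : ℝ := ∠ (T (k + 1)) (T k) (T (k + 2))

/-- The side of `T` opposite to the `k`-th vertex. -/
def sideLen (T : Tri) (k : Fin 3) : ℝ := dist (T (k + 1)) (T (k + 2))

/-- `T` has angles `α`, `β`, `γ` (at vertices `0`, `1`, `2`, which are opposite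
the sides of lengths `a`, `b`, `c` respectively). -/
def HasAngles (T : Tri) (α β γ : ℝ) : Prop :=
  triAngle T 0 = α ∧ triAngle T 1 = β ∧ triAngle T 2 = γ

/-- Two triangles are similar iff corresponding distances agree up to a
permutation of the vertices and a positive scale factor. -/
def SimilarTri (T₁ T₂ : Tri) : Prop :=
  ∃ r : ℝ, 0 < r ∧ ∃ σ : Equiv.Perm (Fin 3),
    ∀ i j : Fin 3, dist (T₁ i) (T₁ j) = r * dist (T₂ (σ i)) (T₂ (σ j))

lemma z12 : (1 : Fin 3) + 2 = 0 := rfl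
lemma z22 : (2 : Fin 3) + 2 = 1 := rfl
lemma z21 : (2 : Fin 3) + 1 = 0 := rfl
lemma z11 : (1 : Fin 3) + 1 = 2 := rfl

lemma ext_of_tb {k S M ι : Type} [Field k] [Field S] [Field M] [IsAlgClosed M] [Algebra k S]
    (v : ι → S) (hv : IsTranscendenceBasis k v) (f : MvPolynomial ι k →+* M)
    (hf : Function.Injective f) :
    ∃ τ : S →+* M, ∀ x : k, τ (algebraMap k S x) = f (MvPolynomial.C x) := by
  classical
  let R := Algebra.adjoin k (Set.range v)
  let e := hv.1.aevalEquiv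
  let g : R →+* M := f.comp (e.symm : R →+* MvPolynomial ι k)
  have hg : Function.Injective g := hf.comp e.symm.injective
  let : Algebra R M := g.toAlgebra
  have : Algebra.IsAlgebraic R S := hv.isAlgebraic
  have : Module.IsTorsionFree R M := by
    rw [Module.isTorsionFree_iff_algebraMap_injective]
    exact hg
  refine ⟨(IsAlgClosed.lift : S →ₐ[R] M).toRingHom, fun x => ?_⟩
  have h1 : algebraMap k S x = algebraMap R S (algebraMap k R x) := rfl
  rw [h1]
  have := (IsAlgClosed.lift : S →ₐ[R] M).commutes (algebraMap k R x)
  refine this.trans ?_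
  change f (e.symm (algebraMap k R x)) = _
  rw [AlgEquiv.commutes]; rfl

lemma exists_ringHom_of_minpoly (x y : ℂ) (hx : IsAlgebraic ℚ x)
    (hy : Polynomial.aeval y (minpoly ℚ x) = 0) : ∃ τ : ℂ →+* ℂ, τ x = y := by
  classical
  let Q := algebraicClosure ℚ ℂ
  have : IsAlgClosed Q := (algebraicClosure.isAlgClosure (F := ℚ) (E := ℂ)).isAlgClosed
  have : Algebra.IsAlgebraic ℚ Q := algebraicClosure.isAlgebraic ℚ ℂ
  have hxm : x ∈ Q := mem_algebraicClosure_iff.2 hx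
  have hya : IsAlgebraic ℚ y := ⟨_, minpoly.ne_zero hx.isIntegral, hy⟩
  have hym : y ∈ Q := mem_algebraicClosure_iff.2 hya
  obtain ⟨σ, hσ⟩ : ∃ σ : Q →ₐ[ℚ] Q, σ ⟨x, hxm⟩ = ⟨y, hym⟩ := by
    apply IntermediateField.exists_algHom_of_splits_of_aeval
    · intro s
      exact ⟨Algebra.IsIntegral.isIntegral s, IsAlgClosed.splits _⟩
    · have h1 : minpoly ℚ (⟨x, hxm⟩ : Q) = minpoly ℚ x :=
        (minpoly.algebraMap_eq (A := ℚ) (B := Q) (B' := ℂ) (algebraMap Q ℂ).injective ⟨x, hxm⟩).symm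
      rw [h1]
      apply (algebraMap Q ℂ).injective
      rw [← Polynomial.aeval_algebraMap_apply, map_zero]
      exact hy
  obtain ⟨s, hs⟩ := exists_isTranscendenceBasis Q ℂ
  obtain ⟨τ, hτ⟩ := ext_of_tb (k := Q) (S := ℂ) (M := ℂ) (Subtype.val : s → ℂ) hs
    ((MvPolynomial.aeval (R := Q) (Subtype.val : s → ℂ) : MvPolynomial s Q →+* ℂ).comp
      (MvPolynomial.map (σ : Q →+* Q))) (by
      refine Function.Injective.comp (g := (MvPolynomial.aeval (R := Q) (Subtype.val : s → ℂ))) hs.1 ?_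
      exact MvPolynomial.map_injective _ (RingHom.injective _))
  refine ⟨τ, ?_⟩
  have := hτ ⟨x, hxm⟩
  refine this.trans ?_
  simp
  erw [hσ]

/-- the real part of a field endomorphism, on reals -/
def rho (τ : ℂ →+* ℂ) (x : ℝ) : ℝ := (τ (x : ℂ)).re

/-- totally real numbers -/
def TR (x : ℝ) : Prop := ∀ τ : ℂ →+* ℂ, (τ (x : ℂ)).im = 0

lemma TR.eq {x : ℝ} (h : TR x) (τ : ℂ →+* ℂ) : τ (x : ℂ) = (rho τ x : ℂ) := by
  apply Complex.ext <;> simp [rho, h τ]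

lemma TR.of_eq {x : ℝ} (h : ∀ τ : ℂ →+* ℂ, ∃ r : ℝ, τ (x : ℂ) = (r : ℂ)) : TR x := by
  intro τ; obtain ⟨r, hr⟩ := h τ; simp [hr]

lemma TR.add {x y : ℝ} (hx : TR x) (hy : TR y) : TR (x + y) := by
  intro τ; simp [hx τ, hy τ]
lemma TR.mul {x y : ℝ} (hx : TR x) (hy : TR y) : TR (x * y) := by
  intro τ; simp [hx τ, hy τ]
lemma TR.inv {x : ℝ} (hx : TR x) : TR (x⁻¹) := by
  intro τ; simp [hx τ]
lemma TR.div {x y : ℝ} (hx : TR x) (hy : TR y) : TR (x / y) := by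
  rw [div_eq_mul_inv]; exact hx.mul hy.inv
lemma TR.rat (q : ℚ) : TR (q : ℝ) := by
  intro τ; simp
lemma TR.nat (q : ℕ) : TR (q : ℝ) := by
  intro τ; simp

lemma rho_add (τ : ℂ →+* ℂ) (x y : ℝ) : rho τ (x + y) = rho τ x + rho τ y := by simp [rho]
lemma rho_sub (τ : ℂ →+* ℂ) (x y : ℝ) : rho τ (x - y) = rho τ x - rho τ y := by simp [rho]
lemma rho_neg (τ : ℂ →+* ℂ) (x : ℝ) : rho τ (-x) = - rho τ x := by simp [rho]
lemma rho_mul (τ : ℂ →+* ℂ) {x : ℝ} (hx : TR x) (y : ℝ) : rho τ (x * y) = rho τ x * rho τ y := by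
  simp [rho, hx τ]
lemma rho_sq (τ : ℂ →+* ℂ) {x : ℝ} (hx : TR x) : rho τ (x ^ 2) = rho τ x ^ 2 := by
  rw [sq, sq, rho_mul τ hx]
lemma rho_rat (τ : ℂ →+* ℂ) (q : ℚ) : rho τ (q : ℝ) = q := by simp [rho]
lemma rho_nat (τ : ℂ →+* ℂ) (q : ℕ) : rho τ (q : ℝ) = q := by simp [rho]
lemma rho_one (τ : ℂ →+* ℂ) : rho τ 1 = 1 := by simp [rho]
lemma rho_ofNat (τ : ℂ →+* ℂ) (q : ℕ) [q.AtLeastTwo] : rho τ (OfNat.ofNat q) = OfNat.ofNat q := by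
  exact rho_nat τ q
lemma rho_natmul (τ : ℂ →+* ℂ) (q : ℕ) (x : ℝ) : rho τ (q * x) = q * rho τ x := by
  rw [rho_mul τ (TR.nat q), rho_nat]
lemma rho_ratmul (τ : ℂ →+* ℂ) (q : ℚ) (x : ℝ) : rho τ (q * x) = q * rho τ x := by
  rw [rho_mul τ (TR.rat q), rho_rat]
lemma rho_ne (τ : ℂ →+* ℂ) {x : ℝ} (hx : TR x) (h0 : x ≠ 0) : rho τ x ≠ 0 := by
  intro h
  have := hx.eq τ
  rw [h] at this
  simp at this
  exact h0 this

lemma TR_of_sq {x : ℝ} (q : ℚ) (hq : 0 ≤ q) (h : x ^ 2 = q) : TR x := by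
  apply TR.of_eq
  intro τ
  have h1 : (τ x) ^ 2 = ((√(q:ℝ) : ℝ) : ℂ) ^ 2 := by
    rw [← map_pow, ← Complex.ofReal_pow, h, ← Complex.ofReal_pow, Real.sq_sqrt (by exact_mod_cast hq)]
    simp
  rcases sq_eq_sq_iff_eq_or_eq_neg.1 h1 with h | h
  · exact ⟨_, h⟩
  · exact ⟨-√(q:ℝ), by simp [h]⟩

lemma exists_flip {x : ℝ} (q : ℚ) (hx : Irrational x) (h : x ^ 2 = q) :
    ∃ τ : ℂ →+* ℂ, rho τ x = -x := by
  have hroot : Polynomial.aeval (x : ℂ) (Polynomial.X ^ 2 - Polynomial.C q : Polynomial ℚ) = 0 := by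
    simp [← Complex.ofReal_pow, h]
  have hmon : (Polynomial.X ^ 2 - Polynomial.C q : Polynomial ℚ).Monic :=
    Polynomial.monic_X_pow_sub_C _ (by norm_num)
  have hint : IsIntegral ℚ (x : ℂ) := ⟨_, hmon, by simpa using hroot⟩
  have hm : minpoly ℚ (x : ℂ) = Polynomial.X ^ 2 - Polynomial.C q := by
    symm
    refine Polynomial.eq_of_monic_of_dvd_of_natDegree_le (minpoly.monic hint) hmon (minpoly.dvd _ _ hroot) ?_
    rw [Polynomial.natDegree_X_pow_sub_C]
    rw [minpoly.two_le_natDegree_iff hint]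
    rintro ⟨r, hr⟩
    apply hx
    refine ⟨r, ?_⟩
    have : ((r : ℝ) : ℂ) = x := by simpa using hr
    exact_mod_cast this
  obtain ⟨τ, hτ⟩ := exists_ringHom_of_minpoly (x : ℂ) (-(x : ℂ)) hint.isAlgebraic (by
    rw [hm]; simp [← Complex.ofReal_pow, h])
  exact ⟨τ, by simp [rho, hτ]⟩

/-- the root of unity exp(pi i / n) -/
noncomputable def zeta (n : ℕ) : ℂ := Complex.exp (π * Complex.I / n)

lemma zeta_prim {n : ℕ} (hn : n ≠ 0) : IsPrimitiveRoot (zeta n) (2 * n) := by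
  have := Complex.isPrimitiveRoot_exp (2 * n) (by omega)
  rw [zeta]
  convert this using 2
  push_cast; field_simp

lemma zeta_pow (n j : ℕ) : zeta n ^ j = Complex.exp (((j * π / n : ℝ) : ℂ) * Complex.I) := by
  rw [zeta, ← Complex.exp_nat_mul]; push_cast; congr 1; ring

lemma exists_tau {n : ℕ} (hn : n ≠ 0) (k : ℕ) (hk : k.Coprime (2 * n)) :
    ∃ τ : ℂ →+* ℂ, τ (zeta n) = zeta n ^ k := by
  have hp := zeta_prim hn
  apply exists_ringHom_of_minpoly
  · exact ((hp.isIntegral (by omega)).tower_top (A := ℚ)).isAlgebraic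
  · rw [← Polynomial.cyclotomic_eq_minpoly_rat hp (by omega)]
    rw [Polynomial.cyclotomic_eq_minpoly_rat (hp.pow_of_coprime k hk) (by omega)]
    exact minpoly.aeval _ _

lemma tau_pow {n : ℕ} (hn : n ≠ 0) (τ : ℂ →+* ℂ) :
    ∃ k : ℕ, k.Coprime (2 * n) ∧ τ (zeta n) = zeta n ^ k := by
  have hp := zeta_prim hn
  have h2 : NeZero (2 * n) := ⟨by omega⟩
  have := hp.map_of_injective τ.injective
  obtain ⟨i, -, hi, h⟩ := (hp.isPrimitiveRoot_iff).1 this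
  exact ⟨i, hi, h.symm⟩

lemma sin_eq_zeta (n j : ℕ) : ((sin (j * π / n) : ℝ) : ℂ) =
    ((zeta n ^ j)⁻¹ - zeta n ^ j) * Complex.I / 2 := by
  rw [zeta_pow, Complex.ofReal_sin, Complex.sin, ← Complex.exp_neg]
  congr 4; ring

lemma cos_eq_zeta (n j : ℕ) : ((cos (j * π / n) : ℝ) : ℂ) =
    ((zeta n ^ j)⁻¹ + zeta n ^ j) / 2 := by
  rw [zeta_pow, Complex.ofReal_cos, Complex.cos, ← Complex.exp_neg, add_comm]
  congr 3; ring

lemma tau_cos {n k : ℕ} (τ : ℂ →+* ℂ) (h : τ (zeta n) = zeta n ^ k) (j : ℕ) :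
    τ ((cos (j * π / n) : ℝ) : ℂ) = ((cos (k * (j * π / n)) : ℝ) : ℂ) := by
  have h1 : (k * (j * π / n) : ℝ) = ((k * j : ℕ) : ℝ) * π / n := by push_cast; ring
  rw [h1, cos_eq_zeta, cos_eq_zeta]
  have t2 : τ 2 = 2 := map_ofNat τ 2
  simp [h, pow_mul, t2]

lemma tau_sin {n k : ℕ} (τ : ℂ →+* ℂ) (h : τ (zeta n) = zeta n ^ k) :
    ∃ ε : ℝ, (ε = 1 ∨ ε = -1) ∧ ∀ j : ℕ,
    τ ((sin (j * π / n) : ℝ) : ℂ) = ((ε * sin (k * (j * π / n)) : ℝ) : ℂ) := by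
  have hI : (τ Complex.I) ^ 2 = Complex.I ^ 2 := by rw [← map_pow]; simp
  have key : ∃ ε : ℝ, (ε = 1 ∨ ε = -1) ∧ τ Complex.I = ε * Complex.I := by
    rcases sq_eq_sq_iff_eq_or_eq_neg.1 hI with h | h
    · exact ⟨1, by simp, by simp [h]⟩
    · exact ⟨-1, by simp, by simp [h]⟩
  obtain ⟨ε, hε, h2⟩ := key
  refine ⟨ε, hε, fun j => ?_⟩
  have h1 : (k * (j * π / n) : ℝ) = ((k * j : ℕ) : ℝ) * π / n := by push_cast; ring
  rw [h1, Complex.ofReal_mul, sin_eq_zeta, sin_eq_zeta]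
  have t2 : τ 2 = 2 := map_ofNat τ 2
  simp [h, pow_mul, h2, t2]
  ring

lemma TR_sin {n : ℕ} (hn : n ≠ 0) (j : ℕ) : TR (sin (j * π / n)) := by
  apply TR.of_eq; intro τ
  obtain ⟨k, -, hk⟩ := tau_pow hn τ
  obtain ⟨ε, -, h⟩ := tau_sin τ hk
  exact ⟨_, h j⟩

lemma rho_trig {n : ℕ} (k : ℕ) (τ : ℂ →+* ℂ) (h : τ (zeta n) = zeta n ^ k) :
    ∃ ε : ℝ, (ε = 1 ∨ ε = -1) ∧ (∀ j : ℕ, rho τ (sin (j * π / n)) = ε * sin (k * (j * π / n))) ∧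
     (∀ j : ℕ, rho τ (cos (j * π / n)) = cos (k * (j * π / n))) := by
  obtain ⟨ε, h1, h2⟩ := tau_sin τ h
  refine ⟨ε, h1, fun j => ?_, fun j => ?_⟩
  · rw [rho, h2, Complex.ofReal_re]
  · rw [rho, tau_cos τ h, Complex.ofReal_re]

/-- target disjunction -/
def Good (N : ℕ) : Prop := (∃ n : ℕ, N = n ^ 2) ∨ (∃ e f : ℕ, N = e ^ 2 + f ^ 2) ∨
      (∃ n : ℕ, N = 2 * n ^ 2) ∨ (∃ n : ℕ, N = 3 * n ^ 2) ∨ (∃ n : ℕ, N = 6 * n ^ 2)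

lemma sqform {w N : ℕ} (hw : Squarefree w) (r : ℚ) (h : (w * N : ℚ) = r ^ 2) : ∃ n : ℕ, N = w * n ^ 2 := by
  have h1 : IsSquare ((w * N : ℕ) : ℚ) := ⟨r, by push_cast; rw [h, sq]⟩
  rw [Rat.isSquare_natCast_iff] at h1
  obtain ⟨s, hs⟩ := h1
  have hd : w ∣ s := by
    have : w ∣ s ^ 2 := ⟨N, by rw [hs, sq]⟩
    exact (hw.dvd_pow_iff_dvd two_ne_zero).1 this
  obtain ⟨t, rfl⟩ := hd
  refine ⟨t, ?_⟩
  have hw0 : 0 < w := Nat.pos_of_ne_zero hw.ne_zero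
  have : w * N = w * (w * t ^ 2) := by rw [hs]; ring
  exact Nat.eq_of_mul_eq_mul_left hw0 this

lemma good1 {N : ℕ} (r : ℚ) (h : (N : ℚ) = r ^ 2) : Good N := by
  obtain ⟨n, hn⟩ := sqform (w := 1) squarefree_one r (by simpa using h)
  exact Or.inl ⟨n, by simpa using hn⟩
lemma good2 {N : ℕ} (r : ℚ) (h : (2 * N : ℚ) = r ^ 2) : Good N := by
  obtain ⟨n, hn⟩ := sqform (w := 2) (Nat.prime_two.prime.squarefree) r (by simpa using h)
  exact Or.inr (Or.inr (Or.inl ⟨n, by simpa using hn⟩))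
lemma good3 {N : ℕ} (r : ℚ) (h : (3 * N : ℚ) = r ^ 2) : Good N := by
  obtain ⟨n, hn⟩ := sqform (w := 3) (Nat.prime_three.prime.squarefree) r (by simpa using h)
  exact Or.inr (Or.inr (Or.inr (Or.inl ⟨n, by simpa using hn⟩)))
lemma good5 {N : ℕ} (r : ℚ) (h : (5 * N : ℚ) = r ^ 2) : Good N := by
  obtain ⟨n, hn⟩ := sqform (w := 5) (Nat.prime_five.prime.squarefree) r (by simpa using h)
  exact Or.inr (Or.inl ⟨2 * n, n, by rw [hn]; ring⟩)
lemma good6 {N : ℕ} (r : ℚ) (h : (6 * N : ℚ) = r ^ 2) : Good N := by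
  obtain ⟨n, hn⟩ := sqform (w := 6) (by rw [show 6 = 2 * 3 by rfl, Nat.squarefree_mul (by norm_num)]; exact ⟨Nat.prime_two.prime.squarefree, Nat.prime_three.prime.squarefree⟩) r (by simpa using h)
  exact Or.inr (Or.inr (Or.inr (Or.inr ⟨n, by simpa using hn⟩)))

/-- Niven for squares -/
lemma niven_sq {n j : ℕ} (q : ℚ) (h : cos (j * π / n) ^ 2 = q) :
    q = 0 ∨ q = 1/4 ∨ q = 1/2 ∨ q = 3/4 ∨ q = 1 := by
  have h2 : cos (2 * (j * π / n)) = ((2 * q - 1 : ℚ) : ℝ) := by rw [cos_two_mul, h]; push_cast; ring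
  have := niven (θ := 2 * (j * π / n)) ⟨2 * j / n, by push_cast; ring⟩ ⟨_, h2⟩
  rw [h2] at this
  simp only [Set.mem_insert_iff, Set.mem_singleton_iff] at this
  rcases this with h | h | h | h | h
  · left; have : (q:ℝ) = 0 := by push_cast at h; linarith
    exact_mod_cast this
  · right; left; have : (q:ℝ) = ((1/4 : ℚ) : ℝ) := by push_cast at h ⊢; linarith
    exact_mod_cast this
  · right; right; left; have : (q:ℝ) = ((1/2 : ℚ) : ℝ) := by push_cast at h ⊢; linarith
    exact_mod_cast this
  · right; right; right; left; have : (q:ℝ) = ((3/4 : ℚ) : ℝ) := by push_cast at h ⊢; linarith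
    exact_mod_cast this
  · right; right; right; right; have : (q:ℝ) = ((1 : ℚ) : ℝ) := by push_cast at h ⊢; linarith
    exact_mod_cast this

lemma niven_sq_sin {n j : ℕ} (q : ℚ) (h : sin (j * π / n) ^ 2 = q) :
    q = 0 ∨ q = 1/4 ∨ q = 1/2 ∨ q = 3/4 ∨ q = 1 := by
  have := niven_sq (n := n) (j := j) (1 - q) (by rw [cos_sq', h]; push_cast; ring)
  rcases this with h | h | h | h | h
  · right; right; right; right; linarith
  · right; right; right; left; linarith
  · right; right; left; linarith
  · right; left; linarith
  · left; linarith

lemma sqrt2_sq : √(2:ℝ) ^ 2 = 2 := Real.sq_sqrt (by norm_num)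
lemma sqrt3_sq : √(3:ℝ) ^ 2 = 3 := Real.sq_sqrt (by norm_num)
lemma sqrt5_sq : √(5:ℝ) ^ 2 = 5 := Real.sq_sqrt (by norm_num)
lemma irr3 : Irrational √(3:ℝ) := by simpa using Nat.prime_three.irrational_sqrt
lemma irr5 : Irrational √(5:ℝ) := by simpa using Nat.prime_five.irrational_sqrt

lemma irr_lin {x : ℝ} (hx : Irrational x) (a b : ℚ) (h : a + b * x = 0) : a = 0 ∧ b = 0 := by
  have hb : b = 0 := by
    by_contra hb
    apply hx
    refine ⟨-a / b, ?_⟩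
    have : (b : ℝ) ≠ 0 := by exact_mod_cast hb
    push_cast; field_simp; linarith
  subst hb
  refine ⟨?_, rfl⟩
  simpa using h

lemma not_sq_rat (r : ℚ) (d : ℕ) (hd : ¬ IsSquare d) : r ^ 2 ≠ d := by
  intro h
  apply hd
  rw [← Rat.isSquare_natCast_iff]
  exact ⟨r, by rw [← h, sq]⟩

lemma not_sq2 (r : ℚ) : r ^ 2 ≠ 2 := by
  have := not_sq_rat r 2 (by rintro ⟨s, hs⟩; have : s ≤ 2 := (by nlinarith); interval_cases s <;> omega); simpa using this
lemma not_sq3 (r : ℚ) : r ^ 2 ≠ 3 := by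
  have := not_sq_rat r 3 (by rintro ⟨s, hs⟩; have : s ≤ 2 := (by nlinarith); interval_cases s <;> omega); simpa using this
lemma not_sq6 (r : ℚ) : r ^ 2 ≠ 6 := by
  have := not_sq_rat r 6 (by rintro ⟨s, hs⟩; have : s ≤ 2 := (by nlinarith); interval_cases s <;> omega); simpa using this

lemma irr_lin23 (y A B C : ℚ) (h : y + A * √2 + B * √3 + C * (√2 * √3) = (0:ℝ)) :
    A = 0 ∧ B = 0 ∧ C = 0 := by
  have h2 := sqrt2_sq
  have h3 := sqrt3_sq
  have e : (y + B * √3) ^ 2 = 2 * (A + C * √3) ^ 2 := by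
    have : (y + B * √3) = - √2 * (A + C * √3) := by linarith
    rw [this, mul_pow, neg_sq, h2]
  have e2 : ((y ^ 2 + 3 * B ^ 2 - 2 * A ^ 2 - 6 * C ^ 2 : ℚ) : ℝ) + ((2 * y * B - 4 * A * C : ℚ):ℝ) * √3 = 0 := by
    push_cast; linear_combination e + (2 * C ^ 2 - B ^ 2) * h3
  obtain ⟨f1, f2⟩ := irr_lin irr3 _ _ e2
  have key : A ^ 2 - 3 * C ^ 2 = 0 := by
    by_contra hne
    have g : (y * A - 3 * B * C) * (B * A - y * C) = 0 := by
      linear_combination (-(A*C)/1) * f1 + (A^2 + 3*C^2)/2 * f2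
    have g2 : (y * A - 3 * B * C) ^ 2 + 3 * (B * A - y * C) ^ 2 = 2 * (A ^ 2 - 3 * C ^ 2) ^ 2 := by
      linear_combination (A^2+3*C^2) * f1 - 6 * A * C * f2
    rcases mul_eq_zero.1 g with g | g
    · rw [g] at g2
      apply not_sq6 (3 * (B * A - y * C) / (A ^ 2 - 3 * C ^ 2))
      field_simp; linarith
    · rw [g] at g2
      apply not_sq2 ((y * A - 3 * B * C) / (A ^ 2 - 3 * C ^ 2))
      field_simp; linarith
  have hC : C = 0 := by
    by_contra hC
    apply not_sq3 (A / C)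
    field_simp; linarith
  subst hC
  have hA : A = 0 := by simpa using key
  subst hA
  have : y ^ 2 + 3 * B ^ 2 = 0 := by linarith
  exact ⟨rfl, by nlinarith [sq_nonneg y, sq_nonneg B], rfl⟩

lemma lift_coprime {D E : ℕ} (hD : D ∣ E) (hE : E ≠ 0) (v : ℕ) (hv : v.Coprime D) :
    ∃ k : ℕ, k.Coprime E ∧ k ≡ v [MOD D] := by
  have : NeZero E := ⟨hE⟩
  obtain ⟨u, hu⟩ := ZMod.unitsMap_surjective hD (ZMod.unitOfCoprime v hv)
  refine ⟨(u : ZMod E).val, ZMod.val_coe_unit_coprime u, ?_⟩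
  rw [← ZMod.natCast_eq_natCast_iff]
  have := congrArg (fun x : (ZMod D)ˣ => (x : ZMod D)) hu
  simp [ZMod.unitsMap_def] at this
  rw [← this, ZMod.cast_eq_val]

lemma cos_modEq {L a b : ℕ} (hL : L ≠ 0) (h : a ≡ b [MOD L]) :
    cos (2 * π * a / L) = cos (2 * π * b / L) := by
  obtain ⟨c, hc⟩ := (Nat.modEq_iff_dvd.1 h)
  have hb : (b : ℝ) = a + L * c := by
    have : (b : ℤ) = a + L * c := by linarith
    exact_mod_cast this
  have : (L : ℝ) ≠ 0 := by exact_mod_cast hL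
  rw [hb, show 2 * π * (a + L * c) / L = 2 * π * a / L + c * (2 * π) by field_simp, cos_add_int_mul_two_pi]

lemma gap_aux {L : ℕ} (hL : L ≠ 0) (h : ∀ v : ℕ, v.Coprime L → -(1/2) < cos (2 * π * v / L)) :
    L = 1 ∨ L = 4 ∨ L = 6 ∨ L = 10 := by
  have key : ∀ v : ℕ, v.Coprime L → L ≤ 3 * v → 2 * v ≤ L → False := by
    intro v hv h1 h2
    have h3 := h v hv
    have hLp : (0:ℝ) < L := by exact_mod_cast Nat.pos_of_ne_zero hL
    have h1' : (L:ℝ) ≤ 3 * v := by exact_mod_cast h1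
    have h2' : 2 * (v:ℝ) ≤ L := by exact_mod_cast h2
    have : cos (2 * π * v / L) ≤ cos (2 * π / 3) := by
      apply cos_le_cos_of_nonneg_of_le_pi
      · positivity
      · rw [div_le_iff₀ hLp]; nlinarith [pi_pos]
      · rw [div_le_div_iff₀ (by norm_num) hLp]; nlinarith [pi_pos]
    rw [show 2 * π / 3 = π - π / 3 by ring, cos_pi_sub, cos_pi_div_three] at this
    linarith
  have hmod : L % 4 < 4 := Nat.mod_lt _ (by norm_num)
  obtain ⟨m, hm⟩ : ∃ m, m = L / 4 := ⟨_, rfl⟩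
  by_contra hcon
  push Not at hcon
  rcases Nat.even_or_odd L with ⟨s, hs⟩ | ⟨s, hs⟩
  · rcases Nat.even_or_odd s with ⟨t, ht⟩ | ⟨t, ht⟩
    · -- L = 4 t
      have : 2 ≤ t := by omega
      refine key (2 * t - 1) ?_ (by omega) (by omega)
      have hL4 : L = 2 * (2 * t - 1) + 2 := by omega
      rw [hL4, Nat.coprime_mul_right_add_right]
      rw [Nat.coprime_two_right]
      exact ⟨t - 1, by omega⟩
    · by_cases h0 : t = 0
      · exact key 1 (by simp) (by omega) (by omega)
      have : 3 ≤ t := by omega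
      refine key (2 * t - 1) ?_ (by omega) (by omega)
      have hL4 : L = 2 * (2 * t - 1) + 2 ^ 2 := by omega
      rw [hL4, Nat.coprime_mul_right_add_right]
      apply Nat.Coprime.pow_right
      rw [Nat.coprime_two_right]
      exact ⟨t - 1, by omega⟩
  · refine key s ?_ (by omega) (by omega)
    rw [hs, mul_comm 2 s]
    simp

lemma gap {D E u : ℕ} (hD : D ≠ 0) (hE : E ≠ 0) (hDE : D ∣ E)
    (h : ∀ k : ℕ, k.Coprime E → -(1/2) < cos (k * (2 * π * u / D))) :
    ∃ L j : ℕ, (L = 1 ∨ L = 4 ∨ L = 6 ∨ L = 10) ∧ j.Coprime L ∧ u * L = j * D := by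
  obtain ⟨g, j, L, hg, hjL, rfl, rfl⟩ := Nat.exists_coprime' (m := u) (n := D)
    (Nat.gcd_pos_of_pos_right _ (Nat.pos_of_ne_zero hD))
  have hL : L ≠ 0 := by rintro rfl; simp at hD
  refine ⟨L, j, gap_aux hL ?_, hjL, by ring⟩
  intro v hv
  have hL0 : NeZero L := ⟨hL⟩
  obtain ⟨w, hw⟩ : ∃ w : ℕ, w.Coprime L ∧ w * j ≡ v [MOD L] := by
    let U := ZMod.unitOfCoprime v hv * (ZMod.unitOfCoprime j hjL)⁻¹
    refine ⟨(U : ZMod L).val, ZMod.val_coe_unit_coprime U, ?_⟩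
    rw [← ZMod.natCast_eq_natCast_iff]
    push_cast
    rw [ZMod.natCast_zmod_val]
    have h1 : U * ZMod.unitOfCoprime j hjL = ZMod.unitOfCoprime v hv := by simp [U]
    have := congrArg (fun x : (ZMod L)ˣ => (x : ZMod L)) h1
    simpa using this
  obtain ⟨k, hk, hkw⟩ := lift_coprime (D := L) (E := E) ((Dvd.intro _ rfl).trans hDE) hE w hw.1
  have h1 := h k hk
  have h2 : k * j ≡ v [MOD L] := (Nat.ModEq.mul_right j hkw).trans hw.2
  rw [← cos_modEq hL h2]
  convert h1 using 2
  have : (L : ℝ) ≠ 0 := by exact_mod_cast hL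
  have : (g : ℝ) ≠ 0 := by exact_mod_cast hg.ne'
  push_cast; field_simp

lemma rho_comp (τ : ℂ →+* ℂ) {x : ℝ} (hx : TR x) : rho (τ.comp τ) x = rho τ (rho τ x) := by
  change (τ (τ x)).re = _
  rw [hx.eq τ]; rfl

lemma rho_sqrt_pm (τ : ℂ →+* ℂ) {x : ℝ} (q : ℚ) (hq : 0 ≤ q) (h : x ^ 2 = q) :
    rho τ x = x ∨ rho τ x = - x := by
  have hx := TR_of_sq q hq h
  apply sq_eq_sq_iff_eq_or_eq_neg.1
  rw [← rho_sq τ hx, h, rho_rat]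

/-- an automorphism fixing all quadratic irrationalities and flipping sin 36, sin 72 -/
lemma exists_tau2 : ∃ τ : ℂ →+* ℂ, (∀ (x : ℝ) (q : ℚ), 0 ≤ q → x ^ 2 = q → rho τ x = x) ∧
    (∀ y : ℝ, y ^ 2 = (5 - √5) / 8 ∨ y ^ 2 = (5 + √5) / 8 → TR y → rho τ y = - y) := by
  obtain ⟨τ, hτ⟩ := exists_flip 5 irr5 (by rw [sqrt5_sq]; norm_num)
  have h5 : TR √5 := TR_of_sq 5 (by norm_num) (by rw [sqrt5_sq]; norm_num)
  refine ⟨τ.comp τ, ?_, ?_⟩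
  · intro x q hq h
    rw [rho_comp _ (TR_of_sq q hq h)]
    rcases rho_sqrt_pm τ q hq h with h1 | h1
    · rw [h1, h1]
    · rw [h1, rho_neg, h1, neg_neg]
  · intro y hy hT
    rw [rho_comp _ hT]
    set z := rho τ y
    have hs5 := sqrt5_sq
    have hs5p : 0 < √(5:ℝ) := by positivity
    have hs5l : √(5:ℝ) < 5 := by nlinarith
    have hz : z ^ 2 = rho τ (y ^ 2) := (rho_sq τ hT).symm
    have r8 : ∀ x : ℝ, rho τ (x / 8) = rho τ x / 8 := by
      intro x
      have := rho_ratmul τ (1/8) x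
      rw [show x / 8 = ((1/8 : ℚ) : ℝ) * x by push_cast; ring, this]; push_cast; ring
    have c1 : rho τ ((5 - √5) / 8) = (5 + √5) / 8 := by
      rw [r8, rho_sub, hτ, rho_ofNat]; ring
    have c2 : rho τ ((5 + √5) / 8) = (5 - √5) / 8 := by
      rw [r8, rho_add, hτ, rho_ofNat]; ring
    have hy0 : y ≠ 0 := by
      rintro rfl
      rcases hy with h | h <;> nlinarith
    have hyz : (y * z = √5 / 4) ∨ (y * z = - (√5 / 4)) := by
      apply sq_eq_sq_iff_eq_or_eq_neg.1
      rw [mul_pow, hz]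
      rcases hy with h | h
      · rw [h, c1]; nlinarith
      · rw [h, c2]; nlinarith
    have r4 : rho τ (√5 / 4) = - (√5 / 4) := by
      have := rho_ratmul τ (1/4) √5
      rw [show √5 / 4 = ((1/4 : ℚ) : ℝ) * √5 by push_cast; ring, this, hτ]; push_cast; ring
    have hz0 : z ≠ 0 := rho_ne τ hT hy0
    have : z * rho τ z = - (y * z) := by
      rw [← rho_mul τ hT]
      rcases hyz with h | h
      · rw [h, r4]
      · rw [h, rho_neg, r4]
    have : z * (rho τ z + y) = 0 := by linarith
    rcases mul_eq_zero.1 this with h | h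
    · exact absurd h hz0
    · linarith

/-- The arithmetic data extracted from a tiling. -/
structure Dat (n N : ℕ) (m M : Fin 3 → ℕ) (cnt side : Fin 3 → Fin 3 → ℕ) (lam : ℝ) : Prop where
  n720 : 720 ∣ n
  npos : 0 < n
  Npos : 0 < N
  mpos : ∀ t, 0 < m t
  msum : ∑ t, m t = n
  Mpos : ∀ t, 0 < M t
  Msum : ∑ t, M t = n
  lpos : 0 < lam
  H1 : ∀ l, lam * sin (M l * π / n) = ∑ t, side l t * sin (m t * π / n)
  H2 : lam ^ 2 * ∏ l, sin (M l * π / n) = N * ∏ t, sin (m t * π / n)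
  H3 : ∀ k : ℕ, k.Coprime (2 * n) → 0 < ∏ t, sin (k * (m t * π / n)) →
    ∀ l, ∑ t, cnt l t * (k * m t % n) = k * M l % n
  H4 : ∀ k : ℕ, k.Coprime (2 * n) → ∀ l t, 0 < side l t →
    0 < (∑ s, side l s * sin (k * (m s * π / n))) * sin (k * (m t * π / n))

namespace Dat
variable {n N : ℕ} {m M : Fin 3 → ℕ} {cnt side : Fin 3 → Fin 3 → ℕ} {lam : ℝ}

lemma permT (d : Dat n N m M cnt side lam) (σ : Equiv.Perm (Fin 3)) :
    Dat n N (m ∘ σ) M (fun l t => cnt l (σ t)) (fun l t => side l (σ t)) lam where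
  n720 := d.n720
  npos := d.npos
  Npos := d.Npos
  mpos := fun t => d.mpos _
  msum := by rw [← d.msum]; exact Equiv.sum_comp σ m
  Mpos := d.Mpos
  Msum := d.Msum
  lpos := d.lpos
  H1 := fun l => by rw [d.H1 l]; exact (Equiv.sum_comp σ (fun t => side l t * sin (m t * π / n))).symm
  H2 := by rw [d.H2]; congr 1; exact (Equiv.prod_comp σ (fun t => sin (m t * π / n))).symm
  H3 := fun k hk h l => by
    rw [← d.H3 k hk (by rw [← Equiv.prod_comp σ]; exact h) l]
    exact Equiv.sum_comp σ (fun t => cnt l t * (k * m t % n))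
  H4 := fun k hk l t h => by
    have := d.H4 k hk l (σ t) h
    rw [← Equiv.sum_comp σ] at this; exact this

lemma permL (d : Dat n N m M cnt side lam) (σ : Equiv.Perm (Fin 3)) :
    Dat n N m (M ∘ σ) (fun l t => cnt (σ l) t) (fun l t => side (σ l) t) lam where
  n720 := d.n720
  npos := d.npos
  Npos := d.Npos
  mpos := d.mpos
  msum := d.msum
  Mpos := fun t => d.Mpos _
  Msum := by rw [← d.Msum]; exact Equiv.sum_comp σ M
  lpos := d.lpos
  H1 := fun l => d.H1 _
  H2 := by rw [← d.H2]; congr 1; exact (Equiv.prod_comp σ (fun t => sin (M t * π / n)))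
  H3 := fun k hk h l => d.H3 k hk h (σ l)
  H4 := fun k hk l t h => d.H4 k hk (σ l) t h

lemma m_lt (d : Dat n N m M cnt side lam) (t : Fin 3) : m t < n := by
  have := d.msum; rw [Fin.sum_univ_three] at this
  have h0 := d.mpos 0; have h1 := d.mpos 1; have h2 := d.mpos 2
  fin_cases t <;> simp <;> omega

lemma M_lt (d : Dat n N m M cnt side lam) (t : Fin 3) : M t < n := by
  have := d.Msum; rw [Fin.sum_univ_three] at this
  have h0 := d.Mpos 0; have h1 := d.Mpos 1; have h2 := d.Mpos 2
  fin_cases t <;> simp <;> omega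

end Dat

lemma ang_pos {n j : ℕ} (h0 : 0 < j) (hj : j < n) : 0 < sin (j * π / n) := by
  have hn : (0:ℝ) < n := by exact_mod_cast (h0.trans hj)
  have hj' : (j:ℝ) < n := by exact_mod_cast hj
  have h0' : (0:ℝ) < j := by exact_mod_cast h0
  apply sin_pos_of_pos_of_lt_pi
  · have := pi_pos; positivity
  · rw [div_lt_iff₀ hn]; nlinarith [pi_pos]

namespace Dat
variable {n N : ℕ} {m M : Fin 3 → ℕ} {cnt side : Fin 3 → Fin 3 → ℕ} {lam : ℝ}

lemma a_pos (d : Dat n N m M cnt side lam) (t : Fin 3) : 0 < sin (m t * π / n) :=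
  ang_pos (d.mpos t) (d.m_lt t)
lemma S_pos (d : Dat n N m M cnt side lam) (t : Fin 3) : 0 < sin (M t * π / n) :=
  ang_pos (d.Mpos t) (d.M_lt t)

lemma H4' (d : Dat n N m M cnt side lam) (τ : ℂ →+* ℂ) (l t : Fin 3) (h : 0 < side l t) :
    0 < rho τ (lam * sin (M l * π / n)) * rho τ (sin (m t * π / n)) := by
  obtain ⟨k, hk, hz⟩ := tau_pow d.npos.ne' τ
  obtain ⟨ε, hε, hs, -⟩ := rho_trig k τ hz
  have := d.H4 k hk l t h
  rw [d.H1, Fin.sum_univ_three, rho_add, rho_add, rho_natmul, rho_natmul, rho_natmul, hs, hs, hs, hs]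
  rw [Fin.sum_univ_three] at this
  have e2 : ε * ε = 1 := by rcases hε with h | h <;> rw [h] <;> norm_num
  nlinarith

lemma TRX (d : Dat n N m M cnt side lam) (l : Fin 3) : TR (lam * sin (M l * π / n)) := by
  rw [d.H1, Fin.sum_univ_three]
  have h := fun t => (TR.nat (side l t)).mul (TR_sin d.npos.ne' (m t))
  exact ((h 0).add (h 1)).add (h 2)

lemma TRlam (d : Dat n N m M cnt side lam) : TR lam := by
  have := (d.TRX 0).div (TR_sin d.npos.ne' (M 0))
  rwa [mul_div_cancel_right₀ _ (d.S_pos 0).ne'] at this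

end Dat

lemma sin_mod {n k x : ℕ} (hn : 0 < n) :
    sin (k * (x * π / n)) = (-1) ^ (k * x / n) * sin ((k * x % n : ℕ) * π / n) := by
  have h := Nat.div_add_mod (k * x) n
  have h' : (k * x : ℝ) = n * (k * x / n : ℕ) + (k * x % n : ℕ) := by exact_mod_cast h.symm
  have hn' : (n:ℝ) ≠ 0 := by exact_mod_cast hn.ne'
  have : (k * (x * π / n) : ℝ) = (k * x % n : ℕ) * π / n + (k * x / n : ℕ) * π := by
    rw [← mul_div_assoc, ← mul_assoc, h']; field_simp; ring
  rw [this, sin_add_nat_mul_pi]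

lemma sgn_sum {n k : ℕ} (x : Fin 3 → ℕ) (hn : 0 < n) (hk : k.Coprime (2 * n)) (hx : ∀ t, 0 < x t)
    (hs : ∑ t, x t = n) :
    (∀ t, 0 < k * x t % n) ∧ (0 < ∏ t, sin (k * (x t * π / n)) ↔ ∑ t, k * x t % n = n) ∧
      ∏ t, sin (k * (x t * π / n)) ≠ 0 := by
  have hkodd : Odd k := (Nat.Coprime.coprime_dvd_right (Dvd.intro _ rfl) hk).symm.odd_of_left
  have hkn : k.Coprime n := Nat.Coprime.coprime_dvd_right (Dvd.intro_left _ rfl) hk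
  have hs' := hs
  rw [Fin.sum_univ_three] at hs'
  have h0 := hx 0
  have h1 := hx 1
  have h2 := hx 2
  have hlt : ∀ t, x t < n := by intro t; fin_cases t <;> simp <;> omega
  have hpos : ∀ t, 0 < k * x t % n := by
    intro t
    rw [Nat.pos_iff_ne_zero]
    intro h
    have := (hkn.symm.dvd_of_dvd_mul_left (Nat.dvd_of_mod_eq_zero h))
    exact absurd (Nat.le_of_dvd (hx t) this) (not_le.2 (hlt t))
  have hsin : ∀ t, 0 < sin ((k * x t % n : ℕ) * π / n) := fun t => ang_pos (hpos t) (Nat.mod_lt _ hn)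
  have hprod : ∏ t, sin (k * (x t * π / n)) =
      (-1) ^ (∑ t, k * x t / n) * ∏ t, sin ((k * x t % n : ℕ) * π / n) := by
    rw [← Finset.prod_pow_eq_pow_sum, ← Finset.prod_mul_distrib]
    exact Finset.prod_congr rfl fun t _ => sin_mod hn
  have hpp : 0 < ∏ t, sin ((k * x t % n : ℕ) * π / n) := Finset.prod_pos fun t _ => hsin t
  have htot : n * (∑ t, k * x t / n) + ∑ t, k * x t % n = k * n := by
    rw [Finset.mul_sum, ← Finset.sum_add_distrib, ← hs, Finset.mul_sum]
    exact Finset.sum_congr rfl fun t _ => Nat.div_add_mod _ _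
  refine ⟨hpos, ?_, ?_⟩
  · have hdvd : n ∣ ∑ t, k * x t % n := by
      have : n ∣ n * (∑ t, k * x t / n) + ∑ t, k * x t % n := htot ▸ Dvd.intro_left _ rfl
      exact (Nat.dvd_add_right (Dvd.intro _ rfl)).1 this
    obtain ⟨s, hs⟩ := hdvd
    have hsb : ∑ t, k * x t % n < n * 3 := by
      rw [Fin.sum_univ_three]
      have := fun t => Nat.mod_lt (k * x t) hn
      have h0 := this 0; have h1 := this 1; have h2 := this 2
      omega
    have hsb2 : 0 < ∑ t, k * x t % n := Finset.sum_pos (fun t _ => hpos t) ⟨0, by simp⟩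
    have hs3 : s < 3 := by rw [hs] at hsb; exact Nat.lt_of_mul_lt_mul_left hsb
    have hs0 : 0 < s := by rw [hs] at hsb2; exact Nat.pos_of_mul_pos_left hsb2
    have hsk : (∑ t, k * x t / n) + s = k := by
      rw [hs, ← mul_add, mul_comm k n] at htot
      exact Nat.eq_of_mul_eq_mul_left hn htot
    rw [hprod, hs]
    obtain ⟨c, hc⟩ := hkodd
    interval_cases s
    · have : Even (∑ t, k * x t / n) := ⟨c, by omega⟩
      rw [this.neg_one_pow, one_mul]; simp [hpp]
    · have : Odd (∑ t, k * x t / n) := by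
        rw [Nat.odd_iff]; omega
      rw [this.neg_one_pow]
      constructor
      · intro h; linarith
      · intro h; omega
  · rw [hprod]
    exact mul_ne_zero (pow_ne_zero _ (by norm_num)) hpp.ne'

lemma coprime_sub {n k : ℕ} (hk : k.Coprime (2 * n)) (hle : k ≤ 2 * n) : (2 * n - k).Coprime (2 * n) := by
  rw [Nat.coprime_self_sub_left hle]; exact hk

lemma sin_refl {n k x : ℕ} (hn : 0 < n) (hle : k ≤ 2 * n) :
    sin ((2 * n - k : ℕ) * (x * π / n)) = - sin (k * (x * π / n)) := by
  have hn' : (n:ℝ) ≠ 0 := by exact_mod_cast hn.ne'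
  rw [Nat.cast_sub hle, show (((2 * n : ℕ) : ℝ) - k) * (x * π / n) = x * (2 * π) - k * (x * π / n) by
    push_cast; field_simp]
  rw [sin_nat_mul_two_pi_sub]

namespace Dat
variable {n N : ℕ} {m M : Fin 3 → ℕ} {cnt side : Fin 3 → Fin 3 → ℕ} {lam : ℝ}

lemma H3b (d : Dat n N m M cnt side lam) (k : ℕ) (hk : k.Coprime (2 * n))
    (h : 0 < ∏ t, sin (k * (m t * π / n))) : ∑ l, ∑ t, cnt l t * (k * m t % n) = n := by
  rw [Finset.sum_congr rfl (fun l _ => d.H3 k hk h l)]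
  obtain ⟨h1, h2, -⟩ := sgn_sum M d.npos hk d.Mpos d.Msum
  apply h2.1
  obtain ⟨τ, hτ⟩ := exists_tau d.npos.ne' k hk
  obtain ⟨ε, hε, hs, -⟩ := rho_trig k τ hτ
  have e := congrArg (rho τ) d.H2
  have TS := fun j => TR_sin d.npos.ne' j
  simp only [Fin.prod_univ_three] at e h ⊢
  rw [rho_natmul, rho_mul τ (by rw [sq]; exact d.TRlam.mul d.TRlam), rho_sq τ d.TRlam,
    rho_mul τ ((TS _).mul (TS _)), rho_mul τ (TS _), rho_mul τ ((TS _).mul (TS _)), rho_mul τ (TS _)] at e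
  simp only [hs] at e
  have hl := rho_ne τ d.TRlam d.lpos.ne'
  have hl2 : 0 < rho τ lam ^ 2 := by positivity
  have hN : (0:ℝ) < N := by exact_mod_cast d.Npos
  have e3 : ε ≠ 0 := by rcases hε with h | h <;> rw [h] <;> norm_num
  have e' : rho τ lam ^ 2 * (sin (k * (M 0 * π / n)) * sin (k * (M 1 * π / n)) * sin (k * (M 2 * π / n)))
    = N * (sin (k * (m 0 * π / n)) * sin (k * (m 1 * π / n)) * sin (k * (m 2 * π / n))) := by
    apply mul_left_cancel₀ (pow_ne_zero 3 e3)
    linear_combination e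
  have : 0 < rho τ lam ^ 2 * (sin (k * (M 0 * π / n)) * sin (k * (M 1 * π / n)) * sin (k * (M 2 * π / n))) := by
    rw [e']; positivity
  exact (mul_pos_iff_of_pos_left hl2).1 this

/-- normalised residues for each Galois conjugate -/
lemma PK (d : Dat n N m M cnt side lam) (k : ℕ) (hk : k.Coprime (2 * n)) (hk2 : k ≤ 2 * n) :
    ∃ k', (k' = k ∨ k' = 2 * n - k) ∧ (∀ t, 0 < k' * m t % n) ∧ ∑ t, k' * m t % n = n ∧
      ∑ t, (∑ l, cnt l t) * (k' * m t % n) = n := by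
  have key : ∀ k : ℕ, k.Coprime (2 * n) → 0 < ∏ t, sin (k * (m t * π / n)) →
     (∀ t, 0 < k * m t % n) ∧ ∑ t, k * m t % n = n ∧ ∑ t, (∑ l, cnt l t) * (k * m t % n) = n := by
    intro k hk h
    obtain ⟨h1, h2, h3⟩ := sgn_sum m d.npos hk d.mpos d.msum
    refine ⟨h1, h2.1 h, ?_⟩
    have := d.H3b k hk h
    rw [Finset.sum_comm] at this
    refine Eq.trans ?_ this
    exact Finset.sum_congr rfl fun t _ => by rw [Finset.sum_mul]
  obtain ⟨h1, h2, h3⟩ := sgn_sum m d.npos hk d.mpos d.msum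
  rcases lt_or_gt_of_ne h3 with h | h
  · refine ⟨2 * n - k, Or.inr rfl, key _ (coprime_sub hk hk2) ?_⟩
    have e : ∏ t, sin ((2 * n - k : ℕ) * (m t * π / n)) = ∏ t, (- sin (k * (m t * π / n))) :=
      Finset.prod_congr rfl fun t _ => sin_refl d.npos hk2
    rw [e]
    simp only [Fin.prod_univ_three] at h ⊢
    linarith
  · exact ⟨k, Or.inl rfl, key k hk h⟩

lemma H3one (d : Dat n N m M cnt side lam) (l : Fin 3) : ∑ t, cnt l t * m t = M l := by
  have h := d.H3 1 (by simp) (by simp only [Nat.cast_one, one_mul]; exact Finset.prod_pos fun t _ => d.a_pos t) l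
  simp only [one_mul] at h
  rw [Nat.mod_eq_of_lt (d.M_lt l)] at h
  rw [← h]
  exact Finset.sum_congr rfl fun t _ => by rw [Nat.mod_eq_of_lt (d.m_lt t)]

lemma P1 (d : Dat n N m M cnt side lam) : ∑ t, (∑ l, cnt l t) * m t = n := by
  rw [← d.Msum, ← Finset.sum_congr rfl (fun l _ => d.H3one l), Finset.sum_comm]
  exact Finset.sum_congr rfl fun t _ => by rw [Finset.sum_mul]

lemma PKE (d : Dat n N m M cnt side lam) {g E : ℕ} (hgE : n = g * E) (v : ℕ)
    (hv : v.Coprime (2 * E)) : ∃ (w : ℕ) (y : Fin 3 → ℕ), (w ≡ v [MOD E] ∨ w + v ≡ 0 [MOD E]) ∧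
      (∀ t, 0 < y t) ∧ ∑ t, y t = n ∧ ∑ t, (∑ l, cnt l t) * y t = n ∧
      (∀ t j, m t = g * j → y t = g * (w * j % E)) := by
  have hn := d.npos
  obtain ⟨k0, hk0, hkv0⟩ := lift_coprime (D := 2 * E) (E := 2 * n) ⟨g, by rw [hgE]; ring⟩ (by omega) v hv
  obtain ⟨k, hk, hkv, hkn⟩ : ∃ k : ℕ, k.Coprime (2 * n) ∧ k ≡ v [MOD E] ∧ k ≤ 2 * n := by
    refine ⟨k0 % (2 * n), ?_, ?_, (Nat.mod_lt _ (by omega)).le⟩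
    · rw [Nat.Coprime, ← Nat.gcd_rec, Nat.gcd_comm]; exact hk0
    · have h1 : k0 % (2 * n) ≡ k0 [MOD E] := (Nat.mod_modEq k0 (2 * n)).of_dvd ⟨2 * g, by rw [hgE]; ring⟩
      exact h1.trans (hkv0.of_dvd ⟨2, by ring⟩)
  obtain ⟨k', h1, h2, h3, h4⟩ := d.PK k hk hkn
  refine ⟨k', fun t => k' * m t % n, ?_, h2, h3, h4, ?_⟩
  · rcases h1 with rfl | rfl
    · left; exact hkv
    · right
      have : 2 * n - k + v ≡ 2 * n - k + k [MOD E] := Nat.ModEq.add_left _ hkv.symm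
      refine this.trans ?_
      rw [Nat.sub_add_cancel hkn]
      exact (Nat.modEq_zero_iff_dvd).2 ⟨2 * g, by rw [hgE]; ring⟩
  · intro t j hj
    simp only []
    rw [hj, hgE, ← Nat.mul_mod_mul_left]; congr 1; ring

/-- if all normalised residues are < n/3 then the angle is one of four -/
lemma small (d : Dat n N m M cnt side lam) (t : Fin 3)
    (h : ∀ y : Fin 3 → ℕ, (∀ t, 0 < y t) → ∑ t, (∑ l, cnt l t) * y t = n → 3 * y t < n) :
    4 * m t = n ∨ 6 * m t = n ∨ 10 * m t = n ∨ 10 * m t = 3 * n := by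
  have hn := d.npos
  have hn' : (0:ℝ) < n := by exact_mod_cast hn
  have hg := gap (D := n) (E := 2 * n) (u := m t) (by omega) (by omega) (by simp) (by
    intro k0 hk0
    have hk : (k0 % (2 * n)).Coprime (2 * n) := by
      rw [Nat.Coprime, ← Nat.gcd_rec, Nat.gcd_comm]; exact hk0
    obtain ⟨k', h1, h2, h3, h4⟩ := d.PK _ hk (Nat.mod_lt _ (by omega)).le
    have h5 := h _ h2 h4
    have e1 : cos (k0 * (2 * π * m t / n)) = cos (2 * π * (k0 * m t : ℕ) / n) := by
      congr 1; push_cast; ring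
    have h6 : k0 % (2 * n) ≡ k0 [MOD n] := (Nat.mod_modEq k0 (2 * n)).of_dvd (by simp)
    have e2 : cos (k0 * (2 * π * m t / n)) = cos (2 * π * (k' * m t % n : ℕ) / n) := by
      rw [e1, cos_modEq hn.ne' (Nat.mod_modEq (k' * m t) n)]
      rw [← cos_modEq hn.ne' (Nat.ModEq.mul_right (m t) h6)]
      rcases h1 with h1 | h1
      · rw [h1]
      · rw [h1]
        have hle : k0 % (2 * n) ≤ 2 * n := (Nat.mod_lt _ (by omega)).le
        push_cast [Nat.cast_sub hle]
        rw [show 2 * π * ((2 * (n:ℝ) - (k0 % (2 * n) : ℕ)) * m t) / n =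
          (2 * m t : ℕ) * (2 * π) - 2 * π * ((k0 % (2 * n) : ℕ) * m t) / n by push_cast; field_simp]
        rw [cos_nat_mul_two_pi_sub]
    rw [e2]
    have h5' : 3 * ((k' * m t % n : ℕ) : ℝ) < n := by exact_mod_cast h5
    have : cos (2 * π / 3) < cos (2 * π * (k' * m t % n : ℕ) / n) := by
      apply cos_lt_cos_of_nonneg_of_le_pi
      · have := pi_pos; positivity
      · linarith [pi_pos]
      · rw [div_lt_div_iff₀ hn' (by norm_num)]; nlinarith [pi_pos]
    rw [show 2 * π / 3 = π - π / 3 by ring, cos_pi_sub, cos_pi_div_three] at this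
    linarith)
  obtain ⟨L, j, hL, hj, hu⟩ := hg
  have h1 := h m d.mpos d.P1
  have hm := d.mpos t
  have hjL : 3 * j < L := by
    by_contra hc
    push Not at hc
    have : L * n ≤ 3 * j * n := Nat.mul_le_mul_right _ hc
    have hL0 : 0 < L := by omega
    nlinarith
  have hj0 : 0 < j := by
    rw [Nat.pos_iff_ne_zero]; rintro rfl
    have : 0 < m t * L := Nat.mul_pos hm (by omega)
    omega
  rcases hL with rfl | rfl | rfl | rfl
  · omega
  · have : j < 4 := by omega
    interval_cases j <;> omega
  · have : j < 4 := by omega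
    interval_cases j <;> omega
  · have : j < 4 := by omega
    interval_cases j
    · omega
    · norm_num at hj
    · omega

end Dat

lemma ang_eq {n j : ℕ} (p q : ℕ) (hn : 0 < n) (hq : 0 < q := by norm_num) (h : j * q = p * n := by omega) :
    (j * π / n : ℝ) = p * π / q := by
  have hn' : (n:ℝ) ≠ 0 := by exact_mod_cast hn.ne'
  have hq' : (q:ℝ) ≠ 0 := by exact_mod_cast hq.ne'
  have h' : (j * q : ℝ) = p * n := by exact_mod_cast h
  field_simp; linear_combination h'

lemma univ3 : ∀ s u t : Fin 3, s ≠ u → t ≠ u → s ≠ t → (Finset.univ : Finset (Fin 3)) = {s, u, t} := by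
  decide

lemma law_cos {x y z : ℝ} (h : x + y + z = π) :
    sin x ^ 2 = sin y ^ 2 + sin z ^ 2 - 2 * sin y * sin z * cos x := by
  have hx : x = π - (y + z) := by linarith
  rw [hx, sin_pi_sub, cos_pi_sub, sin_add, cos_add]
  have h1 := sin_sq_add_cos_sq y
  have h2 := sin_sq_add_cos_sq z
  linear_combination sin z ^ 2 * h1 + sin y ^ 2 * h2

lemma simcore_aux {n N s u t : ℕ} {lam : ℝ} (hn : 0 < n) (hs : 0 < s) (hu : 0 < u) (ht : 0 < t)
    (h : s + u + t = n) (hN : 0 < N) (hl : lam ^ 2 = N) (p q : ℕ)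
    (h1 : lam * sin (s * π / n) = p * sin (u * π / n))
    (h2 : lam * sin (t * π / n) = q * sin (u * π / n)) :
    Good N ∨ cos (s * π / n) = 0 := by
  have hN' : (0:ℝ) < N := by exact_mod_cast hN
  have hn' : (n:ℝ) ≠ 0 := by exact_mod_cast hn.ne'
  have hsum : (s * π / n + u * π / n + t * π / n : ℝ) = π := by
    rw [← h] at hn' ⊢; push_cast at hn' ⊢; field_simp
  have as := ang_pos (n := n) hs (by omega)
  have au := ang_pos (n := n) hu (by omega)
  have at' := ang_pos (n := n) ht (by omega)
  have lc := law_cos hsum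
  have hl0 : lam ≠ 0 := by rintro rfl; simp at hl; linarith
  have hq : (q:ℝ) ≠ 0 := by
    intro h0; rw [h0, zero_mul] at h2
    exact (mul_ne_zero hl0 at'.ne') h2
  have e1 : (p:ℝ) ^ 2 = N + q ^ 2 - 2 * lam * q * cos (s * π / n) := by
    apply mul_left_cancel₀ (pow_ne_zero 2 au.ne')
    have a1 : lam ^ 2 * sin (s * π / n) ^ 2 = p ^ 2 * sin (u * π / n) ^ 2 := by
      rw [← mul_pow, h1, mul_pow]
    have a2 : lam ^ 2 * sin (t * π / n) ^ 2 = q ^ 2 * sin (u * π / n) ^ 2 := by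
      rw [← mul_pow, h2, mul_pow]
    rw [← hl]
    linear_combination -a1 + lam ^ 2 * lc + a2 - 2 * lam * sin (u * π / n) * cos (s * π / n) * h2
  have hqQ : (q:ℚ) ≠ 0 := by exact_mod_cast hq
  have hNQ : (N:ℚ) ≠ 0 := by exact_mod_cast hN.ne'
  set x : ℚ := (N + q ^ 2 - p ^ 2) / q with hx
  have e2 : cos (s * π / n) ^ 2 = ((x ^ 2 / (4 * N) : ℚ) : ℝ) := by
    have : 2 * lam * cos (s * π / n) = (x : ℝ) := by
      rw [hx]; push_cast; field_simp; linarith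
    push_cast
    rw [← this, mul_pow, mul_pow, hl]; field_simp; norm_num
  rcases niven_sq _ e2 with h | h | h | h | h
  · right; rw [h] at e2; simpa using e2
  · left; apply good1 x; field_simp at h; linarith
  · left; apply good2 x; field_simp at h; linarith
  · left; apply good3 x; field_simp at h; linarith
  · left; apply good1 (x / 2); field_simp at h; linarith

lemma simcore {n N s u t : ℕ} {lam : ℝ} (hn : 0 < n) (hs : 0 < s) (hu : 0 < u) (ht : 0 < t)
    (h : s + u + t = n) (hN : 0 < N) (hl : lam ^ 2 = N) (p q : ℕ)
    (h1 : lam * sin (s * π / n) = p * sin (u * π / n))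
    (h2 : lam * sin (t * π / n) = q * sin (u * π / n)) : Good N := by
  rcases simcore_aux hn hs hu ht h hN hl p q h1 h2 with h3 | h3
  · exact h3
  rcases simcore_aux hn ht hu hs (by omega) hN hl q p h2 h1 with h4 | h4
  · exact h4
  exfalso
  have hn' : (n:ℝ) ≠ 0 := by exact_mod_cast hn.ne'
  have hsum : (u * π / n : ℝ) = π - (s * π / n + t * π / n) := by
    rw [← h] at hn' ⊢; push_cast at hn' ⊢; field_simp; ring
  have au := ang_pos (n := n) hu (by omega)
  rw [hsum, sin_pi_sub, sin_add, h3, h4] at au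
  simp at au

lemma rat_or_flip {x : ℝ} (q : ℚ) (h : x ^ 2 = q) :
    (∃ r : ℚ, x = r) ∨ ∃ τ : ℂ →+* ℂ, rho τ x = -x := by
  by_cases hx : Irrational x
  · right; exact exists_flip q hx h
  · left; unfold Irrational at hx; push Not at hx; obtain ⟨r, hr⟩ := hx; exact ⟨r, hr.symm⟩

namespace Dat
variable {n N : ℕ} {m M : Fin 3 → ℕ} {cnt side : Fin 3 → Fin 3 → ℕ} {lam : ℝ}

lemma similar (d : Dat n N m m cnt side lam) : Good N := by
  have hl : lam ^ 2 = N := by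
    have hp : 0 < ∏ t, sin (m t * π / n) := Finset.prod_pos fun t _ => d.a_pos t
    exact mul_right_cancel₀ hp.ne' d.H2
  have hsum := d.msum
  rw [Fin.sum_univ_three] at hsum
  rcases rat_or_flip (N : ℚ) (by rw [hl]; simp) with ⟨r, hr⟩ | ⟨τ, hτ⟩
  · apply good1 r
    rw [hr] at hl
    exact_mod_cast hl.symm
  have TA : ∀ t, TR (sin (m t * π / n)) := fun t => TR_sin d.npos.ne' _
  set a' : Fin 3 → ℝ := fun t => rho τ (sin (m t * π / n)) with ha'
  have hne : ∀ t, a' t ≠ 0 := fun t => rho_ne τ (TA t) (d.a_pos t).ne'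
  have hz : ∀ l t, 0 ≤ a' l * a' t → side l t = 0 := by
    intro l t h
    by_contra h0
    have := d.H4' τ l t (Nat.pos_of_ne_zero h0)
    rw [rho_mul τ d.TRlam, hτ] at this
    have h2 : 0 < -lam * (a' l * a' t) := by simpa [ha', mul_assoc] using this
    nlinarith [d.lpos]
  have hd : ∀ t, side t t = 0 := fun t => hz t t (mul_self_nonneg _)
  have core : ∀ s u t : Fin 3, s ≠ u → t ≠ u → s ≠ t → 0 ≤ a' s * a' t → Good N := by
    intro s u t h1 h2 h3 h4
    have e1 := d.H1 s
    have e2 := d.H1 t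
    have z1 := hz s t h4
    have z2 := hz t s (by rw [mul_comm]; exact h4)
    have z3 := hd s
    have z4 := hd t
    have hm : ∀ f : Fin 3 → ℝ, ∑ i, f i = f s + f u + f t := by
      intro f
      rw [univ3 s u t h1 h2 h3, Finset.sum_insert (by simp [h1, h3]), Finset.sum_insert (by simpa using h2.symm),
        Finset.sum_singleton, add_assoc]
    have hm' : m s + m u + m t = n := by
      have := hm (fun i => (m i : ℝ))
      rw [Fin.sum_univ_three] at this
      rw [← hsum]; exact_mod_cast this.symm
    rw [hm] at e1 e2
    simp only [z1, z2, z3, z4] at e1 e2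
    refine simcore d.npos (d.mpos s) (d.mpos u) (d.mpos t) hm' d.Npos hl (side s u) (side t u) ?_ ?_
    · rw [e1]; simp
    · rw [e2]; simp
  by_cases h01 : 0 ≤ a' 0 * a' 1
  · exact core 0 2 1 (by decide) (by decide) (by decide) h01
  by_cases h02 : 0 ≤ a' 0 * a' 2
  · exact core 0 1 2 (by decide) (by decide) (by decide) h02
  refine core 1 0 2 (by decide) (by decide) (by decide) ?_
  push Not at h01 h02
  have : 0 < (a' 0) ^ 2 * (a' 1 * a' 2) := by nlinarith
  have h0 : 0 < (a' 0) ^ 2 := by have := hne 0; positivity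
  exact ((mul_pos_iff_of_pos_left h0).1 this).le

lemma similar' (d : Dat n N m M cnt side lam) (σ : Equiv.Perm (Fin 3)) (h : ∀ t, M (σ t) = m t) : Good N := by
  have d' := d.permL σ
  have : M ∘ σ = m := funext h
  rw [this] at d'
  exact d'.similar

/-- (2,2,0) with corner (2α, β, β) -/
lemma right_case (d : Dat n N m M cnt side lam) (h01 : 2 * (m 0 + m 1) = n)
    (hM0 : M 0 = 2 * m 0) (hM1 : M 1 = m 1) (hM2 : M 2 = m 1) : Good N := by
  have hn' : (n:ℝ) ≠ 0 := by exact_mod_cast d.npos.ne'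
  have hsum := d.msum
  rw [Fin.sum_univ_three] at hsum
  have h2 : 2 * m 2 = n := by omega
  have e2 : sin (m 2 * π / n) = 1 := by
    rw [ang_eq 1 2 d.npos (by norm_num) (by omega)]; simp
  have eb : sin (m 1 * π / n) = cos (m 0 * π / n) := by
    rw [← sin_pi_div_two_sub]; congr 1
    have h' : (2 * (m 0 + m 1) : ℝ) = n := by exact_mod_cast h01
    field_simp; linear_combination h'
  have a0 := d.a_pos 0
  have a1 := d.a_pos 1
  have TA : ∀ t, TR (sin (m t * π / n)) := fun t => TR_sin d.npos.ne' _
  have H2 := d.H2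
  have X0 := d.H1 0
  have X1 := d.H1 1
  have q0 := fun τ => d.H4' τ 0
  have q1 := fun τ => d.H4' τ 1
  have TX := d.TRX 1
  rw [Fin.sum_univ_three] at X0 X1
  simp only [Fin.prod_univ_three] at H2
  rw [hM0, hM1, hM2] at H2
  rw [hM1] at X1 q1 TX
  rw [hM0] at X0 q0
  have es : sin ((2 * m 0 : ℕ) * π / n) = 2 * sin (m 0 * π / n) * sin (m 1 * π / n) := by
    rw [eb, ← sin_two_mul]; congr 1; push_cast; ring
  rw [es] at H2 X0 q0
  rw [e2] at H2 X0 X1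
  have TA0 := TA 0
  have TA1 := TA 1
  set a := sin (m 0 * π / n) with ha
  set b := sin (m 1 * π / n) with hb
  set μ := lam * b with hμ
  have hμ0 : 0 < μ := mul_pos d.lpos a1
  have hμ2 : μ ^ 2 = ((N / 2 : ℚ) : ℝ) := by
    push_cast
    apply mul_left_cancel₀ (mul_pos a0 a1).ne'
    rw [hμ]; linear_combination (1/2) * H2
  have fin : ∀ (p : ℕ) (j : ℕ), μ = p * sin (j * π / n) → p ≠ 0 → Good N := by
    intro p j hp hp0
    have hpR : (p:ℝ) ≠ 0 := by exact_mod_cast hp0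
    have hpQ : (p:ℚ) ≠ 0 := by exact_mod_cast hp0
    have hNQ : (N:ℚ) ≠ 0 := by exact_mod_cast d.Npos.ne'
    have : sin (j * π / n) ^ 2 = ((N / (2 * p ^ 2) : ℚ) : ℝ) := by
      rw [hp, mul_pow] at hμ2; push_cast at hμ2 ⊢; field_simp; linarith
    rcases niven_sq_sin _ this with h | h | h | h | h
    · exfalso; field_simp at h; simp [d.Npos.ne'] at h
    · apply good2 p; field_simp at h; linarith
    · apply good1 p; field_simp at h; linarith
    · apply good6 (3 * p); field_simp at h; linarith
    · apply good2 (2 * p); field_simp at h; linarith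
  rcases rat_or_flip _ hμ2 with ⟨r, hr⟩ | ⟨τ, hτ⟩
  · apply good2 (2 * r)
    rw [hr] at hμ2
    have h3 : r ^ 2 = N / 2 := by exact_mod_cast hμ2
    linear_combination -4 * h3
  have hX0 : rho τ (lam * (2 * a * b)) = - (2 * μ * rho τ a) := by
    rw [show lam * (2 * a * b) = (2:ℕ) * (μ * a) by rw [hμ]; push_cast; ring, rho_natmul,
      rho_mul τ TX, hτ]; push_cast; ring
  have s12 : side 1 2 = 0 := by
    by_contra h
    have := q1 τ 2 (Nat.pos_of_ne_zero h)
    rw [hτ, e2, rho_one] at this; linarith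
  have s00 : side 0 0 = 0 := by
    by_contra h
    have := q0 τ 0 (Nat.pos_of_ne_zero h)
    rw [hX0, ← ha] at this
    nlinarith [mul_self_nonneg (rho τ a)]
  rw [s12] at X1
  rw [s00] at X0
  by_cases hp : side 1 0 = 0
  · rw [hp] at X1
    by_cases hq : side 1 1 = 0
    · rw [hq] at X1; simp at X1; linarith
    · exact fin (side 1 1) (m 1) (by rw [X1]; simp [hb]) hq
  · have h1 := q1 τ 0 (Nat.pos_of_ne_zero hp)
    rw [hτ, ← ha] at h1
    have ha0 : rho τ a < 0 := by nlinarith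
    by_cases hq : side 1 1 = 0
    · rw [hq] at X1
      exact fin (side 1 0) (m 0) (by rw [X1]; simp [ha]) hp
    have h3 := q1 τ 1 (Nat.pos_of_ne_zero hq)
    rw [hτ, ← hb] at h3
    have hb0 : rho τ b < 0 := by nlinarith
    have s01 : side 0 1 = 0 := by
      by_contra h
      have h2 := q0 τ 1 (Nat.pos_of_ne_zero h)
      rw [hX0, ← hb] at h2
      nlinarith [mul_pos hμ0 (mul_pos (neg_pos.2 ha0) (neg_pos.2 hb0))]
    rw [s01] at X0
    set r := side 0 2
    have hr : 2 * μ * a = r := by rw [hμ]; simp at X0; linarith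
    have hr0 : (r:ℝ) ≠ 0 := by rw [← hr]; positivity
    have hNQ : (N:ℚ) ≠ 0 := by exact_mod_cast d.Npos.ne'
    have hNR : (N:ℝ) ≠ 0 := by exact_mod_cast d.Npos.ne'
    have hrQ : (r:ℚ) ≠ 0 := by exact_mod_cast hr0
    have : sin (m 0 * π / n) ^ 2 = ((r ^ 2 / (2 * N) : ℚ) : ℝ) := by
      push_cast at hμ2 ⊢
      rw [← hr, mul_pow, mul_pow, hμ2, ← ha]; field_simp
    rcases niven_sq_sin _ this with h | h | h | h | h
    · exfalso; field_simp at h; simp at h; exact hrQ (by exact_mod_cast h)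
    · apply good2 (2 * r); field_simp at h; linarith
    · apply good1 r; field_simp at h; linarith
    · apply good6 (2 * r); field_simp at h; linarith
    · apply good2 r; field_simp at h; linarith

end Dat

lemma sin6 {n j f : ℕ} (hn : 0 < n) (h : 6 * j = f * n) (h0 : 0 < f) (h4 : f ≤ 4) :
    (f = 1 ∧ sin (j * π / n) = 1 / 2) ∨ (f = 2 ∧ sin (j * π / n) = √3 / 2) ∨
    (f = 3 ∧ sin (j * π / n) = 1) ∨ (f = 4 ∧ sin (j * π / n) = √3 / 2) := by
  rw [ang_eq f 6 hn (by norm_num) (by omega)]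
  interval_cases f
  · left; refine ⟨rfl, ?_⟩; rw [← sin_pi_div_six]; congr 1; push_cast; ring
  · right; left; refine ⟨rfl, ?_⟩; rw [← sin_pi_div_three]; congr 1; push_cast; ring
  · right; right; left; refine ⟨rfl, ?_⟩; rw [← sin_pi_div_two]; congr 1; push_cast; ring
  · right; right; right; refine ⟨rfl, ?_⟩; rw [← sin_pi_div_three, ← sin_pi_sub]; congr 1; push_cast; ring

lemma six_core {u v : ℚ} {X : ℝ} (w : ℚ) (h : X = u + v * √3) (hX : X ^ 2 = w) :
    w = u ^ 2 ∨ w = 3 * v ^ 2 := by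
  have : ((u ^ 2 + 3 * v ^ 2 - w : ℚ) : ℝ) + ((2 * u * v : ℚ) : ℝ) * √3 = 0 := by
    push_cast; rw [← hX, h]; linear_combination (-v^2) * sqrt3_sq
  obtain ⟨h1, h2⟩ := irr_lin irr3 _ _ this
  rcases mul_eq_zero.1 h2 with h3 | h3
  · have : u = 0 := by simpa using h3
    right; rw [this] at h1; linarith
  · left; rw [h3] at h1; linarith

lemma good_mul {N : ℕ} (r x : ℚ) (h : r * N = x ^ 2)
    (hr : r = 1 ∨ r = 2 ∨ r = 1/2 ∨ r = 3 ∨ r = 1/3 ∨ r = 6 ∨ r = 3/2 ∨ r = 2/3 ∨ r = 1/6 ∨ r = 1/4) : Good N := by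
  rcases hr with rfl | rfl | rfl | rfl | rfl | rfl | rfl | rfl | rfl | rfl
  · exact good1 x (by linarith)
  · exact good2 x (by linarith)
  · exact good2 (2 * x) (by linarith)
  · exact good3 x (by linarith)
  · exact good3 (3 * x) (by linarith)
  · exact good6 x (by linarith)
  · exact good6 (2 * x) (by linarith)
  · exact good6 (3 * x) (by linarith)
  · exact good6 (6 * x) (by linarith)
  · exact good1 (2 * x) (by linarith)

lemma prod6 {n : ℕ} {m f : Fin 3 → ℕ} (hn : 0 < n) (hm : ∀ t, 0 < m t) (hs : ∑ t, m t = n)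
    (hf : ∀ t, 6 * m t = f t * n) : ∃ p : ℚ, (∏ t, sin (m t * π / n)) = p * √3 ∧
      ∃ c : ℚ, ∃ l, 4 * sin (m l * π / n) ^ 2 = c ∧
      ((p = 1/4 ∧ c = 1) ∨ (p = 1/8 ∧ c = 1) ∨ (p = 3/8 ∧ c = 3)) := by
  have hpos : ∀ t, 0 < f t := by
    intro t; rw [Nat.pos_iff_ne_zero]; intro h; have := hf t; rw [h] at this; have := hm t; omega
  have hs6 : f 0 + f 1 + f 2 = 6 := by
    rw [Fin.sum_univ_three] at hs
    have h0 := hf 0; have h1 := hf 1; have h2 := hf 2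
    apply Nat.eq_of_mul_eq_mul_right hn
    rw [add_mul, add_mul]; omega
  have h0 := hpos 0; have h1 := hpos 1; have h2 := hpos 2
  have t0 := sin6 hn (hf 0) h0 (by omega)
  have t1 := sin6 hn (hf 1) h1 (by omega)
  have t2 := sin6 hn (hf 2) h2 (by omega)
  have h3 := sqrt3_sq
  rw [Fin.prod_univ_three]
  rcases t0 with ⟨e0, s0⟩ | ⟨e0, s0⟩ | ⟨e0, s0⟩ | ⟨e0, s0⟩ <;>
  rcases t1 with ⟨e1, s1⟩ | ⟨e1, s1⟩ | ⟨e1, s1⟩ | ⟨e1, s1⟩ <;>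
  rcases t2 with ⟨e2, s2⟩ | ⟨e2, s2⟩ | ⟨e2, s2⟩ | ⟨e2, s2⟩ <;>
  first
  | (exfalso; omega)
  | (refine ⟨1/4, ?_, 1, 0, ?_, ?_⟩; rw [s0, s1, s2]; push_cast; ring1; rw [s0]; push_cast; ring1; norm_num; done)
  | (refine ⟨1/4, ?_, 1, 1, ?_, ?_⟩; rw [s0, s1, s2]; push_cast; ring1; rw [s1]; push_cast; ring1; norm_num; done)
  | (refine ⟨1/4, ?_, 1, 2, ?_, ?_⟩; rw [s0, s1, s2]; push_cast; ring1; rw [s2]; push_cast; ring1; norm_num; done)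
  | (refine ⟨1/8, ?_, 1, 0, ?_, ?_⟩; rw [s0, s1, s2]; push_cast; ring1; rw [s0]; push_cast; ring1; norm_num; done)
  | (refine ⟨1/8, ?_, 1, 1, ?_, ?_⟩; rw [s0, s1, s2]; push_cast; ring1; rw [s1]; push_cast; ring1; norm_num; done)
  | (refine ⟨1/8, ?_, 1, 2, ?_, ?_⟩; rw [s0, s1, s2]; push_cast; ring1; rw [s2]; push_cast; ring1; norm_num; done)
  | (refine ⟨3/8, ?_, 3, 2, ?_, ?_⟩; rw [s0, s1, s2]; push_cast; linear_combination √3 / 8 * h3; rw [s2]; push_cast; linear_combination h3; norm_num)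

namespace Dat
variable {n N : ℕ} {m M : Fin 3 → ℕ} {cnt side : Fin 3 → Fin 3 → ℕ} {lam : ℝ}

lemma six (d : Dat n N m M cnt side lam) (f F : Fin 3 → ℕ) (hf : ∀ t, 6 * m t = f t * n)
    (hF : ∀ t, 6 * M t = F t * n) : Good N := by
  obtain ⟨p, hp, cp, lp, -, hpc⟩ := prod6 d.npos d.mpos d.msum hf
  obtain ⟨P, hP, c, l, hl, hPc⟩ := prod6 d.npos d.Mpos d.Msum hF
  have H2 := d.H2
  rw [hp, hP] at H2
  have s3 : √(3:ℝ) ≠ 0 := by positivity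
  have hPp : P ≠ 0 := by rcases hPc with ⟨h, -⟩ | ⟨h, -⟩ | ⟨h, -⟩ <;> rw [h] <;> norm_num
  have hPR : (P:ℝ) ≠ 0 := by exact_mod_cast hPp
  have hlam : lam ^ 2 = N * p / P := by
    field_simp; apply mul_right_cancel₀ s3; linear_combination H2
  have hpos : ∀ t, 0 < f t := by
    intro t; rw [Nat.pos_iff_ne_zero]; intro h; have h1 := hf t; rw [h] at h1; have := d.mpos t; omega
  have hle : ∀ t, f t ≤ 5 := by
    intro t; by_contra h; have h1 := hf t; have := d.m_lt t
    have : 6 * n ≤ f t * n := Nat.mul_le_mul_right _ (by omega)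
    omega
  have hs6 : f 0 + f 1 + f 2 = 6 := by
    have hs := d.msum
    rw [Fin.sum_univ_three] at hs
    have h0 := hf 0; have h1 := hf 1; have h2 := hf 2
    apply Nat.eq_of_mul_eq_mul_right d.npos
    rw [add_mul, add_mul]; omega
  have hh := hpos 0; have hh1 := hpos 1; have hh2 := hpos 2
  have uv : ∀ t, ∃ u v : ℚ, 2 * sin (m t * π / n) = u + v * √3 := by
    intro t
    have : f t ≤ 4 := by fin_cases t <;> simp <;> omega
    rcases sin6 d.npos (hf t) (hpos t) this with ⟨-, s⟩ | ⟨-, s⟩ | ⟨-, s⟩ | ⟨-, s⟩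
    · exact ⟨1, 0, by rw [s]; push_cast; ring⟩
    · exact ⟨0, 1, by rw [s]; push_cast; ring⟩
    · exact ⟨2, 0, by rw [s]; push_cast; ring⟩
    · exact ⟨0, 1, by rw [s]; push_cast; ring⟩
  choose u v huv using uv
  have hX : 2 * (lam * sin (M l * π / n)) = ((∑ t, side l t * u t : ℚ) : ℝ) + ((∑ t, side l t * v t : ℚ) : ℝ) * √3 := by
    rw [d.H1 l]; simp only [Fin.sum_univ_three]; push_cast
    linear_combination side l 0 * huv 0 + side l 1 * huv 1 + side l 2 * huv 2
  have hX2 : (2 * (lam * sin (M l * π / n))) ^ 2 = ((N * p / P * c : ℚ) : ℝ) := by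
    push_cast; rw [← hlam, ← hl]; ring
  rcases six_core _ hX hX2 with h | h
  · refine good_mul (p / P * c) _ (by rw [← h]; ring) ?_
    rcases hpc with ⟨h1, -⟩ | ⟨h1, -⟩ | ⟨h1, -⟩ <;> rcases hPc with ⟨h2, h3⟩ | ⟨h2, h3⟩ | ⟨h2, h3⟩ <;>
      rw [h1, h2, h3] <;> norm_num
  · refine good_mul (p / P * c / 3) (∑ t, side l t * v t) (by linear_combination h / 3) ?_
    rcases hpc with ⟨h1, -⟩ | ⟨h1, -⟩ | ⟨h1, -⟩ <;> rcases hPc with ⟨h2, h3⟩ | ⟨h2, h3⟩ | ⟨h2, h3⟩ <;>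
      rw [h1, h2, h3] <;> norm_num

end Dat

lemma sin10_3 : sin (3 * π / 10) = (1 + √5) / 4 := by
  rw [← cos_pi_div_five, ← cos_pi_div_two_sub]; congr 1; ring
lemma cos25 : cos (2 * π / 5) = (√5 - 1) / 4 := by
  rw [show 2 * π / 5 = 2 * (π / 5) by ring, cos_two_mul, cos_pi_div_five]
  linear_combination (1/8) * sqrt5_sq
lemma sin10_1 : sin (π / 10) = (√5 - 1) / 4 := by
  rw [← cos25, ← cos_pi_div_two_sub]; congr 1; ring
lemma sin10_2 : sin (2 * π / 10) ^ 2 = (5 - √5) / 8 := by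
  rw [show 2 * π / 10 = π / 5 by ring, sin_sq, cos_pi_div_five]; linear_combination (-1/16) * sqrt5_sq
lemma sin10_6 : sin (6 * π / 10) ^ 2 = (5 + √5) / 8 := by
  rw [show 6 * π / 10 = π - 2 * π / 5 by ring, sin_pi_sub, sin_sq, cos25]; linear_combination (-1/16) * sqrt5_sq

lemma tens_core {N p q r : ℕ} {X y : ℝ} (hy : y ^ 2 = (5-√5)/8 ∨ y ^ 2 = (5+√5)/8) (hT : TR y)
    (hX : X = p * ((√5 - 1) / 4) + q * ((1 + √5) / 4) + r * y) (hX2 : X ^ 2 = ((N / 4 : ℚ) : ℝ)) : Good N := by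
  obtain ⟨τ, h1, h2⟩ := exists_tau2
  have h5 : rho τ √5 = √5 := h1 √5 5 (by norm_num) (by rw [sqrt5_sq]; norm_num)
  have hy' := h2 y hy hT
  have hXX := h1 X _ (by positivity) hX2
  have e1 : (p * ((√5 - 1) / 4) + q * ((1 + √5) / 4) + r * y : ℝ) =
      ((-p/4 + q/4 : ℚ) : ℝ) + ((p/4 + q/4 : ℚ) : ℝ) * √5 + r * y := by push_cast; ring
  rw [e1] at hX
  have e2 := congrArg (rho τ) hX
  rw [hXX, rho_add, rho_add, rho_rat, rho_ratmul, rho_natmul, h5, hy'] at e2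
  have hr : (r:ℝ) * y = 0 := by linarith
  rw [hr] at hX
  have e3 : ((5 * (p/4+q/4)^2 + (-p/4+q/4)^2 - N/4 : ℚ) : ℝ) + ((2 * (p/4+q/4)*(-p/4+q/4) : ℚ) : ℝ) * √5 = 0 := by
    push_cast at hX2 hX ⊢; rw [← hX2, hX]; linear_combination (-(p/4+q/4)^2) * sqrt5_sq
  obtain ⟨f1, f2⟩ := irr_lin irr5 _ _ e3
  have hp : (p:ℚ) = q := by
    rcases mul_eq_zero.1 f2 with h | h
    · have a1 : (0:ℚ) ≤ p := by positivity
      have a2 : (0:ℚ) ≤ q := by positivity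
      linarith
    · linarith
  apply good5 (5 * p)
  rw [← hp] at f1; linear_combination (-20) * f1

namespace Dat
variable {n N : ℕ} {m M : Fin 3 → ℕ} {cnt side : Fin 3 → Fin 3 → ℕ} {lam : ℝ}

lemma tens (d : Dat n N m M cnt side lam) (h : (10 * m 0 = n ∧ 10 * m 1 = 7 * n) ∨ (10 * m 0 = 3 * n ∧ 10 * m 1 = n))
    (hM0 : M 0 = m 0 + m 1) (hM1 : M 1 = m 0) (hM2 : M 2 = m 0) : Good N := by
  have hn := d.npos
  have hn' : (n:ℝ) ≠ 0 := by exact_mod_cast hn.ne'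
  have hs := d.msum
  rw [Fin.sum_univ_three] at hs
  have H2 := d.H2
  simp only [Fin.prod_univ_three] at H2
  have e : sin ((m 0 + m 1 : ℕ) * π / n) = sin (m 2 * π / n) := by
    rw [← sin_pi_sub]; congr 1
    have : (m 0 + m 1 + m 2 : ℝ) = n := by exact_mod_cast hs
    field_simp; push_cast; linarith
  rw [hM0, hM1, hM2, e] at H2
  have a0 := d.a_pos 0
  have a1 := d.a_pos 1
  have a2 := d.a_pos 2
  have hX := d.H1 1
  rw [hM1, Fin.sum_univ_three] at hX
  have T2 : TR (sin (m 2 * π / n)) := TR_sin hn.ne' _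
  have key : sin (m 0 * π / n) * sin (m 1 * π / n) = 1 / 4 → (lam * sin (m 0 * π / n)) ^ 2 = ((N / 4 : ℚ) : ℝ) := by
    intro h
    apply mul_left_cancel₀ a2.ne'
    push_cast
    linear_combination H2 + N * sin (m 2 * π / n) * h
  rcases h with ⟨h0, h1⟩ | ⟨h0, h1⟩
  · have s0 : sin (m 0 * π / n) = (√5 - 1) / 4 := by
      rw [ang_eq 1 10 hn, ← sin10_1]; simp
    have s1 : sin (m 1 * π / n) = (1 + √5) / 4 := by
      rw [ang_eq 7 10 hn, ← sin10_3, ← sin_pi_sub]; congr 1; push_cast; ring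
    have s2 : sin (m 2 * π / n) ^ 2 = (5 - √5) / 8 := by
      rw [ang_eq 2 10 hn, ← sin10_2]; push_cast; rfl
    refine tens_core (p := side 1 0) (q := side 1 1) (r := side 1 2) (Or.inl s2) T2 ?_ (key ?_)
    · rw [← s1, ← s0]; exact hX
    · rw [s0, s1]; linear_combination (1/16) * sqrt5_sq
  · have s0 : sin (m 0 * π / n) = (1 + √5) / 4 := by
      rw [ang_eq 3 10 hn, ← sin10_3]; push_cast; rfl
    have s1 : sin (m 1 * π / n) = (√5 - 1) / 4 := by
      rw [ang_eq 1 10 hn, ← sin10_1]; simp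
    have s2 : sin (m 2 * π / n) ^ 2 = (5 + √5) / 8 := by
      rw [ang_eq 6 10 hn, ← sin10_6]; push_cast; rfl
    refine tens_core (p := side 1 1) (q := side 1 0) (r := side 1 2) (Or.inr s2) T2 ?_ (key ?_)
    · rw [← s1, ← s0]; linarith
    · rw [s0, s1]; linear_combination (1/16) * sqrt5_sq

lemma eqcase_aux (d : Dat n N m M cnt side lam) (h0 : 3 * m 0 = n) (hM : ∀ l, M l = m 0)
    (hle : m 2 ≤ m 1) : Good N := by
  have hn := d.npos
  have hn' : (n:ℝ) ≠ 0 := by exact_mod_cast hn.ne'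
  have hNR : (0:ℝ) < N := by exact_mod_cast d.Npos
  have hs := d.msum
  rw [Fin.sum_univ_three] at hs
  have p2 := d.mpos 2
  have H2 := d.H2
  have hX := d.H1 0
  have TX := d.TRX 0
  simp only [Fin.prod_univ_three, hM] at H2
  have s0 : sin (m 0 * π / n) = √3 / 2 := by
    rw [ang_eq 1 3 hn, ← sin_pi_div_three]; simp
  rw [hM, Fin.sum_univ_three] at hX
  rw [hM] at TX
  have a1 := d.a_pos 1
  have a2 := d.a_pos 2
  rw [s0] at H2 hX TX
  have h3 := sqrt3_sq
  have h30 : 0 < √(3:ℝ) := by positivity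
  have e2 : (lam * (√3 / 2)) ^ 2 = N * (sin (m 1 * π / n) * sin (m 2 * π / n)) := by
    apply mul_left_cancel₀ (show √3 / 2 ≠ 0 by positivity)
    linear_combination H2
  obtain ⟨u, hu⟩ : ∃ u, m 1 = m 2 + u := ⟨m 1 - m 2, by omega⟩
  have ebc : sin (m 1 * π / n) * sin (m 2 * π / n) = ((1/4 : ℚ):ℝ) + ((1/2 : ℚ) : ℝ) * cos (u * π / n) := by
    have t1 : (u * π / n : ℝ) = m 1 * π / n - m 2 * π / n := by rw [hu]; push_cast; ring
    have t2 : cos (m 1 * π / n + m 2 * π / n) = - (1/2) := by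
      rw [show (m 1 * π / n + m 2 * π / n : ℝ) = (m 1 + m 2 : ℕ) * π / n by push_cast; ring,
        ang_eq 2 3 hn, ← cos_pi_div_three, ← cos_pi_sub]
      congr 1; push_cast; ring
    rw [cos_add] at t2
    rw [t1, cos_sub]; push_cast; linear_combination (-1/2) * t2
  have hpos : ∀ τ : ℂ →+* ℂ, 0 < rho τ (sin (m 1 * π / n) * sin (m 2 * π / n)) := by
    intro τ
    have h1 := congrArg (rho τ) e2
    rw [rho_natmul, rho_sq τ TX] at h1
    have h2 := rho_ne τ TX (mul_pos d.lpos (by positivity : 0 < √3 / 2)).ne'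
    have : 0 < rho τ (lam * (√3 / 2)) ^ 2 := by positivity
    rw [h1] at this
    exact (mul_pos_iff_of_pos_left hNR).1 this
  obtain ⟨L, j, hL, hj, hu2⟩ := gap (D := 2 * n) (E := 2 * n) (u := u) (by omega) (by omega) dvd_rfl (by
    intro k hk
    obtain ⟨τ, hτ⟩ := exists_tau hn.ne' k hk
    obtain ⟨ε, hε, -, hc⟩ := rho_trig k τ hτ
    have h1 := hpos τ
    rw [ebc, rho_add, rho_rat, rho_ratmul, hc] at h1
    have : (k * (2 * π * u / (2 * n : ℕ)) : ℝ) = k * (u * π / n) := by push_cast; field_simp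
    rw [this]; push_cast at h1; linarith)
  have h3j : 3 * j < L := by
    have : 0 < L := by omega
    by_contra hc
    have h5 : n * L ≤ n * (3 * j) := Nat.mul_le_mul_left _ (by omega)
    have h6 : 3 * u < 2 * n := by omega
    nlinarith
  have hu3 : u = 0 ∨ 2 * u = n ∨ 3 * u = n ∨ 5 * u = n ∨ 5 * u = 3 * n := by
    rcases hL with rfl | rfl | rfl | rfl
    · have : j = 0 := by omega
      subst this; omega
    · have : j < 2 := by omega
      interval_cases j <;> omega
    · have : j < 2 := by omega
      interval_cases j <;> omega
    · have : j < 4 := by omega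
      interval_cases j
      · omega
      · omega
      · norm_num at hj
      · omega
  have quint : ∀ (y sd c5 : ℝ) (a b : ℚ), sd = a + b * √5 → TR y →
      (y ^ 2 = (5-√5)/8 ∨ y ^ 2 = (5+√5)/8) →
      sin (m 1 * π / n) = √3 / 2 * y + sd / 2 → sin (m 2 * π / n) = √3 / 2 * y - sd / 2 →
      0 < c5 → c5 = 1/4 + √5/4 ∨ c5 = -1/4 + √5/4 →
      sin (m 1 * π / n) * sin (m 2 * π / n) = c5 ^ 2 → False := by
    intro y sd c5 a b hsd Ty hy sb sc hc0 hc hbc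
    obtain ⟨τ, h1, h2⟩ := exists_tau2
    have h5 : rho τ √5 = √5 := h1 √5 5 (by norm_num) (by rw [sqrt5_sq]; norm_num)
    have h3' : rho τ √3 = √3 := h1 √3 3 (by norm_num) (by rw [sqrt3_sq]; norm_num)
    have hsN : √(N:ℝ) ^ 2 = N := Real.sq_sqrt hNR.le
    have hN' : rho τ √(N:ℝ) = √(N:ℝ) := h1 √(N:ℝ) N (by positivity) (by rw [hsN]; norm_num)
    have TN : TR √(N:ℝ) := TR_of_sq N (by positivity) (by rw [hsN]; norm_num)
    have T3 : TR √(3:ℝ) := TR_of_sq 3 (by positivity) (by rw [sqrt3_sq]; norm_num)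
    have hy' := h2 y hy Ty
    have hXe : lam * (√3 / 2) = √(N:ℝ) * c5 := by
      have : (lam * (√3 / 2)) ^ 2 = (√(N:ℝ) * c5) ^ 2 := by rw [e2, hbc, mul_pow, hsN]
      have hl := d.lpos
      exact (pow_left_inj₀ (by positivity) (by positivity) two_ne_zero).1 this
    have hc5 : rho τ c5 = c5 := by
      rcases hc with h | h
      · rw [h, show (1/4 + √5/4 : ℝ) = ((1/4:ℚ):ℝ) + ((1/4:ℚ):ℝ) * √5 by push_cast; ring,
          rho_add, rho_rat, rho_ratmul, h5]
      · rw [h, show (-1/4 + √5/4 : ℝ) = ((-1/4:ℚ):ℝ) + ((1/4:ℚ):ℝ) * √5 by push_cast; ring,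
          rho_add, rho_rat, rho_ratmul, h5]
    have hX2 : lam * (√3 / 2) = ((side 0 0 / 2 : ℚ) : ℝ) * √3 + ((side 0 1 / 2 + side 0 2 / 2 : ℚ) : ℝ) * (√3 * y)
        + ((side 0 1 / 2 - side 0 2 / 2 : ℚ) : ℝ) * (a + b * √5) := by
      rw [hX, sb, sc, hsd]; push_cast; ring
    have h6 := congrArg (rho τ) hX2
    rw [hXe, rho_mul τ TN, hN', hc5, ← hXe, rho_add, rho_add, rho_ratmul, rho_ratmul, rho_ratmul, rho_add, rho_rat,
      rho_ratmul, rho_mul τ T3, h5, h3', hy'] at h6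
    have h7 : ((side 0 1 / 2 + side 0 2 / 2 : ℚ) : ℝ) * (√3 * y) = 0 := by linarith
    have hy0 : y ≠ 0 := by
      rintro rfl
      have : √(5:ℝ) < 3 := by rw [Real.sqrt_lt' (by norm_num)]; norm_num
      have : 0 ≤ √(5:ℝ) := by positivity
      rcases hy with h | h <;> linarith
    have h8 : ((side 0 1 / 2 + side 0 2 / 2 : ℚ) : ℝ) = 0 := by
      rcases mul_eq_zero.1 h7 with h | h
      · exact h
      · exact absurd h (mul_ne_zero h30.ne' hy0)
    have h9 : (side 0 1 : ℝ) = 0 ∧ (side 0 2 : ℝ) = 0 := by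
      push_cast at h8
      have : (0:ℝ) ≤ side 0 1 := by positivity
      have : (0:ℝ) ≤ side 0 2 := by positivity
      constructor <;> linarith
    rw [h9.1, h9.2] at hX
    have h10 : N * c5 ^ 2 = ((3 * side 0 0 ^ 2 / 4 : ℚ) : ℝ) := by
      rw [← hbc, ← e2, hX]; push_cast; linear_combination (side 0 0 ^ 2 / 4 : ℝ) * h3
    have hNQ : (N:ℚ) ≠ 0 := by exact_mod_cast d.Npos.ne'
    rcases hc with h | h
    · have : ((N * (3/8) - 3 * side 0 0 ^ 2 / 4 : ℚ) : ℝ) + ((N * (1/8) : ℚ) : ℝ) * √5 = 0 := by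
        rw [h] at h10; push_cast at h10 ⊢; linear_combination h10 - N / 16 * sqrt5_sq
      have := (irr_lin irr5 _ _ this).2
      apply hNQ; linarith
    · have : ((N * (3/8) - 3 * side 0 0 ^ 2 / 4 : ℚ) : ℝ) + ((N * (-1/8) : ℚ) : ℝ) * √5 = 0 := by
        rw [h] at h10; push_cast at h10 ⊢; linear_combination h10 - N / 16 * sqrt5_sq
      have := (irr_lin irr5 _ _ this).2
      apply hNQ; linarith
  rcases hu3 with h | h | h | h | h
  · refine d.similar' 1 fun t => ?_
    rw [hM]; fin_cases t <;> simp <;> omega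
  · have c12 : cos (u * π / n) = 0 := by
      rw [ang_eq 1 2 hn]; simp
    rw [c12] at ebc
    have h2 := sqrt2_sq
    have sb : sin (m 1 * π / n) = √2 * √3 / 4 + √2 / 4 := by
      rw [ang_eq 7 12 hn, show ((7:ℕ) * π / (12:ℕ) : ℝ) = π / 3 + π / 4 by push_cast; ring,
        sin_add, sin_pi_div_three, cos_pi_div_three, sin_pi_div_four, cos_pi_div_four]; ring
    have sc : sin (m 2 * π / n) = √2 * √3 / 4 - √2 / 4 := by
      rw [ang_eq 1 12 hn, show ((1:ℕ) * π / (12:ℕ) : ℝ) = π / 3 - π / 4 by push_cast; ring,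
        sin_sub, sin_pi_div_three, cos_pi_div_three, sin_pi_div_four, cos_pi_div_four]; ring
    rw [sb, sc] at hX
    set p : ℚ := ((side 0 0 : ℕ) : ℚ) with hp
    set e : ℚ := (side 0 1 + side 0 2) / 2 with he
    set f : ℚ := (side 0 1 - side 0 2) / 2 with hf
    have hX' : 2 * (lam * (√3 / 2)) = p * √3 + e * (√2 * √3) + f * √2 := by
      rw [hX, hp, he, hf]; push_cast; ring
    have hX2 : (2 * (lam * (√3 / 2))) ^ 2 = N := by
      rw [mul_pow, e2, ebc]; push_cast; ring
    have : ((3 * p ^ 2 + 6 * e ^ 2 + 2 * f ^ 2 - N : ℚ):ℝ) + ((6 * p * e : ℚ):ℝ) * √2 + ((4 * e * f : ℚ):ℝ) * √3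
        + ((2 * p * f : ℚ):ℝ) * (√2 * √3) = 0 := by
      push_cast; rw [← hX2, hX']
      linear_combination (-p^2 - 2 * p * e * √2 - e ^ 2 * √2^2) * h3 + (-3 * e ^ 2 - 2 * e * f * √3 - f^2) * h2
    have hy := irr_lin23 _ _ _ _ this
    obtain ⟨g1, g2, g3⟩ := hy
    rw [g1, g2, g3] at this
    have g0 : (3 * p ^ 2 + 6 * e ^ 2 + 2 * f ^ 2 - N : ℚ) = 0 := by
      have : ((3 * p ^ 2 + 6 * e ^ 2 + 2 * f ^ 2 - N : ℚ):ℝ) = 0 := by push_cast at this ⊢; linarith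
      exact_mod_cast this
    by_cases hE : e = 0
    · have i1 : (0:ℚ) ≤ side 0 1 := by positivity
      have i2 : (0:ℚ) ≤ side 0 2 := by positivity
      have hF : f = 0 := by rw [hf]; rw [he] at hE; linarith
      apply good3 (3 * p); rw [hE, hF] at g0; linear_combination (-3) * g0
    · have hP : p = 0 := by
        rcases mul_eq_zero.1 g1 with h | h
        · linarith
        · exact absurd h hE
      have hF : f = 0 := by
        rcases mul_eq_zero.1 g2 with h | h
        · exact absurd (by linarith) hE
        · exact h
      apply good6 (6 * e); rw [hP, hF] at g0; linear_combination (-6) * g0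
  · exact d.six ![2, 3, 1] ![2, 2, 2] (fun t => by fin_cases t <;> simp <;> omega)
      (fun t => by rw [hM]; fin_cases t <;> simp <;> omega)
  · exfalso
    refine quint (sin (6 * π / 10)) (sin (π / 10)) ((1 + √5) / 4) (-1/4) (1/4) ?_ ?_ (Or.inr sin10_6) ?_ ?_
      (by positivity) (Or.inl (by ring)) ?_
    · rw [sin10_1]; push_cast; ring
    · have := TR_sin (n := 10) (by norm_num) 6
      push_cast at this; exact this
    · rw [ang_eq 13 30 hn, show ((13:ℕ) * π / (30:ℕ) : ℝ) = π / 3 + π / 10 by push_cast; ring,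
        sin_add, sin_pi_div_three, cos_pi_div_three, ← sin_pi_div_two_sub, ← sin_pi_sub (π/2 - π/10)]
      rw [show π - (π/2 - π/10) = 6 * π / 10 by ring]; ring
    · rw [ang_eq 7 30 hn, show ((7:ℕ) * π / (30:ℕ) : ℝ) = π / 3 - π / 10 by push_cast; ring,
        sin_sub, sin_pi_div_three, cos_pi_div_three, ← sin_pi_div_two_sub, ← sin_pi_sub (π/2 - π/10)]
      rw [show π - (π/2 - π/10) = 6 * π / 10 by ring]; ring
    · rw [ebc, ang_eq 1 5 hn, Nat.cast_one, one_mul]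
      push_cast; rw [cos_pi_div_five]; linear_combination (-1/16) * sqrt5_sq
  · exfalso
    refine quint (sin (2 * π / 10)) (sin (3 * π / 10)) ((√5 - 1) / 4) (1/4) (1/4) ?_ ?_ (Or.inl sin10_2) ?_ ?_
      ?_ (Or.inr (by ring)) ?_
    · rw [sin10_3]; push_cast; ring
    · have := TR_sin (n := 10) (by norm_num) 2
      push_cast at this; exact this
    · rw [ang_eq 19 30 hn, show ((19:ℕ) * π / (30:ℕ) : ℝ) = π / 3 + 3 * π / 10 by push_cast; ring,
        sin_add, sin_pi_div_three, cos_pi_div_three, ← sin_pi_div_two_sub (3 * π / 10)]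
      rw [show π/2 - 3 * π/10 = 2 * π / 10 by ring]; ring
    · rw [ang_eq 1 30 hn, show ((1:ℕ) * π / (30:ℕ) : ℝ) = π / 3 - 3 * π / 10 by push_cast; ring,
        sin_sub, sin_pi_div_three, cos_pi_div_three, ← sin_pi_div_two_sub (3 * π / 10)]
      rw [show π/2 - 3 * π/10 = 2 * π / 10 by ring]; ring
    · rw [← cos25]; apply cos_pos_of_mem_Ioo; constructor <;> linarith [pi_pos]
    · rw [ebc, ang_eq 3 5 hn, show ((3:ℕ) * π / (5:ℕ) : ℝ) = π - 2 * π / 5 by push_cast; ring,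
        cos_pi_sub, cos25]; push_cast; linear_combination (-1/16) * sqrt5_sq

lemma eqcase (d : Dat n N m M cnt side lam) (h0 : 3 * m 0 = n) (hM : ∀ l, M l = m 0) : Good N := by
  rcases le_total (m 2) (m 1) with h | h
  · exact d.eqcase_aux h0 hM h
  · exact (d.permT (Equiv.swap 1 2)).eqcase_aux h0 hM (by simpa using h)

end Dat

lemma gapcos {n j : ℕ} (hn : 0 < n) (h2 : 2 * j < n) (h : ∀ k : ℕ, k.Coprime (2 * n) → 0 < cos (k * (j * π / n))) :
    j = 0 ∨ 3 * j = n := by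
  have hn' : (n:ℝ) ≠ 0 := by exact_mod_cast hn.ne'
  obtain ⟨L, v, hL, hv, hu⟩ := gap (D := 2 * n) (E := 2 * n) (u := j) (by omega) (by omega) dvd_rfl (by
    intro k hk
    have : (k * (2 * π * j / (2 * n : ℕ)) : ℝ) = k * (j * π / n) := by push_cast; field_simp
    rw [this]; linarith [h k hk])
  have h4 : 4 * v < L := by
    have : 0 < L := by omega
    by_contra hc
    have h5 : n * L ≤ n * (4 * v) := Nat.mul_le_mul_left _ (by omega)
    nlinarith
  rcases hL with rfl | rfl | rfl | rfl
  · have : v = 0 := by omega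
    subst this; omega
  · have : v = 0 := by omega
    subst this; omega
  · have : v < 2 := by omega
    interval_cases v <;> omega
  · have : v < 3 := by omega
    interval_cases v
    · omega
    · exfalso
      have h5 : 5 * j = n := by omega
      obtain ⟨k, hk, hk3⟩ := lift_coprime (D := 10) (E := 2 * n) ⟨j, by omega⟩ (by omega) 3 (by norm_num)
      have := h k hk
      rw [ang_eq 1 5 hn, show (k * ((1:ℕ) * π / (5:ℕ)) : ℝ) = 2 * π * k / (10:ℕ) by push_cast; ring,
        cos_modEq (by norm_num) hk3] at this
      rw [show (2 * π * (3:ℕ) / (10:ℕ) : ℝ) = π - 2 * π / 5 by push_cast; ring, cos_pi_sub, cos25] at this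
      have : (1:ℝ) < √5 := by rw [Real.lt_sqrt (by norm_num)]; norm_num
      linarith
    · norm_num at hv

lemma ratsq {g : ℚ} (w : ℕ) (hw : ¬ IsSquare w) (c : ℚ) (h : c ^ 2 * g ^ 2 = w) : False :=
  not_sq_rat (c * g) w hw (by rw [mul_pow, h])

lemma sq1 {g : ℚ} (h : g ^ 2 = 1) : g = 1 ∨ g = -1 := by
  have : (g - 1) * (g + 1) = 0 := by linarith
  rcases mul_eq_zero.1 this with h | h
  · left; linarith
  · right; linarith

lemma nsq2 : ¬ IsSquare 2 := by rintro ⟨s, hs⟩; have : s ≤ 2 := (by nlinarith); interval_cases s <;> omega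
lemma nsq3 : ¬ IsSquare 3 := by rintro ⟨s, hs⟩; have : s ≤ 2 := (by nlinarith); interval_cases s <;> omega
lemma nsq6 : ¬ IsSquare 6 := by rintro ⟨s, hs⟩; have : s ≤ 2 := (by nlinarith); interval_cases s <;> omega

lemma cos_sub_symm {n i j : ℕ} : ∃ u : ℕ, cos (i * π / n - j * π / n) = cos (u * π / n) := by
  rcases le_total j i with h | h
  · refine ⟨i - j, ?_⟩; congr 1; push_cast [Nat.cast_sub h]; ring
  · refine ⟨j - i, ?_⟩; rw [← cos_neg]; congr 1; push_cast [Nat.cast_sub h]; ring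

lemma sin_cos_abs {n j : ℕ} (hn : 0 < n) (h2 : 2 ∣ n) (hj0 : 0 < j) (hj : j < n) : ∃ u : ℕ, sin (j * π / n) = cos (u * π / n) ∧
    2 * u < n ∧ (2 * (u + j) = n ∨ 2 * j = n + 2 * u) := by
  have hn' : (n:ℝ) ≠ 0 := by exact_mod_cast hn.ne'
  obtain ⟨c, hc⟩ := h2
  have hcR : (n:ℝ) = 2 * c := by exact_mod_cast hc
  have hc0 : (c:ℝ) ≠ 0 := by rintro h; rw [h] at hcR; simp at hcR; exact hn' (by exact_mod_cast hcR)
  rcases le_total j c with h | h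
  · refine ⟨c - j, ?_, by omega, by left; omega⟩
    rw [← cos_pi_div_two_sub]; congr 1; push_cast [Nat.cast_sub h]; rw [hcR]; field_simp
  · refine ⟨j - c, ?_, by omega, by right; omega⟩
    rw [← cos_pi_div_two_sub, ← cos_neg]; congr 1; push_cast [Nat.cast_sub h]; rw [hcR]; field_simp; ring

namespace Dat
variable {n N : ℕ} {m M : Fin 3 → ℕ} {cnt side : Fin 3 → Fin 3 → ℕ} {lam : ℝ}

lemma lack (d : Dat n N m M cnt side lam) (l : Fin 3) (r : ℕ) (ρ : ℕ) (hr : ¬ IsSquare r) (hρ : 0 < ρ)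
    (h : N * (sin (m 1 * π / n) * sin (m 2 * π / n)) = ρ * (√r * (lam * sin (M l * π / n)) ^ 2)) :
    side l 2 = 0 ∨ side l 1 = 0 := by
  by_contra! hc
  have hN : (0:ℝ) < N := by exact_mod_cast d.Npos
  have hρR : (0:ℝ) < ρ := by exact_mod_cast hρ
  have hr2 : √(r:ℝ) ^ 2 = ((r:ℚ):ℝ) := by rw [Real.sq_sqrt (by positivity)]; simp
  have hr0 : 0 < √(r:ℝ) := by
    rw [Real.sqrt_pos]; rcases Nat.eq_zero_or_pos r with h | h
    · exact absurd ⟨0, by simp [h]⟩ hr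
    · exact_mod_cast h
  obtain ⟨τ, hτ⟩ := exists_flip r ((irrational_sqrt_natCast_iff).2 hr) hr2
  have TX := d.TRX l
  have hX0 := rho_ne τ TX (mul_pos d.lpos (d.S_pos l)).ne'
  have h1 := d.H4' τ l 1 (Nat.pos_of_ne_zero hc.2)
  have h2 := d.H4' τ l 2 (Nat.pos_of_ne_zero hc.1)
  have e := congrArg (rho τ) h
  rw [rho_natmul, rho_natmul, rho_mul τ (TR_sin d.npos.ne' _), rho_mul τ (TR_of_sq r (by positivity) hr2), rho_sq τ TX, hτ] at e
  have h3 := mul_pos h1 h2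
  set X := rho τ (lam * sin (M l * π / n))
  set b := rho τ (sin (m 1 * π / n))
  set c := rho τ (sin (m 2 * π / n))
  have hX2 : 0 < X ^ 2 := by positivity
  have : 0 < X ^ 2 * (b * c) := by nlinarith
  have hbc := (mul_pos_iff_of_pos_left hX2).1 this
  have p1 : 0 < N * (b * c) := by positivity
  have p2 : 0 < ρ * (√(r:ℝ) * X ^ 2) := by positivity
  linarith

lemma p6_aux (d : Dat n N m M cnt side lam) (h0 : 6 * m 0 = n) (l : Fin 3) (ρ : ℕ) (hρ : ρ = 1 ∨ ρ = 2)
    (F : Fin 3 → ℕ) (hF : ∀ t, 6 * M t = F t * n)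
    (h : N * (sin (m 1 * π / n) * sin (m 2 * π / n)) = ρ * (√3 * (lam * sin (M l * π / n)) ^ 2))
    (hs2 : side l 2 = 0) : Good N := by
  have hn := d.npos
  have hn' : (n:ℝ) ≠ 0 := by exact_mod_cast hn.ne'
  have hNQ : (N:ℚ) ≠ 0 := by exact_mod_cast d.Npos.ne'
  have hNR : (N:ℝ) ≠ 0 := by exact_mod_cast d.Npos.ne'
  have hs := d.msum
  rw [Fin.sum_univ_three] at hs
  have hX := d.H1 l
  rw [Fin.sum_univ_three, hs2] at hX
  have s0 : sin (m 0 * π / n) = 1 / 2 := by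
    rw [ang_eq 1 6 hn, ← sin_pi_div_six]; simp
  have c0 : cos (m 0 * π / n) = √3 / 2 := by
    rw [ang_eq 1 6 hn, ← cos_pi_div_six]; simp
  have hsum : (m 0 * π / n + m 1 * π / n + m 2 * π / n : ℝ) = π := by
    have : (m 0 + m 1 + m 2 : ℝ) = n := by exact_mod_cast hs
    field_simp; linarith
  have a1 := d.a_pos 1
  have a2 := d.a_pos 2
  have hX0 : 0 < lam * sin (M l * π / n) := mul_pos d.lpos (d.S_pos l)
  have h3 := sqrt3_sq
  have h30 : √(3:ℝ) ≠ 0 := by positivity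
  rw [s0] at hX
  by_cases hq : side l 1 = 0
  · rw [hq] at hX
    set p := side l 0
    have hX' : lam * sin (M l * π / n) = p / 2 := by rw [hX]; simp; ring
    obtain ⟨u, hu⟩ := cos_sub_symm (n := n) (i := m 1) (j := m 2)
    set g : ℚ := ρ * p ^ 2 / N - 1 with hg
    have e1 : cos (u * π / n) ^ 2 = ((3/4 * g ^ 2 : ℚ) : ℝ) := by
      have : cos (u * π / n) = √3 / 2 * g := by
        have t : cos (m 1 * π / n + m 2 * π / n) = - (√3/2) := by
          rw [← c0, ← cos_pi_sub]; congr 1; linarith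
        rw [cos_add] at t
        rw [hX'] at h
        rw [← hu, cos_sub, hg]; push_cast
        apply mul_left_cancel₀ hNR
        have t3 : (N:ℝ) * (√3 / 2 * (ρ * p ^ 2 / N - 1)) = √3 / 2 * (ρ * p ^ 2 - N) := by field_simp
        rw [t3]
        linear_combination N * t + 2 * h
      rw [this, mul_pow, div_pow, h3]; push_cast; ring
    have hgs : g = 0 ∨ g = 1 ∨ g = -1 := by
      rcases niven_sq _ e1 with k | k | k | k | k
      · left; simpa using k
      · exact (ratsq (g := g) 3 nsq3 3 (by push_cast; linarith)).elim
      · exact (ratsq (g := g) 6 nsq6 3 (by push_cast; linarith)).elim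
      · right; exact sq1 (by linarith)
      · exact (ratsq (g := g) 3 nsq3 (3/2) (by push_cast; linarith)).elim
    have hp0 : (p:ℚ) ≠ 0 := by
      intro h; have : (p:ℝ) = 0 := by exact_mod_cast h
      rw [hX', this] at hX0; simp at hX0
    rcases hgs with k | k | k
    · rw [hg] at k; field_simp at k
      rcases hρ with rfl | rfl
      · apply good1 p; push_cast at k; linarith
      · apply good2 (2 * p); push_cast at k; linarith
    · rw [hg] at k; field_simp at k
      rcases hρ with rfl | rfl
      · apply good2 p; push_cast at k; linarith
      · apply good1 p; push_cast at k; linarith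
    · exfalso; rw [hg] at k
      have : (ρ:ℚ) * p ^ 2 / N = 0 := by linarith
      rcases hρ with rfl | rfl <;> · field_simp at this; simp at this; exact hp0 (by exact_mod_cast this)
  by_cases hp : side l 0 = 0
  · rw [hp] at hX
    set q := side l 1
    have hX' : lam * sin (M l * π / n) = q * sin (m 1 * π / n) := by rw [hX]; simp
    have hq0 : (q:ℚ) ≠ 0 := by exact_mod_cast hq
    set g : ℚ := 2 * ρ * q ^ 2 / N - 1 with hg
    have e1 : sin (m 1 * π / n) ^ 2 * (1 + 3 * g ^ 2) = 1 := by
      have t : sin (m 2 * π / n) = 1/2 * cos (m 1 * π / n) + √3 / 2 * sin (m 1 * π / n) := by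
        rw [← s0, ← c0, ← sin_add, ← sin_pi_sub]; congr 1; linarith
      rw [hX', t] at h
      have : cos (m 1 * π / n) = √3 * g * sin (m 1 * π / n) := by
        rw [hg]; push_cast; field_simp
        apply mul_left_cancel₀ a1.ne'
        linear_combination 2 * h
      have t2 := sin_sq_add_cos_sq (m 1 * π / n)
      rw [this, mul_pow, mul_pow, h3] at t2
      linarith
    have hg1 : (1 + 3 * g ^ 2 : ℚ) ≠ 0 := by positivity
    have e2 : sin (m 1 * π / n) ^ 2 = ((1 / (1 + 3 * g ^ 2) : ℚ) : ℝ) := by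
      have hp : (1 + 3 * (g:ℝ) ^ 2) ≠ 0 := by positivity
      push_cast; rw [eq_div_iff hp]; exact e1
    have hgs : g = 0 ∨ (g = 1 ∨ g = -1) ∨ (3 * g = 1 ∨ 3 * g = -1) := by
      rcases niven_sq_sin _ e2 with k | k | k | k | k
      · exfalso; field_simp at k; simp at k
      · right; left; field_simp at k; exact sq1 (by linarith)
      · field_simp at k; exact (ratsq (g := g) 3 nsq3 3 (by push_cast; linarith)).elim
      · right; right; field_simp at k; exact sq1 (by linarith)
      · left; field_simp at k; have : g ^ 2 = 0 := by linarith
        simpa using this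
    have fin : ∀ c : ℚ, c = 1 ∨ c = 2 ∨ c = 4/3 ∨ c = 2/3 → 2 * ρ * q ^ 2 / N = c → Good N := by
      intro c hc k
      field_simp at k
      refine good_mul (c / (2 * ρ)) q ?_ ?_
      · rcases hρ with rfl | rfl <;> · push_cast at k ⊢; linarith
      · rcases hρ with rfl | rfl <;> rcases hc with rfl | rfl | rfl | rfl <;> norm_num
    rcases hgs with k | (k | k) | (k | k)
    · exact fin 1 (by norm_num) (by linarith)
    · exact fin 2 (by norm_num) (by linarith)
    · exfalso; rw [hg] at k
      have : 2 * (ρ:ℚ) * q ^ 2 / N = 0 := by linarith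
      rcases hρ with rfl | rfl <;> · field_simp at this; simp at this; exact hq0 (by exact_mod_cast this)
    · exact fin (4/3) (by norm_num) (by linarith)
    · exact fin (2/3) (by norm_num) (by linarith)
  obtain ⟨u, hu1, hu2, hu3⟩ := sin_cos_abs hn (Dvd.dvd.trans (by norm_num) d.n720) (d.mpos 1) (d.m_lt 1)
  have hm2 := d.mpos 2
  rcases gapcos hn hu2 (by
    intro k hk
    obtain ⟨τ, hτ⟩ := exists_tau hn.ne' k hk
    obtain ⟨ε, hε, -, hc⟩ := rho_trig k τ hτ
    rw [← hc, ← hu1]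
    have i1 := d.H4' τ l 0 (Nat.pos_of_ne_zero hp)
    have i2 := d.H4' τ l 1 (Nat.pos_of_ne_zero hq)
    rw [s0, show (1/2:ℝ) = ((1/2 : ℚ):ℝ) by norm_num, rho_rat] at i1
    push_cast at i1
    have i3 : 0 < rho τ (lam * sin (M l * π / n)) := by linarith
    exact (mul_pos_iff_of_pos_left i3).1 i2) with h | h
  · exact d.six ![1, 3, 2] F (fun t => by fin_cases t <;> simp <;> omega) hF
  · exact d.six ![1, 1, 4] F (fun t => by fin_cases t <;> simp <;> omega) hF

lemma p6 (d : Dat n N m M cnt side lam) (h0 : 6 * m 0 = n) (l : Fin 3) (ρ : ℕ) (hρ : ρ = 1 ∨ ρ = 2)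
    (F : Fin 3 → ℕ) (hF : ∀ t, 6 * M t = F t * n)
    (h : N * (sin (m 1 * π / n) * sin (m 2 * π / n)) = ρ * (√3 * (lam * sin (M l * π / n)) ^ 2)) : Good N := by
  rcases d.lack l 3 ρ nsq3 (by omega) (by rw [h]; norm_num) with hs | hs
  · exact d.p6_aux h0 l ρ hρ F hF h hs
  · refine (d.permT (Equiv.swap 1 2)).p6_aux h0 l ρ hρ F hF ?_ (by simpa using hs)
    simp only [Function.comp, Equiv.swap_apply_left, Equiv.swap_apply_right]
    rw [← h]; ring

lemma p4_aux (d : Dat n N m M cnt side lam) (h0 : 4 * m 0 = n) (hM0 : 2 * M 0 = n) (hM1 : 4 * M 1 = n) (hM2 : 4 * M 2 = n)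
    (h : N * (sin (m 1 * π / n) * sin (m 2 * π / n)) = (√2 * (lam * sin (M 1 * π / n)) ^ 2))
    (hs2 : side 1 2 = 0) : Good N := by
  have hn := d.npos
  have hn' : (n:ℝ) ≠ 0 := by exact_mod_cast hn.ne'
  have hNQ : (N:ℚ) ≠ 0 := by exact_mod_cast d.Npos.ne'
  have hNR : (N:ℝ) ≠ 0 := by exact_mod_cast d.Npos.ne'
  have hNp : (0:ℝ) < N := by exact_mod_cast d.Npos
  have hs := d.msum
  rw [Fin.sum_univ_three] at hs
  have hX := d.H1 1
  rw [Fin.sum_univ_three, hs2] at hX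
  have s0 : sin (m 0 * π / n) = √2 / 2 := by
    rw [ang_eq 1 4 hn, ← sin_pi_div_four]; simp
  have c0 : cos (m 0 * π / n) = √2 / 2 := by
    rw [ang_eq 1 4 hn, ← cos_pi_div_four]; simp
  have hsum : (m 0 * π / n + m 1 * π / n + m 2 * π / n : ℝ) = π := by
    have : (m 0 + m 1 + m 2 : ℝ) = n := by exact_mod_cast hs
    field_simp; linarith
  have a1 := d.a_pos 1
  have a2 := d.a_pos 2
  have hX0 : 0 < lam * sin (M 1 * π / n) := mul_pos d.lpos (d.S_pos 1)
  have h2 := sqrt2_sq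
  have h20 : √(2:ℝ) ≠ 0 := by positivity
  rw [s0] at hX
  by_cases hq : side 1 1 = 0
  · rw [hq] at hX
    set p := side 1 0
    have hX' : lam * sin (M 1 * π / n) = p * (√2 / 2) := by rw [hX]; simp
    obtain ⟨u, hu⟩ := cos_sub_symm (n := n) (i := m 1) (j := m 2)
    set g : ℚ := 2 * p ^ 2 / N - 1 with hg
    have e1 : cos (u * π / n) ^ 2 = ((1/2 * g ^ 2 : ℚ) : ℝ) := by
      have : cos (u * π / n) = √2 / 2 * g := by
        have t : cos (m 1 * π / n + m 2 * π / n) = - (√2/2) := by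
          rw [← c0, ← cos_pi_sub]; congr 1; linarith
        rw [cos_add] at t
        rw [hX', mul_pow, div_pow, h2] at h
        rw [← hu, cos_sub, hg]; push_cast
        apply mul_left_cancel₀ hNR
        have t3 : (N:ℝ) * (√2 / 2 * (2 * p ^ 2 / N - 1)) = √2 / 2 * (2 * p ^ 2 - N) := by field_simp
        rw [t3]
        linear_combination N * t + 2 * h
      rw [this, mul_pow, div_pow, h2]; push_cast; ring
    have hgs : g = 0 ∨ g = 1 ∨ g = -1 := by
      rcases niven_sq _ e1 with k | k | k | k | k
      · left; simpa using k
      · exact (ratsq (g := g) 2 nsq2 2 (by push_cast; linarith)).elim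
      · right; exact sq1 (by linarith)
      · exact (ratsq (g := g) 6 nsq6 2 (by push_cast; linarith)).elim
      · exact (ratsq (g := g) 2 nsq2 1 (by push_cast; linarith)).elim
    have hp0 : (p:ℚ) ≠ 0 := by
      intro h; have : (p:ℝ) = 0 := by exact_mod_cast h
      rw [hX', this] at hX0; simp at hX0
    rcases hgs with k | k | k
    · rw [hg] at k; field_simp at k
      apply good2 (2 * p); linarith
    · rw [hg] at k; field_simp at k
      apply good1 p; linarith
    · exfalso; rw [hg] at k
      have : 2 * (p:ℚ) ^ 2 / N = 0 := by linarith
      field_simp at this; simp at this; exact hp0 (by exact_mod_cast this)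
  by_cases hp : side 1 0 = 0
  · rw [hp] at hX
    set q := side 1 1
    have hX' : lam * sin (M 1 * π / n) = q * sin (m 1 * π / n) := by rw [hX]; simp
    have hq0 : (q:ℚ) ≠ 0 := by exact_mod_cast hq
    set g : ℚ := 2 * q ^ 2 / N - 1 with hg
    have e1 : sin (m 1 * π / n) ^ 2 * (1 + g ^ 2) = 1 := by
      have t : sin (m 2 * π / n) = √2/2 * cos (m 1 * π / n) + √2 / 2 * sin (m 1 * π / n) := by
        nth_rw 1 [← s0]; rw [← c0, ← sin_add, ← sin_pi_sub]; congr 1; linarith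
      rw [hX', t] at h
      have : cos (m 1 * π / n) = g * sin (m 1 * π / n) := by
        rw [hg]; push_cast; field_simp
        apply mul_left_cancel₀ a1.ne'
        apply mul_left_cancel₀ h20
        linear_combination 2 * h
      have t2 := sin_sq_add_cos_sq (m 1 * π / n)
      rw [this, mul_pow] at t2
      linarith
    have hg1 : (1 + g ^ 2 : ℚ) ≠ 0 := by positivity
    have e2 : sin (m 1 * π / n) ^ 2 = ((1 / (1 + g ^ 2) : ℚ) : ℝ) := by
      have hp : (1 + (g:ℝ) ^ 2) ≠ 0 := by positivity
      push_cast; rw [eq_div_iff hp]; exact e1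
    have hgs : g = 0 ∨ (g = 1 ∨ g = -1) := by
      rcases niven_sq_sin _ e2 with k | k | k | k | k
      · exfalso; field_simp at k; simp at k
      · field_simp at k; exact (ratsq (g := g) 3 nsq3 1 (by push_cast; linarith)).elim
      · right; field_simp at k; exact sq1 (by linarith)
      · field_simp at k; exact (ratsq (g := g) 3 nsq3 3 (by push_cast; linarith)).elim
      · left; field_simp at k; have : g ^ 2 = 0 := by linarith
        simpa using this
    rcases hgs with k | (k | k)
    · rw [hg] at k; field_simp at k
      apply good2 (2 * q); linarith
    · rw [hg] at k; field_simp at k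
      apply good1 q; linarith
    · exfalso; rw [hg] at k
      have : 2 * (q:ℚ) ^ 2 / N = 0 := by linarith
      field_simp at this; simp at this; exact hq0 (by exact_mod_cast this)
  obtain ⟨u, hu1, hu2, hu3⟩ := sin_cos_abs hn (Dvd.dvd.trans (by norm_num) d.n720) (d.mpos 2) (d.m_lt 2)
  have hm1 := d.mpos 1
  rcases gapcos hn hu2 (by
    intro k hk
    obtain ⟨τ, hτ⟩ := exists_tau hn.ne' k hk
    obtain ⟨ε, hε, -, hc⟩ := rho_trig k τ hτ
    rw [← hc, ← hu1]
    have i1 := d.H4' τ 1 0 (Nat.pos_of_ne_zero hp)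
    have i2 := d.H4' τ 1 1 (Nat.pos_of_ne_zero hq)
    have T2 : TR √2 := TR_of_sq 2 (by norm_num) (by rw [h2]; norm_num)
    have TX := d.TRX 1
    have e := congrArg (rho τ) h
    rw [rho_natmul, rho_mul τ (TR_sin hn.ne' _), rho_mul τ T2, rho_sq τ TX] at e
    rw [s0, show √2/2 = ((1/2 : ℚ):ℝ) * √2 by push_cast; ring, rho_ratmul] at i1
    push_cast at i1
    set X := rho τ (lam * sin (M 1 * π / n))
    set b := rho τ (sin (m 1 * π / n))
    have i3 : 0 < X ^ 2 := by have : X ≠ 0 := (by intro h; rw [h] at i2; simp at i2); positivity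
    have i4 : 0 < (X * b) * (N * rho τ (sin (m 2 * π / n))) := by
      have : (X * b) * (N * rho τ (sin (m 2 * π / n))) = 2 * X ^ 2 * (X * (1 / 2 * rho τ √2)) := by
        linear_combination X * e
      rw [this]; positivity
    exact (mul_pos_iff_of_pos_left hNp).1 ((mul_pos_iff_of_pos_left i2).1 i4)) with k | k
  · refine d.similar' (Equiv.swap 0 2) fun t => ?_
    fin_cases t
    · simp; omega
    · simp [Equiv.swap_apply_of_ne_of_ne]; omega
    · simp; omega
  · exfalso
    have h3 := sqrt3_sq
    have sb : sin (m 1 * π / n) = √2 * (√3 + 1) / 4 := by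
      rw [ang_eq 7 12 hn, show ((7:ℕ) * π / (12:ℕ) : ℝ) = π / 3 + π / 4 by push_cast; ring,
        sin_add, sin_pi_div_three, cos_pi_div_three, sin_pi_div_four, cos_pi_div_four]; ring
    have sc : sin (m 2 * π / n) = 1 / 2 := by
      rw [ang_eq 1 6 hn, ← sin_pi_div_six]; simp
    rw [hX, sb, sc] at h
    set p := side 1 0
    set q := side 1 1
    have e : ((N - ((2 * p + q) ^ 2 + 3 * q ^ 2) : ℚ) : ℝ) + ((N - 2 * q * (2 * p + q) : ℚ) : ℝ) * √3 = 0 := by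
      apply mul_left_cancel₀ h20
      push_cast at h ⊢; linear_combination 8 * h - (-4 * √2 * (p * (1/2) + q * (√3+1)/4)^2 * 2) * h2 + √2 * q ^ 2 * h3
    obtain ⟨f1, f2⟩ := irr_lin irr3 _ _ e
    have hp0 : (0:ℚ) < p := by exact_mod_cast Nat.pos_of_ne_zero hp
    nlinarith [sq_nonneg (q:ℚ)]

lemma p4 (d : Dat n N m M cnt side lam) (h0 : 4 * m 0 = n) (hM0 : 2 * M 0 = n) (hM1 : 4 * M 1 = n) (hM2 : 4 * M 2 = n) : Good N := by
  have hn := d.npos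
  have t0 : sin (M 0 * π / n) = 1 := by rw [ang_eq 1 2 hn]; simp
  have t1 : ∀ j, 4 * j = n → sin (j * π / n) = √2 / 2 := by
    intro j hj; rw [ang_eq 1 4 hn, ← sin_pi_div_four]; simp
  have h : N * (sin (m 1 * π / n) * sin (m 2 * π / n)) = √2 * (lam * sin (M 1 * π / n)) ^ 2 := by
    have H2 := d.H2
    simp only [Fin.prod_univ_three] at H2
    rw [t0, t1 _ hM1, t1 _ hM2, t1 _ h0] at H2
    rw [t1 _ hM1]
    have h20 : √(2:ℝ) ≠ 0 := by positivity
    apply mul_left_cancel₀ h20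
    linear_combination (-2) * H2 - lam ^ 2 / 4 * √2 ^ 2 * sqrt2_sq
  rcases d.lack 1 2 1 nsq2 (by omega) (by rw [h]; norm_num) with hs | hs
  · exact d.p4_aux h0 hM0 hM1 hM2 h hs
  · refine (d.permT (Equiv.swap 1 2)).p4_aux h0 hM0 hM1 hM2 ?_ (by simpa using hs)
    simp only [Function.comp, Equiv.swap_apply_left, Equiv.swap_apply_right]
    rw [← h]; ring
lemma p6x (d : Dat n N m M cnt side lam) (h0 : 6 * m 0 = n) (F : Fin 3 → ℕ) (hF : ∀ t, 6 * M t = F t * n)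
    (hpos : ∀ t, 0 < F t) (hs : F 0 + F 1 + F 2 = 6) (h : F 0 = 1 ∨ (F 0 = 2 ∧ F 1 = 2)) : Good N := by
  have hn := d.npos
  have s0 : sin (m 0 * π / n) = 1 / 2 := by
    rw [ang_eq 1 6 hn, ← sin_pi_div_six]; simp
  have h1 := hpos 0; have h2 := hpos 1; have h3 := hpos 2
  have t0 := sin6 hn (hF 0) h1 (by omega)
  have t1 := sin6 hn (hF 1) h2 (by omega)
  have t2 := sin6 hn (hF 2) h3 (by omega)
  have H2 := d.H2
  simp only [Fin.prod_univ_three] at H2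
  rw [s0] at H2
  rcases h with h | ⟨h, h'⟩
  · have e0 : sin (M 0 * π / n) = 1 / 2 := by rcases t0 with t | t | t | t <;> first | exact t.2 | (exfalso; omega)
    by_cases hc : F 1 = 1 ∨ F 1 = 4
    · refine d.p6 h0 0 1 (by simp) F hF ?_
      have : sin (M 1 * π / n) * sin (M 2 * π / n) = √3 / 4 := by
        rcases t1 with t | t | t | t <;> rcases t2 with t' | t' | t' | t' <;> first | (exfalso; omega) | (rw [t.2, t'.2]; ring)
      rw [e0] at H2 ⊢
      push_cast; linear_combination (-2) * H2 + lam ^ 2 * this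
    · refine d.p6 h0 0 2 (by simp) F hF ?_
      have : sin (M 1 * π / n) * sin (M 2 * π / n) = √3 / 2 := by
        rcases t1 with t | t | t | t <;> rcases t2 with t' | t' | t' | t' <;> first | (exfalso; omega) | (rw [t.2, t'.2]; ring)
      rw [e0] at H2 ⊢
      push_cast; linear_combination (-2) * H2 + lam ^ 2 * this
  · have e0 : sin (M 0 * π / n) = √3 / 2 := by rcases t0 with t | t | t | t <;> first | exact t.2 | (exfalso; omega)
    have e1 : sin (M 1 * π / n) = √3 / 2 := by rcases t1 with t | t | t | t <;> first | exact t.2 | (exfalso; omega)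
    have e2 : sin (M 2 * π / n) = √3 / 2 := by rcases t2 with t | t | t | t <;> first | exact t.2 | (exfalso; omega)
    refine d.p6 h0 0 1 (by simp) F hF ?_
    rw [e0, e1, e2] at H2
    rw [e0]
    push_cast; linear_combination (-2) * H2

lemma p6y (d : Dat n N m M cnt side lam) (h0 : 6 * m 0 = n) (F : Fin 3 → ℕ) (hF : ∀ t, 6 * M t = F t * n)
    (hpos : ∀ t, 0 < F t) (hs : F 0 + F 1 + F 2 = 6) : Good N := by
  have h1 := hpos 0; have h2 := hpos 1; have h3 := hpos 2
  by_cases h : F 0 = 1 ∨ (F 0 = 2 ∧ F 1 = 2)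
  · exact d.p6x h0 F hF hpos hs h
  by_cases h' : F 1 = 1
  · exact (d.permL (Equiv.swap 0 1)).p6x h0 (F ∘ Equiv.swap 0 1) (fun t => hF _) (fun t => hpos _)
      (by simp [Equiv.swap_apply_of_ne_of_ne]; omega) (by simp; omega)
  · exact (d.permL (Equiv.swap 0 2)).p6x h0 (F ∘ Equiv.swap 0 2) (fun t => hF _) (fun t => hpos _)
      (by simp [Equiv.swap_apply_of_ne_of_ne]; omega) (by simp; omega)

lemma simL (d : Dat n N m M cnt side lam) (h : (M 0 = m 0 ∧ M 1 = m 1) ∨ (M 0 = m 0 ∧ M 1 = m 2) ∨ (M 0 = m 1 ∧ M 1 = m 0)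
    ∨ (M 0 = m 1 ∧ M 1 = m 2) ∨ (M 0 = m 2 ∧ M 1 = m 0) ∨ (M 0 = m 2 ∧ M 1 = m 1)) : Good N := by
  have hs := d.msum
  have hS := d.Msum
  rw [Fin.sum_univ_three] at hs hS
  have key : ∀ a b c : Fin 3, a ≠ b → b ≠ c → a ≠ c → M a = m 0 → M b = m 1 → M c = m 2 → Good N := by
    intro a b c hab hbc hac h0 h1 h2
    have hb : Function.Bijective (![a, b, c] : Fin 3 → Fin 3) := by
      rw [Fintype.bijective_iff_injective_and_card]; refine ⟨?_, rfl⟩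
      intro i j; fin_cases i <;> fin_cases j <;> simp [hab, hbc, hac, hab.symm, hbc.symm, hac.symm]
    refine d.similar' (Equiv.ofBijective _ hb) fun t => ?_
    fin_cases t <;> simpa
  rcases h with h | h | h | h | h | h
  · exact key 0 1 2 (by decide) (by decide) (by decide) (by omega) (by omega) (by omega)
  · exact key 0 2 1 (by decide) (by decide) (by decide) (by omega) (by omega) (by omega)
  · exact key 1 0 2 (by decide) (by decide) (by decide) (by omega) (by omega) (by omega)
  · exact key 2 0 1 (by decide) (by decide) (by decide) (by omega) (by omega) (by omega)
  · exact key 1 2 0 (by decide) (by decide) (by decide) (by omega) (by omega) (by omega)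
  · exact key 2 1 0 (by decide) (by decide) (by decide) (by omega) (by omega) (by omega)

lemma swapL {Q : ℕ → ℕ → ℕ → Prop} {R : Prop} (d : Dat n N m M cnt side lam)
    (H : ∀ (M : Fin 3 → ℕ) (cnt side : Fin 3 → Fin 3 → ℕ), Dat n N m M cnt side lam → Q (M 0) (M 1) (M 2) → R)
    (h : Q (M 0) (M 1) (M 2) ∨ Q (M 1) (M 0) (M 2) ∨ Q (M 2) (M 1) (M 0)) : R := by
  rcases h with h | h | h
  · exact H _ _ _ d h
  · exact H _ _ _ (d.permL (Equiv.swap 0 1)) (by simpa [Equiv.swap_apply_of_ne_of_ne] using h)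
  · exact H _ _ _ (d.permL (Equiv.swap 0 2)) (by simpa [Equiv.swap_apply_of_ne_of_ne] using h)

lemma rightL (d : Dat n N m M cnt side lam) (h01 : 2 * (m 0 + m 1) = n)
    (h : (M 0 = 2 * m 0 ∧ M 1 = m 1) ∨ (M 1 = 2 * m 0 ∧ M 0 = m 1) ∨ (M 2 = 2 * m 0 ∧ M 1 = m 1)) : Good N := by
  refine d.swapL (Q := fun x y z => x = 2 * m 0 ∧ y = m 1) (fun M cnt side d h => ?_) h
  have hS := d.Msum
  rw [Fin.sum_univ_three] at hS
  exact d.right_case h01 h.1 h.2 (by omega)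

lemma rightL' (d : Dat n N m M cnt side lam) (h01 : 2 * (m 0 + m 1) = n)
    (h : (M 0 = 2 * m 1 ∧ M 1 = m 0) ∨ (M 1 = 2 * m 1 ∧ M 0 = m 0) ∨ (M 2 = 2 * m 1 ∧ M 1 = m 0)) : Good N := by
  refine (d.permT (Equiv.swap 0 1)).rightL (by simp; omega) (by simpa using h)

lemma ex (d : Dat n N m M cnt side lam) (P Q g E a b v : ℕ) (hP : ∑ l, cnt l 0 = P) (hQ : ∑ l, cnt l 1 = Q)
    (hR : ∑ l, cnt l 2 = 0) (hn : n = g * E) (h0 : m 0 = g * a) (h1 : m 1 = g * b) (hv : v.Coprime (2 * E)) (hvE : v ≤ E) :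
    P * (v * a % E) + Q * (v * b % E) = E ∨ P * ((E - v) * a % E) + Q * ((E - v) * b % E) = E := by
  obtain ⟨w, y, hw, hy, -, hs, hj⟩ := d.PKE hn v hv
  rw [Fin.sum_univ_three, hP, hQ, hR, hj 0 a h0, hj 1 b h1, hn] at hs
  have hg : 0 < g := by rw [Nat.pos_iff_ne_zero]; rintro rfl; have := d.npos; omega
  have hs' : P * (w * a % E) + Q * (w * b % E) = E := by
    apply Nat.eq_of_mul_eq_mul_left hg; rw [← hs]; ring
  have aux : ∀ v', w ≡ v' [MOD E] → P * (v' * a % E) + Q * (v' * b % E) = E := by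
    intro v' h
    rw [show w * a % E = v' * a % E from h.mul_right a, show w * b % E = v' * b % E from h.mul_right b] at hs'
    exact hs'
  rcases hw with h | h
  · left; exact aux v h
  · right; apply aux
    apply Nat.ModEq.add_right_cancel' v
    rw [Nat.sub_add_cancel hvE]
    exact h.trans (by simp [Nat.ModEq])

lemma ex10 (d : Dat n N m M cnt side lam) (h0 : 10 * m 0 = n) : ∑ l, cnt l 0 ≤ 3 := by
  obtain ⟨w, y, hw, hy, -, hs, hj⟩ := d.PKE (show n = m 0 * 10 by omega) 3 (by norm_num)
  have h1 := hj 0 1 (by omega)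
  have hp := d.mpos 0
  have h3 : 3 ≤ w * 1 % 10 := by
    rcases hw with h | h <;> · unfold Nat.ModEq at h; omega
  rw [Fin.sum_univ_three] at hs
  by_contra hc
  have h4 : 4 * y 0 ≤ (∑ l, cnt l 0) * y 0 := Nat.mul_le_mul_right _ (by omega)
  have h5 : m 0 * 3 ≤ y 0 := by rw [h1]; exact Nat.mul_le_mul_left _ h3
  omega

set_option maxHeartbeats 4000000 in
lemma main_sorted (d : Dat n N m M cnt side lam) (h01 : ∑ l, cnt l 1 ≤ ∑ l, cnt l 0) (h12 : ∑ l, cnt l 2 ≤ ∑ l, cnt l 1) : Good N := by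
  have hn := d.npos
  obtain ⟨s, hs720⟩ := d.n720
  have hs := d.msum
  have hS := d.Msum
  have e1 := d.P1
  have r0 := d.H3one 0
  have r1 := d.H3one 1
  have r2 := d.H3one 2
  have p0 := d.mpos 0; have p1 := d.mpos 1; have p2 := d.mpos 2
  have q0 := d.Mpos 0; have q1 := d.Mpos 1; have q2 := d.Mpos 2
  have small := d.small 0
  obtain ⟨P, hP⟩ : ∃ P, ∑ l, cnt l 0 = P := ⟨_, rfl⟩
  obtain ⟨Q, hQ⟩ : ∃ Q, ∑ l, cnt l 1 = Q := ⟨_, rfl⟩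
  obtain ⟨R, hR⟩ : ∃ R, ∑ l, cnt l 2 = R := ⟨_, rfl⟩
  have ex := d.ex P Q
  have ex10 := d.ex10
  simp only [hP, hQ, hR] at h01 h12 ex10
  simp only [Fin.sum_univ_three] at hs hS r0 r1 r2 small e1
  have ex := fun g E a b v => ex g E a b v hP hQ
  replace ex := fun g E a b v (h : R = 0) => ex g E a b v (hR.trans h)
  simp only [Fin.sum_univ_three] at hP hQ hR
  rw [hP, hQ, hR] at e1
  simp only [hP, hQ, hR] at small
  have n0 : 0 < cnt 0 0 + cnt 0 1 + cnt 0 2 := by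
    by_contra h
    have h0 : cnt 0 0 = 0 := by omega
    have h1 : cnt 0 1 = 0 := by omega
    have h2 : cnt 0 2 = 0 := by omega
    rw [h0, h1, h2] at r0; omega
  have n1 : 0 < cnt 1 0 + cnt 1 1 + cnt 1 2 := by
    by_contra h
    have h0 : cnt 1 0 = 0 := by omega
    have h1 : cnt 1 1 = 0 := by omega
    have h2 : cnt 1 2 = 0 := by omega
    rw [h0, h1, h2] at r1; omega
  have n2 : 0 < cnt 2 0 + cnt 2 1 + cnt 2 2 := by
    by_contra h
    have h0 : cnt 2 0 = 0 := by omega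
    have h1 : cnt 2 1 = 0 := by omega
    have h2 : cnt 2 2 = 0 := by omega
    rw [h0, h1, h2] at r2; omega
  have simL := d.simL
  have rightL := d.rightL
  have rightL' := d.rightL'
  have eqc := d.eqcase
  have six := d.six
  have p6 := d.p6y
  have p4 : 4 * m 0 = n → _ → Good N := fun h0 => d.swapL (Q := fun x y z => 2 * x = n ∧ 4 * y = n ∧ 4 * z = n) (R := Good N)
    (fun M cnt side d h => d.p4 h0 h.1 h.2.1 h.2.2)
  have tens := fun h => d.swapL (Q := fun x y z => x = m 0 + m 1 ∧ y = m 0 ∧ z = m 0) (R := Good N)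
    (fun M cnt side d h' => d.tens h h'.1 h'.2.1 h'.2.2)
  clear d
  generalize cnt 0 0 = c00 at *
  generalize cnt 0 1 = c01 at *
  generalize cnt 0 2 = c02 at *
  generalize cnt 1 0 = c10 at *
  generalize cnt 1 1 = c11 at *
  generalize cnt 1 2 = c12 at *
  generalize cnt 2 0 = c20 at *
  generalize cnt 2 1 = c21 at *
  generalize cnt 2 2 = c22 at *
  rcases Nat.eq_zero_or_pos R with hR0 | hR0
  swap
  · have a0 : 1 * m 0 ≤ P * m 0 := Nat.mul_le_mul_right _ (by omega)
    have a1 : 1 * m 1 ≤ Q * m 1 := Nat.mul_le_mul_right _ (by omega)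
    have a2 : 1 * m 2 ≤ R * m 2 := Nat.mul_le_mul_right _ (by omega)
    have hP1 : P = 1 := by
      by_contra h
      have : 2 * m 0 ≤ P * m 0 := Nat.mul_le_mul_right _ (by omega)
      omega
    have f0 : c00 ≤ 1 := by omega
    have f1 : c10 ≤ 1 := by omega
    have g0 : c01 ≤ 1 := by omega
    have g1 : c11 ≤ 1 := by omega
    apply simL
    obtain rfl : c20 = 1 - c00 - c10 := by omega
    obtain rfl : c21 = 1 - c01 - c11 := by omega
    obtain rfl : c22 = 1 - c02 - c12 := by omega
    have k0 : c02 ≤ 1 := by omega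
    have k1 : c12 ≤ 1 := by omega
    clear ex small six p6 eqc p4 tens rightL rightL'
    interval_cases c00 <;> interval_cases c10 <;> (try omega) <;> interval_cases c01 <;> interval_cases c11 <;> (try omega) <;>
      interval_cases c02 <;> interval_cases c12 <;> omega
  subst hR0
  obtain rfl : c02 = 0 := by omega
  obtain rfl : c12 = 0 := by omega
  obtain rfl : c22 = 0 := by omega
  simp only [zero_mul, add_zero] at small e1 r0 r1 r2 hP hQ
  have hq : 0 < P := by omega
  rcases Nat.eq_zero_or_pos Q with hQ0 | hQ0
  · subst hQ0
    obtain rfl : c01 = 0 := by omega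
    obtain rfl : c11 = 0 := by omega
    obtain rfl : c21 = 0 := by omega
    simp only [zero_mul, add_zero] at small e1 r0 r1 r2 hP hQ
    by_cases hP3 : P = 3
    · subst hP3
      obtain rfl : c00 = 1 := by omega
      obtain rfl : c10 = 1 := by omega
      obtain rfl : c20 = 1 := by omega
      exact eqc (by omega) (fun l => by fin_cases l <;> simp <;> omega)
    rcases small (by
      intro y hy h
      have := hy 0
      have : 4 * y 0 ≤ P * y 0 := Nat.mul_le_mul_right _ (by omega)
      omega) with h | h | h | h
    · obtain rfl : P = 4 := by apply Nat.eq_of_mul_eq_mul_right p0; omega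
      apply p4 h
      rw [← r0, ← r1, ← r2]
      by_cases c : c00 = 2
      · left; subst c; obtain rfl : c10 = 1 := by omega
        obtain rfl : c20 = 1 := by omega
        omega
      by_cases c' : c10 = 2
      · right; left; subst c'; obtain rfl : c00 = 1 := by omega
        obtain rfl : c20 = 1 := by omega
        omega
      · right; right; obtain rfl : c20 = 2 := by omega
        obtain rfl : c00 = 1 := by omega
        obtain rfl : c10 = 1 := by omega
        omega
    · obtain rfl : P = 6 := by apply Nat.eq_of_mul_eq_mul_right p0; omega
      refine p6 h ![c00, c10, c20] (fun t => ?_) (fun t => ?_) (by simpa using hP)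
      · fin_cases t
        · simp; rw [← r0, ← h]; ring
        · simp; rw [← r1, ← h]; ring
        · simp; rw [← r2, ← h]; ring
      · fin_cases t <;> simp <;> assumption
    · exfalso
      obtain rfl : P = 10 := by apply Nat.eq_of_mul_eq_mul_right p0; omega
      have := ex10 (by omega)
      omega
    · exfalso
      have : P * (10 * m 0) = 10 * n := by rw [← e1]; ring
      rw [h] at this
      have : (3 * P) * n = 10 * n := by rw [← this]; ring
      have := Nat.eq_of_mul_eq_mul_right hn this
      omega
  have hQm : 0 < Q * m 1 := Nat.mul_pos hQ0 p1
  have f0 : c00 ≤ P := by omega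
  have f1 : c10 ≤ P := by omega
  have g0 : c01 ≤ Q := by omega
  have g1 : c11 ≤ Q := by omega
  by_cases hP2 : P ≤ 2
  · clear ex small six p6 eqc p4 tens
    obtain rfl : c20 = P - c00 - c10 := by omega
    obtain rfl : c21 = Q - c01 - c11 := by omega
    interval_cases P
    · obtain rfl : Q = 1 := by omega
      omega
    · obtain hQ | hQ : Q = 1 ∨ Q = 2 := by omega
      · subst hQ
        apply simL
        clear rightL rightL'
        interval_cases c00 <;> interval_cases c10 <;> (try omega) <;> interval_cases c01 <;> interval_cases c11 <;> omega
      · subst hQ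
        have hh : 2 * (m 0 + m 1) = n := by omega
        replace rightL := rightL hh
        replace rightL' := rightL' hh
        interval_cases c00 <;> interval_cases c10 <;> (try omega) <;> interval_cases c01 <;> interval_cases c11 <;>
          first
          | (exfalso; omega)
          | (apply simL; omega)
          | (apply rightL; omega)
          | (apply rightL'; omega)
  have six' : ∀ f1 f2, 6 * m 0 = n → m 1 = f1 * m 0 → m 2 = f2 * m 0 → Good N := by
    intro f1 f2 h h1 h2
    refine six ![1, f1, f2] ![c00 + c01 * f1, c10 + c11 * f1, c20 + c21 * f1] (fun t => ?_) (fun t => ?_)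
    · fin_cases t <;> simp
      · exact h
      · rw [h1, ← h]; ring
      · rw [h2, ← h]; ring
    · fin_cases t <;> simp
      · rw [← r0, h1, ← h]; ring
      · rw [← r1, h1, ← h]; ring
      · rw [← r2, h1, ← h]; ring
  rcases small (by
      intro y hy h
      have := hy 0
      have : 3 * y 0 ≤ P * y 0 := Nat.mul_le_mul_right _ (by omega)
      have : 0 < Q * y 1 := Nat.mul_pos hQ0 (hy 1)
      omega) with h | h | h | h
  · have hP3 : P < 4 := by
      by_contra hc
      have : 4 * m 0 ≤ P * m 0 := Nat.mul_le_mul_right _ (by omega)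
      omega
    obtain rfl : P = 3 := by omega
    interval_cases Q
    · apply simL
      obtain rfl : c20 = 3 - c00 - c10 := by omega
      obtain rfl : c21 = 1 - c01 - c11 := by omega
      clear ex small six p6 eqc p4 tens rightL rightL' six'
      interval_cases c00 <;> interval_cases c10 <;> (try omega) <;> interval_cases c01 <;> interval_cases c11 <;> omega
    · have := ex (m 1) 8 2 1 3 rfl (by omega) (by omega) (by omega) (by norm_num) (by norm_num)
      norm_num at this
    · have := ex (m 1) 12 3 1 5 rfl (by omega) (by omega) (by omega) (by norm_num) (by norm_num)
      norm_num at this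
  · have hP3 : P < 6 := by
      by_contra hc
      have : 6 * m 0 ≤ P * m 0 := Nat.mul_le_mul_right _ (by omega)
      omega
    have hP3' : 3 ≤ P := by omega
    interval_cases P
    · interval_cases Q
      · exact six' 3 2 h (by omega) (by omega)
      · have := ex (60 * s) 12 2 3 5 rfl (by omega) (by omega) (by omega) (by norm_num) (by norm_num)
        norm_num at this
      · exact six' 1 4 h (by omega) (by omega)
    · interval_cases Q
      · exact six' 2 3 h (by omega) (by omega)
      · exact six' 1 4 h (by omega) (by omega)
      · have := ex (40 * s) 18 3 2 5 rfl (by omega) (by omega) (by omega) (by norm_num) (by norm_num)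
        norm_num at this
      · have := ex (60 * s) 12 2 1 5 rfl (by omega) (by omega) (by omega) (by norm_num) (by norm_num)
        norm_num at this
    · interval_cases Q
      · exact six' 1 4 h (by omega) (by omega)
      · have := ex (m 1) 12 2 1 5 rfl (by omega) (by omega) (by omega) (by norm_num) (by norm_num)
        norm_num at this
      · have := ex (m 1) 18 3 1 5 rfl (by omega) (by omega) (by omega) (by norm_num) (by norm_num)
        norm_num at this
      · have := ex (m 1) 24 4 1 5 rfl (by omega) (by omega) (by omega) (by norm_num) (by norm_num)
        norm_num at this
      · have := ex (m 1) 30 5 1 7 rfl (by omega) (by omega) (by omega) (by norm_num) (by norm_num)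
        norm_num at this
  · have hP3 : P < 4 := by
      by_contra hc
      have := ex10 (by omega)
      omega
    obtain rfl : P = 3 := by omega
    interval_cases Q
    · have hh := tens (Or.inl ⟨by omega, by omega⟩)
      clear ex small six p6 eqc p4 tens rightL rightL' six'
      obtain rfl : c20 = 3 - c00 - c10 := by omega
      obtain rfl : c21 = 1 - c01 - c11 := by omega
      interval_cases c00 <;> interval_cases c10 <;> (try omega) <;> interval_cases c01 <;> interval_cases c11 <;>
        first
        | (exfalso; omega)
        | (apply simL; omega)
        | (apply hh; omega)
    · have := ex (36 * s) 20 2 7 7 rfl (by omega) (by omega) (by omega) (by norm_num) (by norm_num)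
      norm_num at this
    · have := ex (24 * s) 30 3 7 7 rfl (by omega) (by omega) (by omega) (by norm_num) (by norm_num)
      norm_num at this
  · have hP3 : P < 4 := by
      by_contra hc
      have : 4 * m 0 ≤ P * m 0 := Nat.mul_le_mul_right _ (by omega)
      omega
    obtain rfl : P = 3 := by omega
    interval_cases Q
    · have hh := tens (Or.inr ⟨by omega, by omega⟩)
      clear ex small six p6 eqc p4 tens rightL rightL' six'
      obtain rfl : c20 = 3 - c00 - c10 := by omega
      obtain rfl : c21 = 1 - c01 - c11 := by omega
      interval_cases c00 <;> interval_cases c10 <;> (try omega) <;> interval_cases c01 <;> interval_cases c11 <;>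
        first
        | (exfalso; omega)
        | (apply simL; omega)
        | (apply hh; omega)
    · have := ex (m 1) 20 6 1 9 rfl (by omega) (by omega) (by omega) (by norm_num) (by norm_num)
      norm_num at this
    · have := ex (m 1) 30 9 1 11 rfl (by omega) (by omega) (by omega) (by norm_num) (by norm_num)
      norm_num at this

lemma main (d : Dat n N m M cnt side lam) : Good N := by
  let P := fun t => ∑ l, cnt l t
  have key : ∀ σ : Equiv.Perm (Fin 3), P (σ 1) ≤ P (σ 0) → P (σ 2) ≤ P (σ 1) → Good N := fun σ h1 h2 =>
    (d.permT σ).main_sorted h1 h2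
  rcases le_total (P 0) (P 1) with a | a <;> rcases le_total (P 1) (P 2) with b | b <;> rcases le_total (P 0) (P 2) with c | c
  · exact key (Equiv.swap 0 2) (by simpa [Equiv.swap_apply_of_ne_of_ne] using b) (by simpa [Equiv.swap_apply_of_ne_of_ne] using a)
  · exact key (Equiv.swap 0 2) (by simpa [Equiv.swap_apply_of_ne_of_ne] using b) (by simpa [Equiv.swap_apply_of_ne_of_ne] using a)
  · exact key (finRotate 3) b c
  · exact key (Equiv.swap 0 1) (by simpa [Equiv.swap_apply_of_ne_of_ne] using a) (by simpa [Equiv.swap_apply_of_ne_of_ne] using c)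
  · exact key (finRotate 3).symm c a
  · exact key (Equiv.swap 1 2) (by simpa [Equiv.swap_apply_of_ne_of_ne] using c) (by simpa [Equiv.swap_apply_of_ne_of_ne] using b)
  · exact key (Equiv.refl _) a b
  · exact key (Equiv.refl _) a b
end Dat

/-- A closed polygon with directions which are powers of `zeta n`. -/
structure TPoly (n : ℕ) (w : Fin 3 → ℂ) (r : Fin 3 → ℝ) (e μ : Fin 3 → ℕ) : Prop where
  edge : ∀ j, w (j + 2) - w (j + 1) = r j * zeta n ^ e j
  rpos : ∀ j, 0 < r j
  turn : ∀ j, e (j + 1) + μ (j + 2) ≡ e j + n [MOD 2 * n]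
  mpos : ∀ j, 0 < μ j
  mlt : ∀ j, μ j < n

def lge (z : ℂ) : Prop := 0 < z.im ∨ (z.im = 0 ∧ 0 ≤ z.re)

lemma zeta_n {n : ℕ} (hn : 0 < n) : zeta n ^ n = -1 := by
  have hn' : (n:ℝ) ≠ 0 := by exact_mod_cast hn.ne'
  rw [zeta_pow, show (n * π / n : ℝ) = π by field_simp, Complex.exp_pi_mul_I]

lemma zeta_2n {n : ℕ} (hn : 0 < n) : zeta n ^ (2 * n) = 1 := by
  rw [mul_comm, pow_mul, zeta_n hn]; norm_num

lemma zeta_modEq {n a b : ℕ} (hn : 0 < n) (h : a ≡ b [MOD 2 * n]) : zeta n ^ a = zeta n ^ b := by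
  rw [pow_eq_pow_mod a (zeta_2n hn), pow_eq_pow_mod b (zeta_2n hn), h]

lemma zeta_im (n j : ℕ) : (zeta n ^ j).im = sin (j * π / n) := by rw [zeta_pow, Complex.exp_ofReal_mul_I_im]
lemma zeta_re (n j : ℕ) : (zeta n ^ j).re = cos (j * π / n) := by rw [zeta_pow, Complex.exp_ofReal_mul_I_re]

lemma zeta_conj {n : ℕ} (hn : 0 < n) (j : ℕ) : (starRingEnd ℂ) (zeta n ^ j) = zeta n ^ (j * (2 * n - 1)) := by
  have h1 : zeta n ^ j * zeta n ^ (j * (2 * n - 1)) = 1 := by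
    rw [← pow_add, show j + j * (2 * n - 1) = (2 * n) * j by
      obtain ⟨q, hq⟩ : ∃ q, 2 * n = q + 1 := ⟨2 * n - 1, by omega⟩
      rw [hq]; simp; ring, pow_mul, zeta_2n hn, one_pow]
  have h0 : zeta n ^ j ≠ 0 := left_ne_zero_of_mul_eq_one h1
  apply mul_left_cancel₀ h0
  rw [h1, Complex.mul_conj, Complex.normSq_eq_norm_sq, zeta_pow, Complex.norm_exp_ofReal_mul_I]; simp

lemma zeta_mul_conj {n : ℕ} (j : ℕ) : zeta n ^ j * (starRingEnd ℂ) (zeta n ^ j) = 1 := by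
  rw [Complex.mul_conj, Complex.normSq_eq_norm_sq, zeta_pow, Complex.norm_exp_ofReal_mul_I]; simp

lemma zeta_div {n : ℕ} (hn : 0 < n) (a : ℕ) : zeta n ^ a = (-1) ^ (a / n) * zeta n ^ (a % n) := by
  conv_lhs => rw [← Nat.div_add_mod a n, pow_add, pow_mul, zeta_n hn]

lemma lge_sgn {n a : ℕ} {x : ℝ} (hn : 0 < n) (hx : x ≠ 0) (h : lge (x * zeta n ^ a)) : 0 < x * (-1) ^ (a / n) := by
  have hn' : (0:ℝ) < n := by exact_mod_cast hn
  rw [zeta_div hn, ← mul_assoc] at h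
  have hy : x * (-1) ^ (a / n) ≠ 0 := mul_ne_zero hx (pow_ne_zero _ (by norm_num))
  have he : (x:ℂ) * (-1) ^ (a / n) = ((x * (-1) ^ (a / n) : ℝ) : ℂ) := by push_cast; ring
  rw [he] at h
  set y := x * (-1) ^ (a / n)
  unfold lge at h
  rw [Complex.re_ofReal_mul, Complex.im_ofReal_mul, zeta_im, zeta_re] at h
  rcases Nat.eq_zero_or_pos (a % n) with h0 | h0
  · rw [h0] at h; simp at h
    exact lt_of_le_of_ne h (Ne.symm hy)
  · have hlt : ((a % n : ℕ):ℝ) < n := by exact_mod_cast Nat.mod_lt a hn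
    have hpos : (0:ℝ) < (a % n : ℕ) := by exact_mod_cast h0
    have : 0 < sin ((a % n : ℕ) * π / n) := by
      apply sin_pos_of_pos_of_lt_pi
      · positivity
      · rw [div_lt_iff₀ hn']; nlinarith [pi_pos]
    rcases h with h | h
    · exact (pos_iff_pos_of_mul_pos h).2 this
    · rcases mul_eq_zero.1 h.1 with h1 | h1
      · exact absurd h1 hy
      · exact absurd h1 this.ne'

lemma par {n k A B C : ℕ} (hn : 0 < n) (hk : Odd k) (h : A + C ≡ B + k * n [MOD 2 * n])
    (ho : Odd (A / n + B / n + C / n)) : A % n + C % n = B % n := by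
  have hA := Nat.div_add_mod A n
  have hB := Nat.div_add_mod B n
  have hC := Nat.div_add_mod C n
  have lA := Nat.mod_lt A hn
  have lB := Nat.mod_lt B hn
  have lC := Nat.mod_lt C hn
  generalize A / n = a at *
  generalize B / n = b at *
  generalize C / n = c at *
  generalize A % n = x at *
  generalize B % n = y at *
  generalize C % n = z at *
  obtain ⟨s, hs⟩ := ho
  obtain ⟨t, ht⟩ := hk
  obtain ⟨u, hu⟩ := (Nat.modEq_iff_dvd.1 h)
  subst hA hB hC
  push_cast at hu
  zify at *
  have h2 : x + z - y = 2 * n * (b + t - s - u) := by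
    rw [ht] at hu
    have e : (a:ℤ) = 2 * s + 1 - b - c := by linarith
    rw [e] at hu
    linear_combination -hu
  have h3 : (b + t - s - u : ℤ) = 0 := by
    generalize (b + t - s - u : ℤ) = v at *
    have h4 : v < 1 := by
      by_contra hc; push Not at hc; nlinarith
    have h5 : -1 < v := by
      by_contra hc; push Not at hc; nlinarith
    omega
  rw [h3] at h2
  linarith

lemma f11 (j : Fin 3) : j + 1 + 1 = j + 2 := by fin_cases j <;> rfl
lemma f12 (j : Fin 3) : j + 1 + 2 = j := by fin_cases j <;> rfl
lemma f21 (j : Fin 3) : j + 2 + 1 = j := by fin_cases j <;> rfl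
lemma f22 (j : Fin 3) : j + 2 + 2 = j + 1 := by fin_cases j <;> rfl

/-- the image polygon under a Galois-type map -/
structure IP (n k : ℕ) (w : Fin 3 → ℂ) (p : Fin 3 → ℝ) (e μ : Fin 3 → ℕ) : Prop where
  edge : ∀ j, w (j + 2) - w (j + 1) = p j * zeta n ^ (k * e j)
  turn : ∀ j, e (j + 1) + μ (j + 2) ≡ e j + n [MOD 2 * n]
  ori : ∀ j, 0 < p (j + 1) * p (j + 2) * sin (k * (μ j * π / n))

namespace IP
variable {n k : ℕ} {w : Fin 3 → ℂ} {p : Fin 3 → ℝ} {e μ : Fin 3 → ℕ}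

lemma e1 (h : IP n k w p e μ) (j) : w j - w (j + 2) = p (j + 1) * zeta n ^ (k * e (j + 1)) := by
  have := h.edge (j + 1); rwa [f12, f11] at this
lemma e2 (h : IP n k w p e μ) (j) : w (j + 1) - w j = p (j + 2) * zeta n ^ (k * e (j + 2)) := by
  have := h.edge (j + 2); rwa [f22, f21] at this
lemma t1 (h : IP n k w p e μ) (j) : k * e (j + 2) + k * μ j ≡ k * e (j + 1) + k * n [MOD 2 * n] := by
  have := h.turn (j + 1); rw [f11, f12] at this
  simpa [mul_add] using this.mul_left k
lemma pne (h : IP n k w p e μ) (j) : p j ≠ 0 := by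
  have := h.ori (j + 1); rw [f11, f12] at this
  intro h0; simp [h0] at this

lemma cross_eq (h : IP n k w p e μ) (hn : 0 < n) (hk : Odd k) (j) :
    ((w (j + 2) - w j) * (starRingEnd ℂ) (w (j + 1) - w j)).im = p (j + 1) * p (j + 2) * sin (k * (μ j * π / n)) := by
  have h1 := zeta_modEq hn (h.t1 j)
  rw [pow_add, pow_add, mul_comm k n, pow_mul _ n k, zeta_n hn, hk.neg_one_pow] at h1
  have h2 : w (j + 2) - w j = - (p (j + 1) * zeta n ^ (k * e (j + 1))) := by rw [← h.e1]; ring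
  rw [h2, h.e2, map_mul, Complex.conj_ofReal]
  have h3 := zeta_mul_conj (n := n) (k * e (j + 2))
  have : -((p (j + 1) : ℂ) * zeta n ^ (k * e (j + 1))) * (p (j + 2) * (starRingEnd ℂ) (zeta n ^ (k * e (j + 2)))) =
    ((p (j + 1) * p (j + 2) : ℝ) : ℂ) * zeta n ^ (k * μ j) := by
    push_cast
    linear_combination (-(p (j + 1) : ℂ) * p (j + 2) * (starRingEnd ℂ) (zeta n ^ (k * e (j + 2)))) * h1
      + ((p (j + 1) : ℂ) * p (j + 2) * zeta n ^ (k * μ j)) * h3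
  rw [this, Complex.im_ofReal_mul, zeta_im]
  congr 2; push_cast; ring

lemma cross (h : IP n k w p e μ) (hn : 0 < n) (hk : Odd k) (j) :
    0 < ((w (j + 2) - w j) * (starRingEnd ℂ) (w (j + 1) - w j)).im := by
  rw [h.cross_eq hn hk]; exact h.ori j

lemma vertex (h : IP n k w p e μ) (hn : 0 < n) (hk : Odd k) (j) {y : ℝ} (hy : y ≠ 0) (q : ℕ)
    (h1 : lge ((w (j + 1) - w j) * (y * zeta n ^ q))) (h2 : lge ((w (j + 2) - w j) * (y * zeta n ^ q))) :
    (k * e (j + 2) + q) % n + k * μ j % n = (k * e (j + 1) + q) % n := by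
  have a1 : (w (j + 1) - w j) * (y * zeta n ^ q) = ((p (j + 2) * y : ℝ) : ℂ) * zeta n ^ (k * e (j + 2) + q) := by
    rw [h.e2, pow_add]; push_cast; ring
  have a2 : (w (j + 2) - w j) * (y * zeta n ^ q) = ((-p (j + 1) * y : ℝ) : ℂ) * zeta n ^ (k * e (j + 1) + q) := by
    rw [show w (j + 2) - w j = -(w j - w (j + 2)) by ring, h.e1, pow_add]; push_cast; ring
  rw [a1] at h1; rw [a2] at h2
  have b1 := lge_sgn hn (mul_ne_zero (h.pne _) hy) h1
  have b2 := lge_sgn hn (mul_ne_zero (neg_ne_zero.2 (h.pne _)) hy) h2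
  have b3 := h.ori j
  rw [sin_mod hn] at b3
  have b4 : 0 ≤ sin ((k * μ j % n : ℕ) * π / n) := by
    have hn' : (0:ℝ) < n := by exact_mod_cast hn
    apply sin_nonneg_of_nonneg_of_le_pi (by positivity)
    rw [div_le_iff₀ hn']
    have : ((k * μ j % n : ℕ):ℝ) < n := by exact_mod_cast Nat.mod_lt _ hn
    nlinarith [pi_pos]
  have b5 : 0 < p (j + 1) * p (j + 2) * (-1) ^ (k * μ j / n) := by
    rw [← mul_assoc] at b3
    by_contra hc; push Not at hc
    have := mul_nonpos_of_nonpos_of_nonneg hc b4; linarith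
  apply par hn hk
  · have := (h.t1 j).add_right q
    convert this using 1 <;> ring
  · by_contra hc
    rw [Nat.not_odd_iff_even] at hc
    have c1 := hc.neg_one_pow (α := ℝ)
    have c2 := mul_pos (mul_pos b1 b2) b5
    rw [pow_add, pow_add] at c1
    have : p (j + 2) * y * (-1) ^ ((k * e (j + 2) + q) / n) * (-p (j + 1) * y * (-1) ^ ((k * e (j + 1) + q) / n)) * (p (j + 1) * p (j + 2) * (-1) ^ (k * μ j / n)) = -(p (j+1) * p (j + 2) * y) ^ 2 * ((-1) ^ ((k * e (j + 2) + q) / n) * (-1) ^ ((k * e (j + 1) + q) / n) * (-1) ^ (k * μ j / n)) := by ring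
    rw [this, c1] at c2
    nlinarith [sq_nonneg (p (j+1) * p (j + 2) * y)]

end IP

lemma exists_lex {ι : Type*} [Fintype ι] [Nonempty ι] (f : ι → ℂ) : ∃ s, ∀ t, lge (f t - f s) := by
  obtain ⟨s, -, hs⟩ := Finset.exists_min_image Finset.univ (fun t => toLex ((f t).im, (f t).re)) Finset.univ_nonempty
  refine ⟨s, fun t => ?_⟩
  have := hs t (Finset.mem_univ _)
  rw [Prod.Lex.toLex_le_toLex] at this
  unfold lge
  simp only [Complex.sub_im, Complex.sub_re]
  rcases this with h | ⟨h, h'⟩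
  · left; simpa using h
  · right; simp at h h'; exact ⟨by rw [h]; ring, by linarith⟩

def Bal (n : ℕ) {N : ℕ} (w : Fin N → Fin 3 → ℂ) (e : Fin N → Fin 3 → ℕ) (W : Fin 3 → ℂ) (eW : Fin 3 → ℕ) : Prop :=
  ∀ G : ℂ → ℕ → ℝ, ∑ i, ∑ j, (G (w i (j + 2)) (e i j % n) - G (w i (j + 1)) (e i j % n)) =
    ∑ j, (G (W (j + 2)) (eW j % n) - G (W (j + 1)) (eW j % n))

lemma sum_shift (G : ℂ → ℕ → ℝ) (w : Fin 3 → ℂ) (e : Fin 3 → ℕ) :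
    ∑ j, (G (w (j + 2)) (e j) - G (w (j + 1)) (e j)) = ∑ j, (G (w j) (e (j + 1)) - G (w j) (e (j + 2))) := by
  simp [Fin.sum_univ_three]
  ring

section
variable {n k N : ℕ} {w : Fin N → Fin 3 → ℂ} {p : Fin N → Fin 3 → ℝ} {e μ : Fin N → Fin 3 → ℕ}
  {W : Fin 3 → ℂ} {P : Fin 3 → ℝ} {eW M : Fin 3 → ℕ}

lemma IP.vsum {w' : Fin 3 → ℂ} {w : Fin 3 → ℂ} {p : Fin 3 → ℝ} {e μ : Fin 3 → ℕ}
    (h : IP n k w' p e μ) (hn : 0 < n) (hk : Odd k) {y : ℝ} (hy : y ≠ 0) (q : ℕ) (x0 x' : ℂ)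
    (hx : ∀ j, w j = x0 → w' j = x') (hl : ∀ j, lge ((w' j - x') * (y * zeta n ^ q))) :
    ∑ j, ((if w (j + 2) = x0 then (((k * (e j % n) + q) % n : ℕ) : ℝ) else 0) -
      (if w (j + 1) = x0 then (((k * (e j % n) + q) % n : ℕ) : ℝ) else 0)) =
    ∑ j, if w j = x0 then ((k * μ j % n : ℕ) : ℝ) else 0 := by
  rw [sum_shift (fun z c => if z = x0 then (((k * (c % n) + q) % n : ℕ) : ℝ) else 0) w e]
  apply Finset.sum_congr rfl
  intro j _
  by_cases hj : w j = x0
  · simp only [hj, if_true]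
    have hh := hx j hj
    have := h.vertex hn hk j hy q (by rw [hh]; exact hl _) (by rw [hh]; exact hl _)
    have e : ∀ c, (k * (c % n) + q) % n = (k * c + q) % n := fun c => by
      rw [Nat.add_mod, Nat.mul_mod, Nat.mod_mod, ← Nat.mul_mod, ← Nat.add_mod]
    rw [e, e, ← this]; push_cast; ring
  · simp [hj]

lemma lex_main (Ψ : ℂ →+ ℂ) (hn : 0 < n) (hk : Odd k)
    (ht : ∀ i, IP n k (fun j => Ψ (w i j)) (p i) (e i) (μ i)) (hA : IP n k (fun j => Ψ (W j)) P eW M)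
    (hμ : ∀ i j, 0 < k * μ i j % n) (bal : Bal n w e W eW) (l : Fin 3) :
    (∀ i j, 0 ≤ ((Ψ (w i j) - Ψ (W l)) * (starRingEnd ℂ) (Ψ (W (l + 1)) - Ψ (W l))).im) ∧
    ∑ i, ∑ j, (if w i j = W l then ((k * μ i j % n : ℕ) : ℝ) else 0) = ((k * M l % n : ℕ) : ℝ) := by
  set D := Ψ (W (l + 1)) - Ψ (W l) with hD
  have hDe : D = P (l + 2) * zeta n ^ (k * eW (l + 2)) := hA.e2 l
  set y := P (l + 2)
  have hy : y ≠ 0 := hA.pne _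
  set q := k * eW (l + 2) * (2 * n - 1)
  have hcD : (starRingEnd ℂ) D = y * zeta n ^ q := by
    rw [hDe, map_mul, Complex.conj_ofReal, zeta_conj hn]
  have cr := hA.cross hn hk
  let vt : (Fin N × Fin 3) ⊕ Fin 3 → ℂ := Sum.elim (fun a => w a.1 a.2) W
  obtain ⟨s, hs⟩ := exists_lex (fun t => Ψ (vt t) * (starRingEnd ℂ) D)
  have hs' : ∀ t, lge ((Ψ (vt t) - Ψ (vt s)) * (y * zeta n ^ q)) := by
    intro t; rw [← hcD, sub_mul]; exact hs t
  have key : ∑ i, ∑ j, (if w i j = vt s then ((k * μ i j % n : ℕ) : ℝ) else 0) =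
      ∑ j, (if W j = vt s then ((k * M j % n : ℕ) : ℝ) else 0) := by
    have b := bal (fun z c => if z = vt s then (((k * c + q) % n : ℕ) : ℝ) else 0)
    rw [← hA.vsum (w := W) hn hk hy q (vt s) (Ψ (vt s)) (fun j h => by simp only [h]) (fun j => hs' (Sum.inr j)), ← b]
    apply Finset.sum_congr rfl
    intro i _
    rw [← (ht i).vsum (w := w i) hn hk hy q (vt s) (Ψ (vt s)) (fun j h => by simp only [h]) (fun j => hs' (Sum.inl (i, j)))]
  have hex : ∃ l', W l' = vt s := by
    rcases hs0 : s with ⟨i, j⟩ | l'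
    · by_contra hc
      push Not at hc
      rw [Finset.sum_congr rfl (fun j _ => if_neg (hs0 ▸ hc j)), Finset.sum_const_zero] at key
      rw [Finset.sum_eq_zero_iff_of_nonneg (fun i _ => Finset.sum_nonneg fun j _ => by split_ifs <;> positivity)] at key
      have k1 := key i (Finset.mem_univ _)
      rw [Finset.sum_eq_zero_iff_of_nonneg (fun j _ => by split_ifs <;> positivity)] at k1
      have k2 := k1 j (Finset.mem_univ _)
      rw [if_pos (by rw [hs0]; rfl)] at k2
      have := hμ i j
      rw [Nat.cast_eq_zero] at k2
      omega
    · exact ⟨l', rfl⟩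
  obtain ⟨l', hl'⟩ := hex
  rw [← hl'] at hs' key
  have hl : l' = l := by
    have hc : l' = l ∨ l' = l + 1 ∨ l' = l + 2 := by
      clear * -; revert l l'; decide
    rcases hc with h | h | h
    · exact h
    · exfalso
      have h1 := hs' (Sum.inr l)
      rw [← hcD, h] at h1
      have h2 : (Ψ (vt (Sum.inr l)) - Ψ (W (l + 1))) * (starRingEnd ℂ) D = ((-Complex.normSq D : ℝ) : ℂ) := by
        rw [show Ψ (vt (Sum.inr l)) - Ψ (W (l + 1)) = - D by rw [hD]; simp [vt], neg_mul, Complex.mul_conj]; simp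
      rw [h2] at h1
      have h3 : D ≠ 0 := by rw [hDe]; exact mul_ne_zero (by exact_mod_cast hy) (pow_ne_zero _ (by unfold zeta; exact Complex.exp_ne_zero _))
      have h4 := Complex.normSq_pos.2 h3
      unfold lge at h1
      simp at h1
      linarith
    · exfalso
      have h1 := hs' (Sum.inr l)
      rw [← hcD, h] at h1
      have h2 := cr l
      unfold lge at h1
      rw [show Ψ (vt (Sum.inr l)) - Ψ (W (l + 2)) = -(Ψ (W (l + 2)) - Ψ (W l)) by simp [vt], neg_mul, Complex.neg_im] at h1
      rcases h1 with h1 | ⟨h1, -⟩ <;> linarith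
  subst hl
  constructor
  · intro i j
    have := hs' (Sum.inl (i, j))
    rw [← hcD] at this
    rcases this with h | h
    · exact h.le
    · exact h.1.ge
  · rw [key, Finset.sum_eq_single l']
    · simp
    · intro b _ hb
      rw [if_neg]
      intro h
      have hc : b = l' + 1 ∨ b = l' + 2 := by
        clear * - hb; revert b l'; decide
      have := cr l'
      rcases hc with h' | h' <;> rw [← h', h] at this <;> simp at this
    · simp

lemma side_pos (Ψ : ℂ →+ ℂ) (ρ : ℝ → ℝ) (hΨ : ∀ (x : ℝ) (a : ℕ), Ψ (x * zeta n ^ a) = ρ x * zeta n ^ (k * a)) (hn : 0 < n) (hk : Odd k)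
    (ht : ∀ i, IP n k (fun j => Ψ (w i j)) (p i) (e i) (μ i)) (hA : IP n k (fun j => Ψ (W j)) P eW M)
    (hμ : ∀ i j, 0 < k * μ i j % n) (bal : Bal n w e W eW) (l : Fin 3) (i : Fin N) (j : Fin 3)
    (h1 : e i j % n = eW l % n) (h2 : ((w i (j + 1) - W (l + 1)) * (starRingEnd ℂ) (zeta n ^ eW l)).im = 0) :
    ∃ s : ℝ, (s = 1 ∨ s = -1) ∧ zeta n ^ e i j = s * zeta n ^ eW l ∧ 0 < s * p i j * P l := by
  obtain ⟨ha, -⟩ := lex_main Ψ hn hk ht hA hμ bal (l + 1)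
  rw [f11] at ha
  have hDe := hA.edge l
  set D := Ψ (W (l + 2)) - Ψ (W (l + 1)) with hD
  obtain ⟨s, hs, hz⟩ : ∃ s : ℝ, (s = 1 ∨ s = -1) ∧ zeta n ^ e i j = s * zeta n ^ eW l := by
    refine ⟨(-1) ^ (e i j / n + eW l / n), neg_one_pow_eq_or _ _, ?_⟩
    rw [zeta_div hn (e i j), zeta_div hn (eW l), h1, pow_add]
    push_cast
    have : ((-1 : ℂ) ^ (eW l / n)) * (-1) ^ (eW l / n) = 1 := by
      rw [← mul_pow]; norm_num
    linear_combination (-(-1) ^ (e i j / n) * zeta n ^ (eW l % n)) * this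
  refine ⟨s, hs, hz, ?_⟩
  have hsk : s ^ k = s := by rcases hs with h | h <;> simp [h, hk.neg_one_pow]
  have hs2 : s * s = 1 := by rcases hs with h | h <;> simp [h]
  have hP := hA.pne l
  have hb : ((Ψ (w i (j + 1)) - Ψ (W (l + 1))) * (starRingEnd ℂ) D).im = 0 := by
    set x := ((w i (j + 1) - W (l + 1)) * (starRingEnd ℂ) (zeta n ^ eW l)).re
    have hx : w i (j + 1) - W (l + 1) = x * zeta n ^ eW l := by
      have : ((x:ℝ):ℂ) = (w i (j + 1) - W (l + 1)) * (starRingEnd ℂ) (zeta n ^ eW l) := by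
        apply Complex.ext
        · simp [x]
        · rw [Complex.ofReal_im, h2]
      rw [this]
      have := zeta_mul_conj (n := n) (eW l)
      linear_combination -(w i (j + 1) - W (l + 1)) * this
    rw [← map_sub, hx, hΨ, hDe, map_mul, Complex.conj_ofReal]
    have := zeta_mul_conj (n := n) (k * eW l)
    rw [show (ρ x : ℂ) * zeta n ^ (k * eW l) * (P l * (starRingEnd ℂ) (zeta n ^ (k * eW l))) = ((ρ x * P l : ℝ) : ℂ) by
      push_cast; linear_combination (ρ x * P l : ℂ) * this, Complex.ofReal_im]
  have hE := (ht i).edge j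
  have hz' : zeta n ^ (k * e i j) = s * zeta n ^ (k * eW l) := by
    rw [mul_comm k, pow_mul, hz, mul_pow, ← pow_mul, mul_comm k]
    congr 1; exact_mod_cast hsk
  have hE' : Ψ (w i (j + 2)) - Ψ (w i (j + 1)) = ((p i j * s / P l : ℝ) : ℂ) * D := by
    rw [hE, hDe, hz']
    have : (P l : ℂ) ≠ 0 := by exact_mod_cast hP
    push_cast; field_simp
  have cr := (ht i).cross hn hk (j + 1)
  simp only [f12, f11] at cr
  rw [hE', map_mul, Complex.conj_ofReal, mul_left_comm, Complex.im_ofReal_mul] at cr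
  have h3 := ha i j
  have h4 : ((Ψ (w i j) - Ψ (w i (j + 1))) * (starRingEnd ℂ) D).im = ((Ψ (w i j) - Ψ (W (l + 1))) * (starRingEnd ℂ) D).im := by
    rw [show Ψ (w i j) - Ψ (w i (j + 1)) = (Ψ (w i j) - Ψ (W (l + 1))) - (Ψ (w i (j + 1)) - Ψ (W (l + 1))) by ring, sub_mul, Complex.sub_im, hb, sub_zero]
  rw [h4] at cr
  have h5 : 0 < p i j * s / P l := by
    by_contra hc; push Not at hc
    have := mul_nonpos_of_nonpos_of_nonneg hc h3; linarith
  have : s * p i j * P l = (p i j * s / P l) * (P l) ^ 2 := by field_simp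
  rw [this]
  positivity
end

structure Cfg (n N : ℕ) (m M : Fin 3 → ℕ) (w : Fin N → Fin 3 → ℂ) (e : Fin N → Fin 3 → ℕ)
    (τ : Fin N → Equiv.Perm (Fin 3)) (W : Fin 3 → ℂ) (X : Fin 3 → ℝ) (eW : Fin 3 → ℕ) : Prop where
  n720 : 720 ∣ n
  npos : 0 < n
  Npos : 0 < N
  mpos : ∀ t, 0 < m t
  msum : ∑ t, m t = n
  tile : ∀ i, TPoly n (w i) (fun j => sin (m (τ i j) * π / n)) (e i) (fun j => m (τ i j))
  abc : TPoly n W X eW M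
  bal : Bal n w e W eW

lemma sin_pos_nat {n a : ℕ} (h0 : 0 < a) (h1 : a < n) : 0 < sin (a * π / n) := by
  have h1' : (a:ℝ) < n := by exact_mod_cast h1
  have h0' : (0:ℝ) < a := by exact_mod_cast h0
  have hn : (0:ℝ) < n := by linarith
  apply sin_pos_of_pos_of_lt_pi
  · positivity
  · rw [div_lt_iff₀ hn]; nlinarith [pi_pos]

lemma TPoly.ip {n : ℕ} {w : Fin 3 → ℂ} {r : Fin 3 → ℝ} {e μ : Fin 3 → ℕ} (h : TPoly n w r e μ) : IP n 1 w r e μ where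
  edge := fun j => by rw [one_mul]; exact h.edge j
  turn := h.turn
  ori := fun j => by
    have := sin_pos_nat (h.mpos j) (h.mlt j)
    have h1 := h.rpos (j + 1)
    have h2 := h.rpos (j + 2)
    rw [Nat.cast_one, one_mul]; positivity

lemma cross_inv (w : Fin 3 → ℂ) (j : Fin 3) : ((w (j + 2) - w j) * (starRingEnd ℂ) (w (j + 1) - w j)).im =
    ((w 2 - w 0) * (starRingEnd ℂ) (w 1 - w 0)).im := by
  fin_cases j <;> simp <;> ring

lemma TPoly.area {n : ℕ} {w : Fin 3 → ℂ} {r : Fin 3 → ℝ} {e μ : Fin 3 → ℕ} (h : TPoly n w r e μ) (hn : 0 < n) (j) :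
    r (j + 1) * r (j + 2) * sin (μ j * π / n) = ((w 2 - w 0) * (starRingEnd ℂ) (w 1 - w 0)).im := by
  rw [← cross_inv w j, h.ip.cross_eq hn odd_one j, Nat.cast_one, one_mul]

lemma TPoly.law {n : ℕ} {w : Fin 3 → ℂ} {r : Fin 3 → ℝ} {e μ : Fin 3 → ℕ} (h : TPoly n w r e μ) (hn : 0 < n) (j) :
    r j = r 0 / sin (μ 0 * π / n) * sin (μ j * π / n) := by
  have a0 := h.area hn 0
  have a1 := h.area hn 1
  have a2 := h.area hn 2
  rw [← a0] at a1 a2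
  simp [z12, z22, z21, z11] at a1 a2
  have s0 := sin_pos_nat (h.mpos 0) (h.mlt 0)
  have r0 := h.rpos 0
  have r1 := h.rpos 1
  have r2 := h.rpos 2
  generalize hS : (fun t : Fin 3 => sin (μ t * π / n)) = S at *
  have hS' : ∀ t, sin (μ t * π / n) = S t := fun t => congrFun hS t
  simp only [hS'] at *
  fin_cases j
  · simp; field_simp
  · simp
    field_simp
    apply mul_left_cancel₀ r2.ne'
    linarith
  · simp
    field_simp
    apply mul_left_cancel₀ r1.ne'
    linarith

lemma TPoly.msum {n : ℕ} {w : Fin 3 → ℂ} {r : Fin 3 → ℝ} {e μ : Fin 3 → ℕ} (h : TPoly n w r e μ) : ∑ t, μ t = n := by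
  have t0 := h.turn 0
  have t1 := h.turn 1
  have t2 := h.turn 2
  have l0 := h.mlt 0
  have l1 := h.mlt 1
  have l2 := h.mlt 2
  have p0 := h.mpos 0
  have p1 := h.mpos 1
  have p2 := h.mpos 2
  simp [z12, z22, z21, z11] at t0 t1 t2
  rw [Nat.modEq_iff_dvd] at t0 t1 t2
  obtain ⟨a, ha⟩ := t0
  obtain ⟨b, hb⟩ := t1
  obtain ⟨c, hc⟩ := t2
  rw [Fin.sum_univ_three]
  push_cast at *
  zify at *
  have h2 : (μ 0 + μ 1 + μ 2 - n : ℤ) = 2 * n * (1 - a - b - c) := by linarith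
  have h3 : (1 - a - b - c : ℤ) = 0 := by
    generalize (1 - a - b - c : ℤ) = v at *
    have h4 : v < 1 := by
      by_contra hc; push Not at hc; nlinarith
    have h5 : -1 < v := by
      by_contra hc; push Not at hc; nlinarith
    omega
  rw [h3] at h2; linarith

lemma area_form {n : ℕ} {w : Fin 3 → ℂ} {r : Fin 3 → ℝ} {e μ : Fin 3 → ℕ} (h : TPoly n w r e μ) (hn : 0 < n) :
    ∑ j, (((w (j + 2)) ^ 2 * (starRingEnd ℂ) (zeta n ^ (2 * (e j % n)))).im - ((w (j + 1)) ^ 2 * (starRingEnd ℂ) (zeta n ^ (2 * (e j % n)))).im)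
     = -2 * ((w 2 - w 0) * (starRingEnd ℂ) (w 1 - w 0)).im := by
  have key : ∀ j, (((w (j + 2)) ^ 2 * (starRingEnd ℂ) (zeta n ^ (2 * (e j % n)))).im - ((w (j + 1)) ^ 2 * (starRingEnd ℂ) (zeta n ^ (2 * (e j % n)))).im) = ((w (j + 2) + w (j + 1)) * (starRingEnd ℂ) (w (j + 2) - w (j + 1))).im := by
    intro j
    have h1 : zeta n ^ (2 * (e j % n)) = zeta n ^ (e j) * zeta n ^ (e j) := by
      rw [zeta_div hn (e j), pow_mul', sq]
      have : ((-1 : ℂ) ^ (e j / n)) * (-1) ^ (e j / n) = 1 := by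
        rw [← mul_pow]; norm_num
      linear_combination -(zeta n ^ (e j % n) * zeta n ^ (e j % n)) * this
    rw [← Complex.sub_im, h1, ← sub_mul, map_mul]
    congr 1
    rw [show w (j + 2) ^ 2 - w (j + 1) ^ 2 = (w (j + 2) + w (j + 1)) * (w (j + 2) - w (j + 1)) by ring, h.edge j, map_mul, Complex.conj_ofReal]
    have := zeta_mul_conj (n := n) (e j)
    linear_combination ((w (j + 2) + w (j + 1)) * r j * (starRingEnd ℂ) (zeta n ^ e j)) * this
  rw [Finset.sum_congr rfl (fun j _ => key j), Fin.sum_univ_three]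
  simp [z12, z22, z21, z11]
  ring

def onl (n : ℕ) (z W : ℂ) (a : ℕ) : Prop := ((z - W) * (starRingEnd ℂ) (zeta n ^ a)).im = 0

open Classical in
noncomputable def sd (n : ℕ) {N : ℕ} (w : Fin N → Fin 3 → ℂ) (e : Fin N → Fin 3 → ℕ)
    (τ : Fin N → Equiv.Perm (Fin 3)) (W : Fin 3 → ℂ) (eW : Fin 3 → ℕ) (l t : Fin 3) : ℕ :=
  ∑ i, ∑ j, if (e i j % n = eW l % n ∧ onl n (w i (j + 1)) (W (l + 1)) (eW l)) ∧ τ i j = t then 1 else 0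

open Classical in
noncomputable def cn {N : ℕ} (w : Fin N → Fin 3 → ℂ)
    (τ : Fin N → Equiv.Perm (Fin 3)) (W : Fin 3 → ℂ) (l t : Fin 3) : ℕ :=
  ∑ i, ∑ j, if w i j = W l ∧ τ i j = t then 1 else 0

lemma cnt_sum {N : ℕ} (τ : Fin N → Equiv.Perm (Fin 3)) (Q : Fin N → Fin 3 → Prop) [∀ i j, Decidable (Q i j)] (f : Fin 3 → ℝ) :
    ∑ t, ((∑ i, ∑ j, if Q i j ∧ τ i j = t then 1 else 0 : ℕ) : ℝ) * f t = ∑ i, ∑ j, if Q i j then f (τ i j) else 0 := by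
  push_cast
  simp only [Finset.sum_mul]
  rw [Finset.sum_comm]
  apply Finset.sum_congr rfl; intro i _
  rw [Finset.sum_comm]
  apply Finset.sum_congr rfl; intro j _
  by_cases h : Q i j <;> simp [h]

namespace Cfg
variable {n N : ℕ} {m M : Fin 3 → ℕ} {w : Fin N → Fin 3 → ℂ} {e : Fin N → Fin 3 → ℕ}
    {τ : Fin N → Equiv.Perm (Fin 3)} {W : Fin 3 → ℂ} {X : Fin 3 → ℝ} {eW : Fin 3 → ℕ}

noncomputable def lm (X : Fin 3 → ℝ) (n : ℕ) (M : Fin 3 → ℕ) : ℝ := X 0 / sin (M 0 * π / n)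

lemma h2 (c : Cfg n N m M w e τ W X eW) : lm X n M ^ 2 * ∏ l, sin (M l * π / n) = N * ∏ t, sin (m t * π / n) := by
  have b := c.bal (fun z a => (z ^ 2 * (starRingEnd ℂ) (zeta n ^ (2 * a))).im)
  rw [area_form c.abc c.npos, Finset.sum_congr rfl (fun i _ => area_form (c.tile i) c.npos)] at b
  have b1 : ∀ i, ((w i 2 - w i 0) * (starRingEnd ℂ) (w i 1 - w i 0)).im = ∏ t, sin (m t * π / n) := by
    intro i
    rw [← (c.tile i).area c.npos 0, ← Equiv.prod_comp (τ i), Fin.prod_univ_three]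
    simp; ring
  rw [Finset.sum_congr rfl (fun i _ => by rw [b1]), Finset.sum_const, ← c.abc.area c.npos 0] at b
  have l1 := c.abc.law c.npos 1
  have l2 := c.abc.law c.npos 2
  simp at b
  rw [l1, l2] at b
  rw [Fin.prod_univ_three]
  unfold lm
  linear_combination -b/2

lemma mlt (c : Cfg n N m M w e τ W X eW) (t : Fin 3) : m t < n := by
  have i : Fin N := ⟨0, c.Npos⟩
  have := (c.tile i).mlt ((τ i).symm t)
  simpa using this

lemma on_eq (c : Cfg n N m M w e τ W X eW) {l : Fin 3} {i : Fin N} {j : Fin 3} (h : e i j % n = eW l % n)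
    (h' : onl n (w i (j + 1)) (W (l + 1)) (eW l)) : zeta n ^ e i j = zeta n ^ eW l := by
  obtain ⟨s, hs, hz, hp⟩ := side_pos (AddMonoidHom.id ℂ) id (k := 1) (fun x a => by simp) c.npos odd_one
    (fun i => (c.tile i).ip) c.abc.ip (fun i j => by
      rw [one_mul, Nat.mod_eq_of_lt (c.mlt _)]; exact c.mpos _) c.bal l i j h h'
  have hs1 : s = 1 := by
    rcases hs with h | h
    · exact h
    · exfalso
      rw [h] at hp
      have h1 := (c.tile i).rpos j
      have h2 := c.abc.rpos l
      nlinarith [mul_pos h1 h2]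
  rw [hz, hs1]; simp

open Classical in
lemma h1 (c : Cfg n N m M w e τ W X eW) (l : Fin 3) :
    ∑ t, (sd n w e τ W eW l t : ℝ) * sin (m t * π / n) = X l := by
  unfold sd
  rw [cnt_sum]
  have hn := c.npos
  have b := c.bal (fun z a => if a = eW l % n ∧ onl n z (W (l + 1)) (eW l) then (z * (starRingEnd ℂ) (zeta n ^ eW l)).re else 0)
  have hpar : ∀ (z1 z2 : ℂ) (a : ℕ) (x : ℝ), z2 - z1 = x * zeta n ^ a → a % n = eW l % n →
      ((z2 - z1) * (starRingEnd ℂ) (zeta n ^ eW l)).im = 0 := by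
    intro z1 z2 a x h1 h2
    rw [h1, zeta_div hn a, zeta_div hn (eW l), h2, map_mul, map_pow, map_neg, map_one]
    have := zeta_mul_conj (n := n) (eW l % n)
    rw [show (x:ℂ) * ((-1) ^ (a / n) * zeta n ^ (eW l % n)) * ((-1) ^ (eW l / n) * (starRingEnd ℂ) (zeta n ^ (eW l % n))) = ((x * (-1) ^ (a / n) * (-1) ^ (eW l / n) : ℝ) : ℂ) by
      push_cast; linear_combination (x * (-1) ^ (a / n) * (-1) ^ (eW l / n) : ℂ) * this, Complex.ofReal_im]
  have honl : ∀ (z1 z2 : ℂ) (a : ℕ) (x : ℝ), z2 - z1 = x * zeta n ^ a → a % n = eW l % n →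
      (onl n z2 (W (l + 1)) (eW l) ↔ onl n z1 (W (l + 1)) (eW l)) := by
    intro z1 z2 a x h1 h2
    have := hpar z1 z2 a x h1 h2
    unfold onl
    rw [show z2 - W (l + 1) = (z2 - z1) + (z1 - W (l + 1)) by ring, add_mul, Complex.add_im, this, zero_add]
  have hL : ∀ i j, ((if e i j % n = eW l % n ∧ onl n (w i (j + 2)) (W (l + 1)) (eW l) then (w i (j + 2) * (starRingEnd ℂ) (zeta n ^ eW l)).re else 0) -
      (if e i j % n = eW l % n ∧ onl n (w i (j + 1)) (W (l + 1)) (eW l) then (w i (j + 1) * (starRingEnd ℂ) (zeta n ^ eW l)).re else 0)) =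
      if e i j % n = eW l % n ∧ onl n (w i (j + 1)) (W (l + 1)) (eW l) then sin (m (τ i j) * π / n) else 0 := by
    intro i j
    by_cases h : e i j % n = eW l % n
    · rw [honl _ _ _ _ ((c.tile i).edge j) h]
      by_cases h' : onl n (w i (j + 1)) (W (l + 1)) (eW l)
      · simp only [h, h', and_self, if_true]
        rw [← Complex.sub_re, ← sub_mul, (c.tile i).edge j]
        rw [c.on_eq h h']
        have := zeta_mul_conj (n := n) (eW l)
        rw [mul_assoc, this, mul_one, Complex.ofReal_re]
      · simp [h']
    · simp [h]
  rw [Finset.sum_congr rfl (fun i _ => Finset.sum_congr rfl (fun j _ => hL i j))] at b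
  rw [b, Finset.sum_eq_single l]
  · have h1 : onl n (W (l + 1)) (W (l + 1)) (eW l) := by simp [onl]
    have h2 := (honl _ _ _ _ (c.abc.edge l) rfl).2 h1
    simp only [h1, h2, and_self, if_true]
    rw [← Complex.sub_re, ← sub_mul, c.abc.edge l, mul_assoc, zeta_mul_conj, mul_one, Complex.ofReal_re]
  · intro b _ hb
    have hne : ¬ (eW b % n = eW l % n) := by
      have gen : ∀ j, ¬ (eW (j + 1) % n = eW j % n) := by
        intro j h
        have t : eW (j + 1) + M (j + 2) ≡ eW j + n [MOD n] := (c.abc.turn j).of_dvd (Dvd.intro_left _ rfl)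
        have h' : eW (j + 1) ≡ eW j [MOD n] := h
        have := Nat.ModEq.add_left_cancel h' t
        have h2 : M (j + 2) % n = n % n := this
        rw [Nat.mod_self, Nat.mod_eq_of_lt (c.abc.mlt _)] at h2
        have := c.abc.mpos (j + 2)
        omega
      have hc : b = l + 1 ∨ l = b + 1 := by
        clear * - hb; revert b l; decide
      rcases hc with h | h
      · rw [h]; exact gen l
      · rw [h]; exact fun h => gen b h.symm
    simp [hne]
  · simp

lemma TRlm (c : Cfg n N m M w e τ W X eW) : TR (lm X n M) := by
  have hn := c.npos
  unfold lm
  apply TR.div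
  · rw [← c.h1 0, Fin.sum_univ_three]
    have g := fun t => (TR.nat (sd n w e τ W eW 0 t)).mul (TR_sin hn.ne' (m t))
    exact ((g 0).add (g 1)).add (g 2)
  · exact TR_sin hn.ne' _

lemma prodM (c : Cfg n N m M w e τ W X eW) {k : ℕ} (hk : k.Coprime (2 * n)) (h : 0 < ∏ t, sin (k * (m t * π / n))) :
    0 < ∏ t, sin (k * (M t * π / n)) := by
  obtain ⟨τ', hτ⟩ := exists_tau c.npos.ne' k hk
  obtain ⟨ε, hε, hs, -⟩ := rho_trig k τ' hτ
  have TS := fun j => TR_sin c.npos.ne' j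
  have e := congrArg (rho τ') c.h2
  simp only [Fin.prod_univ_three] at e h ⊢
  rw [rho_mul τ' (by rw [sq]; exact c.TRlm.mul c.TRlm), rho_sq τ' c.TRlm, rho_natmul, rho_mul τ' ((TS _).mul (TS _)), rho_mul τ' (TS _),
    rho_mul τ' ((TS _).mul (TS _)), rho_mul τ' (TS _)] at e
  simp only [hs] at e
  have hN : (0:ℝ) < N := by exact_mod_cast c.Npos
  have hε2 : ε * ε = 1 := by rcases hε with h | h <;> simp [h]
  have hε0 : ε ≠ 0 := by rintro rfl; simp at hε2
  have e2 : rho τ' (lm X n M) ^ 2 * (sin (k * (M 0 * π / n)) * sin (k * (M 1 * π / n)) * sin (k * (M 2 * π / n))) =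
      N * (sin (k * (m 0 * π / n)) * sin (k * (m 1 * π / n)) * sin (k * (m 2 * π / n))) := by
    apply mul_left_cancel₀ (pow_ne_zero 3 hε0)
    linear_combination e
  have := mul_pos hN h
  rw [← e2] at this
  by_contra hc; push Not at hc
  nlinarith [mul_nonpos_of_nonneg_of_nonpos (sq_nonneg (rho τ' (lm X n M))) hc]

noncomputable def Psi (τ : ℂ →+* ℂ) : ℂ →+ ℂ where
  toFun z := (τ z + (starRingEnd ℂ) (τ ((starRingEnd ℂ) z))) / 2
  map_zero' := by simp
  map_add' x y := by simp; ring

lemma Psi_apply {n k : ℕ} (hn : 0 < n) (τ : ℂ →+* ℂ) (h : τ (zeta n) = zeta n ^ k) (x : ℝ) (a : ℕ) :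
    Psi τ (x * zeta n ^ a) = rho τ x * zeta n ^ (k * a) := by
  show (τ (x * zeta n ^ a) + (starRingEnd ℂ) (τ ((starRingEnd ℂ) (x * zeta n ^ a)))) / 2 = _
  rw [map_mul (starRingEnd ℂ), zeta_conj hn, Complex.conj_ofReal, map_mul, map_mul, map_pow, map_pow, h, ← pow_mul, ← pow_mul,
    ← mul_assoc k a, ← zeta_conj hn (k * a), map_mul, Complex.conj_conj, ← add_mul, Complex.add_conj]
  simp [rho]; ring

lemma ips (c : Cfg n N m M w e τ W X eW) {k : ℕ} (hk : k.Coprime (2 * n)) (h : 0 < ∏ t, sin (k * (m t * π / n)))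
    (τ' : ℂ →+* ℂ) (hτ : τ' (zeta n) = zeta n ^ k) :
    (∀ i, IP n k (fun j => Psi τ' (w i j)) (fun j => rho τ' (sin (m (τ i j) * π / n))) (e i) (fun j => m (τ i j))) ∧
    IP n k (fun j => Psi τ' (W j)) (fun j => rho τ' (X j)) eW M := by
  obtain ⟨ε, hε, hs, -⟩ := rho_trig k τ' hτ
  have hε2 : ε * ε = 1 := by rcases hε with h | h <;> simp [h]
  have sh : ∀ (f : Fin 3 → ℝ) j, f (j + 1) * f (j + 2) * f j = ∏ t, f t := by
    intro f j; rw [Fin.prod_univ_three]; fin_cases j <;> simp <;> ring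
  refine ⟨fun i => ⟨fun j => ?_, (c.tile i).turn, fun j => ?_⟩, ⟨fun j => ?_, c.abc.turn, fun j => ?_⟩⟩
  · rw [← map_sub, (c.tile i).edge, Psi_apply c.npos τ' hτ]
  · simp only [hs]
    rw [← Equiv.prod_comp (τ i), ← sh _ j] at h
    linear_combination h - (sin (k * (m (τ i (j + 1)) * π / n)) * sin (k * (m (τ i (j + 2)) * π / n)) * sin (k * (m (τ i j) * π / n))) * hε2
  · rw [← map_sub, c.abc.edge, Psi_apply c.npos τ' hτ]
  · have h' := c.prodM hk h
    have hX : ∀ l, rho τ' (X l) = rho τ' (lm X n M) * (ε * sin (k * (M l * π / n))) := by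
      intro l
      rw [c.abc.law c.npos l, ← hs, ← rho_mul τ' c.TRlm]; rfl
    simp only [hX]
    rw [← sh _ j] at h'
    have hl : 0 < rho τ' (lm X n M) ^ 2 := by
      apply sq_pos_of_ne_zero
      refine rho_ne τ' c.TRlm ?_
      unfold lm
      exact (div_pos (c.abc.rpos 0) (sin_pos_nat (c.abc.mpos 0) (c.abc.mlt 0))).ne'
    have := mul_pos hl h'
    linear_combination this - (rho τ' (lm X n M) ^ 2 * (sin (k * (M (j + 1) * π / n)) * sin (k * (M (j + 2) * π / n)) * sin (k * (M j * π / n)))) * hε2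

lemma toDat (c : Cfg n N m M w e τ W X eW) :
    Dat n N m M (cn w τ W) (sd n w e τ W eW) (lm X n M) where
  n720 := c.n720
  npos := c.npos
  Npos := c.Npos
  mpos := c.mpos
  msum := c.msum
  Mpos := c.abc.mpos
  Msum := c.abc.msum
  lpos := div_pos (c.abc.rpos 0) (sin_pos_nat (c.abc.mpos 0) (c.abc.mlt 0))
  H1 := fun l => by rw [c.h1, c.abc.law c.npos l]; rfl
  H2 := c.h2
  H3 := fun k hk h l => by
    have hkodd : Odd k := (Nat.Coprime.coprime_dvd_right (Dvd.intro _ rfl) hk).symm.odd_of_left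
    obtain ⟨τ', hτ⟩ := exists_tau c.npos.ne' k hk
    obtain ⟨i1, i2⟩ := c.ips hk h τ' hτ
    have h0 := (sgn_sum m c.npos hk c.mpos c.msum).1
    have := (lex_main (Psi τ') c.npos hkodd i1 i2 (fun i j => h0 _) c.bal l).2
    classical
    have h2 := cnt_sum τ (fun i j => w i j = W l) (fun t => ((k * m t % n : ℕ) : ℝ))
    have h3 : ∑ t, (cn w τ W l t : ℝ) * ((k * m t % n : ℕ) : ℝ) = ((k * M l % n : ℕ) : ℝ) := by
      rw [← this]
      convert h2 using 1
      unfold cn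
      congr!
    exact_mod_cast h3
  H4 := by
    classical
    have key : ∀ k : ℕ, k.Coprime (2 * n) → 0 < ∏ t, sin (k * (m t * π / n)) → ∀ l t, 0 < sd n w e τ W eW l t →
      0 < (∑ s, sd n w e τ W eW l s * sin (k * (m s * π / n))) * sin (k * (m t * π / n)) := by
      intro k hk h l t ht
      have hkodd : Odd k := (Nat.Coprime.coprime_dvd_right (Dvd.intro _ rfl) hk).symm.odd_of_left
      obtain ⟨τ', hτ⟩ := exists_tau c.npos.ne' k hk
      obtain ⟨i1, i2⟩ := c.ips hk h τ' hτ
      obtain ⟨ε, hε, hs, -⟩ := rho_trig k τ' hτ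
      have hε2 : ε * ε = 1 := by rcases hε with h | h <;> simp [h]
      have h0 := (sgn_sum m c.npos hk c.mpos c.msum).1
      obtain ⟨i, j, ⟨ha, hb⟩, hc⟩ : ∃ i j, (e i j % n = eW l % n ∧ onl n (w i (j + 1)) (W (l + 1)) (eW l)) ∧ τ i j = t := by
        by_contra hc
        push Not at hc
        unfold sd at ht
        rw [Finset.sum_eq_zero] at ht
        · omega
        · intro i _
          apply Finset.sum_eq_zero
          intro j _
          rw [if_neg]
          rintro ⟨h1, h2⟩
          exact hc i j h1 h2
      obtain ⟨s, hs1, hz, hp⟩ := side_pos (Psi τ') (rho τ') (Psi_apply c.npos τ' hτ) c.npos hkodd i1 i2 (fun i j => h0 _) c.bal l i j ha hb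
      have hs' : s = 1 := by
        rw [c.on_eq ha hb] at hz
        have : zeta n ^ eW l ≠ 0 := pow_ne_zero _ (by unfold zeta; exact Complex.exp_ne_zero _)
        have h2 : (s : ℂ) = 1 := by
          apply mul_right_cancel₀ this; rw [← hz, one_mul]
        exact_mod_cast h2
      rw [hs', hc, hs, ← c.h1 l] at hp
      have : rho τ' (∑ t, sd n w e τ W eW l t * sin (m t * π / n)) = ε * ∑ s, sd n w e τ W eW l s * sin (k * (m s * π / n)) := by
        simp only [Fin.sum_univ_three, rho_add, rho_natmul, hs]; ring
      rw [this] at hp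
      linear_combination hp + ((∑ s, sd n w e τ W eW l s * sin (k * (m s * π / n))) * sin (k * (m t * π / n))) * (hε2)
    intro k hk l t ht
    rcases lt_or_gt_of_ne (sgn_sum m c.npos hk c.mpos c.msum).2.2 with h | h
    · have hfl : ∀ x : ℕ, sin ((k * (2 * n - 1) : ℕ) * (x * π / n)) = - sin (k * (x * π / n)) := by
        intro x
        have hn' : (n:ℝ) ≠ 0 := by exact_mod_cast c.npos.ne'
        have hn1 : 1 ≤ 2 * n := by have := c.npos; omega
        rw [Nat.cast_mul, Nat.cast_sub hn1, show (k * (((2 * n : ℕ) : ℝ) - (1:ℕ))) * (x * π / n) = (k * x : ℕ) * (2 * π) - k * (x * π / n) by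
          push_cast; field_simp]
        rw [sin_nat_mul_two_pi_sub]
      have h1 : (k * (2 * n - 1)).Coprime (2 * n) := by
        apply Nat.Coprime.mul_left hk
        rw [Nat.coprime_self_sub_left (by have := c.npos; omega)]; simp
      have := key _ h1 (by simp only [hfl, Fin.prod_univ_three] at h ⊢; linarith) l t ht
      simp only [hfl, Fin.sum_univ_three] at this ⊢
      linarith
    · exact key k hk h l t ht

lemma good (c : Cfg n N m M w e τ W X eW) : Good N := c.toDat.main

end Cfg

def cr (a b : ℂ) : ℝ := a.re * b.im - a.im * b.re

def Ln (w : Fin 3 → ℂ) (j : Fin 3) (z : ℂ) : ℝ := cr (w (j + 2) - w (j + 1)) (z - w (j + 1))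

open Classical in
noncomputable def ind (w : Fin 3 → ℂ) (z : ℂ) : ℝ := if ∀ j, 0 < Ln w j z then 1 else 0

def lexp (a b d : ℝ) : Prop := 0 < a ∨ (a = 0 ∧ (0 < b ∨ (b = 0 ∧ 0 < d)))

open Filter Topology in
lemma ev1 (a b : ℝ) : ∀ᶠ ε in 𝓝[>] (0:ℝ), (0 < a + ε * b ↔ (0 < a ∨ (a = 0 ∧ 0 < b))) ∧ (a + ε * b = 0 ↔ a = 0 ∧ b = 0) := by
  have hlim : Tendsto (fun ε : ℝ => a + ε * b) (𝓝[>] 0) (𝓝 a) := by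
    have : Continuous (fun ε : ℝ => a + ε * b) := by fun_prop
    have h := this.tendsto 0
    simp at h
    exact h.mono_left nhdsWithin_le_nhds
  rcases lt_trichotomy a 0 with h | h | h
  · filter_upwards [hlim.eventually (gt_mem_nhds h)] with ε h1
    constructor
    · constructor
      · intro h2; linarith
      · rintro (h2 | h2) <;> linarith [h2]
    · constructor
      · intro h2; linarith
      · intro h2; linarith [h2.1]
  · subst h
    filter_upwards [self_mem_nhdsWithin] with ε h1
    have h1 : 0 < ε := h1
    simp [h1, h1.ne']
  · filter_upwards [hlim.eventually (lt_mem_nhds h)] with ε h1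
    simp [h1, h1.ne', h, h.ne']

open Filter Topology in
lemma ev2 (a b d : ℝ) (h : b ≠ 0 ∨ d ≠ 0) : ∀ᶠ ε in 𝓝[>] (0:ℝ), ∀ᶠ η in 𝓝[>] (0:ℝ),
    (0 < a + ε * b + η * d ↔ lexp a b d) ∧ a + ε * b + η * d ≠ 0 := by
  filter_upwards [ev1 a b] with ε h1
  filter_upwards [ev1 (a + ε * b) d] with η h2
  unfold lexp
  rw [h2.1, Ne, h2.2, h1.1, h1.2]
  tauto

noncomputable def zst (x u : ℂ) (s t ε η : ℝ) : ℂ := x + (s * ε : ℝ) * u + (t * η : ℝ) * (Complex.I * u)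

lemma Ln_zst (w : Fin 3 → ℂ) (j) (x u : ℂ) (s t ε η : ℝ) :
    Ln w j (zst x u s t ε η) = Ln w j x + ε * (s * cr (w (j + 2) - w (j + 1)) u) + η * (t * cr (w (j + 2) - w (j + 1)) (Complex.I * u)) := by
  simp [Ln, cr, zst]; ring

lemma cr_zero {E u : ℂ} (hE : E ≠ 0) (hu : u ≠ 0) (h : cr E u = 0) : ∃ κ : ℝ, κ ≠ 0 ∧ E = κ * u := by
  have hu' := Complex.normSq_pos.2 hu
  rw [Complex.normSq_apply] at hu'
  obtain ⟨κ, hκ⟩ : ∃ κ : ℝ, κ * (u.re * u.re + u.im * u.im) = E.re * u.re + E.im * u.im := ⟨_, div_mul_cancel₀ _ hu'.ne'⟩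
  have e : E = κ * u := by
    unfold cr at h
    apply Complex.ext <;> simp <;> apply mul_right_cancel₀ hu'.ne'
    · linear_combination u.im * h - u.re * hκ
    · linear_combination -u.re * h - u.im * hκ
  refine ⟨_, ?_, e⟩
  intro h0
  rw [h0] at e; simp at e; exact hE e

def Pos (w : Fin 3 → ℂ) : Prop := 0 < cr (w 1 - w 0) (w 2 - w 0)

lemma pos_rot (w : Fin 3 → ℂ) (j : Fin 3) : cr (w (j + 2) - w (j + 1)) (w j - w (j + 1)) = cr (w 1 - w 0) (w 2 - w 0) := by
  fin_cases j <;> simp [cr] <;> ring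

lemma Pos.ne {w : Fin 3 → ℂ} (h : Pos w) (j : Fin 3) : w (j + 2) - w (j + 1) ≠ 0 := by
  intro h0
  unfold Pos at h
  rw [← pos_rot w j, h0] at h
  simp [cr] at h

lemma cr_I {E u : ℂ} (hE : E ≠ 0) (hu : u ≠ 0) (h : cr E u = 0) : cr E (Complex.I * u) ≠ 0 := by
  obtain ⟨κ, hκ, rfl⟩ := cr_zero hE hu h
  have hu' := Complex.normSq_pos.2 hu
  rw [Complex.normSq_apply] at hu'
  have : cr (κ * u) (Complex.I * u) = κ * (u.re * u.re + u.im * u.im) := by simp [cr]; ring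
  rw [this]
  exact mul_ne_zero hκ hu'.ne'

def Bc (w : Fin 3 → ℂ) (u : ℂ) (j : Fin 3) : ℝ := cr (w (j + 2) - w (j + 1)) u

open Classical in
noncomputable def hh (w : Fin 3 → ℂ) (x u : ℂ) (s t : ℝ) : ℝ :=
  if ∀ j, lexp (Ln w j x) (s * Bc w u j) (t * Bc w (Complex.I * u) j) then 1 else 0

open Classical in
noncomputable def FF (w : Fin 3 → ℂ) (x u : ℂ) : ℝ :=
  ∑ j, if Bc w u j = 0 then ((if w (j + 1) = x then 1 else 0) - (if w (j + 2) = x then 1 else 0) : ℝ) else 0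

lemma all3 {P : Fin 3 → Prop} (j : Fin 3) : (∀ i, P i) ↔ P j ∧ P (j + 1) ∧ P (j + 2) := by
  constructor
  · intro h; exact ⟨h _, h _, h _⟩
  · rintro ⟨h1, h2, h3⟩ i
    have : i = j ∨ i = j + 1 ∨ i = j + 2 := by clear * -; revert i j; decide
    rcases this with rfl | rfl | rfl <;> assumption

lemma sum3 (f : Fin 3 → ℝ) (j : Fin 3) : ∑ i, f i = f j + f (j + 1) + f (j + 2) := by
  rw [Fin.sum_univ_three]; fin_cases j <;> simp <;> ring

open Classical in
lemma hh_sum {w : Fin 3 → ℂ} (hw : Pos w) (x u : ℂ) (hu : u ≠ 0) :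
    hh w x u 1 1 - hh w x u 1 (-1) - hh w x u (-1) 1 + hh w x u (-1) (-1) = FF w x u := by
  by_cases hA : ∃ j, Ln w j x = 0 ∧ Bc w u j = 0
  · obtain ⟨j, ha, hb⟩ := hA
    have hΔ := hw
    unfold Pos at hΔ
    rw [← pos_rot w j] at hΔ
    have hE := hw.ne j
    have hIu := cr_I hE hu hb
    obtain ⟨κ, hκ, e1⟩ := cr_zero hE hu hb
    obtain ⟨σ, e2⟩ : ∃ σ : ℝ, x - w (j + 1) = σ * (w (j + 2) - w (j + 1)) := by
      by_cases h0 : x - w (j + 1) = 0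
      · exact ⟨0, by rw [h0]; simp⟩
      · obtain ⟨σ, -, h⟩ := cr_zero h0 hE (by have := ha; unfold Ln cr at this; unfold cr; linarith)
        exact ⟨σ, h⟩
    set Δ := cr (w (j + 2) - w (j + 1)) (w j - w (j + 1)) with hΔd
    have b1 : Bc w u (j + 1) * κ = -Δ := by
      unfold Bc
      rw [f12, f11, hΔd, show w j - w (j + 1) = (w j - w (j + 2)) + κ * u by rw [← e1]; ring, e1]
      simp [cr]; ring
    have b2 : Bc w u (j + 2) * κ = Δ := by
      unfold Bc
      rw [f22, f21, hΔd, e1]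
      simp [cr]; ring
    have hx : x = w (j + 1) + σ * (κ * u) := by rw [← e1, ← e2]; ring
    have hw2 : w (j + 2) = w (j + 1) + κ * u := by rw [← e1]; ring
    have a1 : Ln w (j + 1) x = (1 - σ) * Δ := by
      unfold Ln
      rw [f12, f11, hΔd, hx, hw2]
      simp [cr]; ring
    have a2 : Ln w (j + 2) x = σ * Δ := by
      unfold Ln
      rw [f22, f21, hΔd, hx, hw2]
      simp [cr]; ring
    have d0 : Bc w (Complex.I * u) j = κ * Complex.normSq u := by
      unfold Bc; rw [e1, Complex.normSq_apply]; simp [cr]; ring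
    have hu' := Complex.normSq_pos.2 hu
    have hκu : (κ : ℂ) * u ≠ 0 := mul_ne_zero (by exact_mod_cast hκ) hu
    have v1 : w (j + 1) = x ↔ σ = 0 := by
      rw [hx]; simp [hκ, hu]
    have v2 : w (j + 2) = x ↔ σ = 1 := by
      rw [hx, hw2, add_right_inj]
      constructor
      · intro h
        have : (1 : ℂ) * (κ * u) = σ * (κ * u) := by rw [one_mul]; exact h
        have := mul_right_cancel₀ hκu this
        exact_mod_cast this.symm
      · rintro rfl; simp
    have n1 : Bc w u (j + 1) ≠ 0 := by rintro h; rw [h] at b1; linarith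
    have n2 : Bc w u (j + 2) ≠ 0 := by rintro h; rw [h] at b2; linarith
    have c1 : Bc w u (j + 1) = -Δ / κ := by field_simp; linarith
    have c2 : Bc w u (j + 2) = Δ / κ := by field_simp; linarith
    unfold FF
    rw [sum3 _ j, if_pos hb, if_neg n1, if_neg n2]
    simp only [v1, v2]
    unfold hh
    simp only [all3 j, ha, hb, a1, a2, d0]
    unfold lexp
    have n1' : ∀ s : ℝ, s = 1 ∨ s = -1 → s * Bc w u (j + 1) ≠ 0 := by
      rintro s (rfl | rfl) <;> simpa using n1
    have n2' : ∀ s : ℝ, s = 1 ∨ s = -1 → s * Bc w u (j + 2) ≠ 0 := by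
      rintro s (rfl | rfl) <;> simpa using n2
    have q1 := n1' 1 (Or.inl rfl)
    have q2 := n1' (-1) (Or.inr rfl)
    have q3 := n2' 1 (Or.inl rfl)
    have q4 := n2' (-1) (Or.inr rfl)
    simp only [q1, q2, q3, q4, false_and, or_false, mul_zero, lt_irrefl, true_and, false_or]
    have p1 : 0 < σ * Δ ↔ 0 < σ := mul_pos_iff_of_pos_right hΔ
    have p2 : 0 < (1 - σ) * Δ ↔ σ < 1 := by rw [mul_pos_iff_of_pos_right hΔ, sub_pos]
    have p3 : σ * Δ = 0 ↔ σ = 0 := by simp [hΔ.ne']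
    have p4 : (1 - σ) * Δ = 0 ↔ σ = 1 := by
      rw [mul_eq_zero, sub_eq_zero]; simp [hΔ.ne']; exact eq_comm
    simp only [p1, p2, p3, p4, c1, c2, one_mul]
    rcases lt_or_gt_of_ne hκ with k0 | k0
    · have g1 : ¬ (0 < κ * Complex.normSq u) := by nlinarith
      have g2 : 0 < -1 * (κ * Complex.normSq u) := by nlinarith
      have g3 : Δ / κ < 0 := div_neg_of_pos_of_neg hΔ k0
      have g4 : 0 < -Δ / κ := by rw [neg_div]; linarith
      have g5 : ¬ (0 < -1 * (-Δ / κ)) := by linarith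
      have g6 : 0 < -1 * (Δ / κ) := by linarith
      have g7 : ¬ (0 < Δ / κ) := by linarith
      simp only [g1, g2, g4, g5, g6, g7]
      rcases lt_trichotomy σ 0 with h | h | h
      · simp [h.ne, h.not_gt, (by linarith : σ ≠ 1)]
      · simp [h]
      · rcases lt_trichotomy σ 1 with h' | h' | h'
        · simp [h, h.ne', h', h'.ne]
        · simp [h']
        · simp [h.ne', h'.ne', h'.not_gt]
    · have g1 : (0 < κ * Complex.normSq u) := by nlinarith
      have g2 : ¬ (0 < -1 * (κ * Complex.normSq u)) := by nlinarith
      have g3 : 0 < Δ / κ := div_pos hΔ k0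
      have g4 : ¬ (0 < -Δ / κ) := by rw [neg_div]; linarith
      have g5 : (0 < -1 * (-Δ / κ)) := by rw [neg_div]; linarith
      have g6 : ¬ 0 < -1 * (Δ / κ) := by linarith
      simp only [g1, g2, g4, g5, g6, g3]
      rcases lt_trichotomy σ 0 with h | h | h
      · simp [h.ne, h.not_gt, (by linarith : σ ≠ 1)]
      · simp [h]
      · rcases lt_trichotomy σ 1 with h' | h' | h'
        · simp [h, h.ne', h', h'.ne]
        · simp [h']
        · simp [h.ne', h'.ne', h'.not_gt]
  · push Not at hA
    have h1 : FF w x u = 0 := by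
      unfold FF
      apply Finset.sum_eq_zero
      intro j _
      split_ifs with h1 h2 h3 h3
      · simp
      · exfalso; apply hA j _ h1; rw [← h2]; simp [Ln, cr]
      · exfalso; apply hA j _ h1; rw [← h3]; simp [Ln, cr]; ring
      · simp
      · rfl
    have h2 : ∀ s, s = 1 ∨ s = -1 → hh w x u s 1 = hh w x u s (-1) := by
      intro s hs
      unfold hh
      have : ∀ j, (lexp (Ln w j x) (s * Bc w u j) (1 * Bc w (Complex.I * u) j) ↔ lexp (Ln w j x) (s * Bc w u j) (-1 * Bc w (Complex.I * u) j)) := by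
        intro j
        unfold lexp
        by_cases h : Ln w j x = 0
        · have := hA j h
          have : s * Bc w u j ≠ 0 := by rcases hs with rfl | rfl <;> simpa using this
          simp [this]
        · simp [h]
      simp only [this]
    rw [h1, h2 1 (Or.inl rfl), h2 (-1) (Or.inr rfl)]; ring

open Filter Topology in
lemma ind_ev {w : Fin 3 → ℂ} (hw : Pos w) (x u : ℂ) (hu : u ≠ 0) (s t : ℝ) (hs : s = 1 ∨ s = -1) (ht : t = 1 ∨ t = -1) :
    ∀ᶠ ε in 𝓝[>] (0:ℝ), ∀ᶠ η in 𝓝[>] (0:ℝ), ind w (zst x u s t ε η) = hh w x u s t ∧ ∀ j, Ln w j (zst x u s t ε η) ≠ 0 := by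
  have key : ∀ j, ∀ᶠ ε in 𝓝[>] (0:ℝ), ∀ᶠ η in 𝓝[>] (0:ℝ),
      (0 < Ln w j (zst x u s t ε η) ↔ lexp (Ln w j x) (s * Bc w u j) (t * Bc w (Complex.I * u) j)) ∧ Ln w j (zst x u s t ε η) ≠ 0 := by
    intro j
    simp only [Ln_zst]
    apply ev2
    by_cases h : Bc w u j = 0
    · right
      have := cr_I (hw.ne j) hu h
      rcases ht with rfl | rfl <;> simpa using this
    · left
      rcases hs with rfl | rfl <;> simpa [Bc] using h
  have k2 := eventually_all.2 key
  filter_upwards [k2] with ε h1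
  filter_upwards [eventually_all.2 h1] with η h2
  refine ⟨?_, fun j => (h2 j).2⟩
  unfold ind hh
  have hp := forall_congr' fun j => (h2 j).1
  split_ifs with a b b
  · rfl
  · exact absurd (hp.1 a) b
  · exact absurd (hp.2 b) a
  · rfl

def Cov {N : ℕ} (w : Fin N → Fin 3 → ℂ) (W : Fin 3 → ℂ) : Prop :=
  ∀ z, (∀ i j, Ln (w i) j z ≠ 0) → (∀ j, Ln W j z ≠ 0) → ∑ i, ind (w i) z = ind W z

open Filter Topology in
lemma star {N : ℕ} {w : Fin N → Fin 3 → ℂ} {W : Fin 3 → ℂ} (hw : ∀ i, Pos (w i)) (hW : Pos W) (hc : Cov w W) (x u : ℂ) (hu : u ≠ 0) :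
    ∑ i, FF (w i) x u = FF W x u := by
  have key : ∀ s t : ℝ, (s = 1 ∨ s = -1) → (t = 1 ∨ t = -1) → ∑ i, hh (w i) x u s t = hh W x u s t := by
    intro s t hs ht
    have e1 := ind_ev hW x u hu s t hs ht
    have e2 := eventually_all.2 (fun i => ind_ev (hw i) x u hu s t hs ht)
    obtain ⟨ε, h1, h2⟩ := (e1.and e2).exists
    obtain ⟨η, h3, h4⟩ := (h1.and (eventually_all.2 h2)).exists
    have := hc _ (fun i j => (h4 i).2 j) h3.2
    rw [h3.1] at this
    rw [← this]
    exact Finset.sum_congr rfl fun i _ => (h4 i).1.symm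
  rw [← hh_sum hW x u hu, ← key 1 1 (by simp) (by simp), ← key 1 (-1) (by simp) (by simp), ← key (-1) 1 (by simp) (by simp), ← key (-1) (-1) (by simp) (by simp)]
  rw [← Finset.sum_sub_distrib, ← Finset.sum_sub_distrib, ← Finset.sum_add_distrib]
  exact Finset.sum_congr rfl fun i _ => (hh_sum (hw i) x u hu).symm

noncomputable def cls (z : ℂ) : ℂ := z / (starRingEnd ℂ) z

lemma cls_eq {a b : ℂ} (ha : a ≠ 0) (hb : b ≠ 0) : cls a = cls b ↔ cr a b = 0 := by
  have ha' : (starRingEnd ℂ) a ≠ 0 := by simpa using ha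
  have hb' : (starRingEnd ℂ) b ≠ 0 := by simpa using hb
  unfold cls
  rw [div_eq_div_iff ha' hb', Complex.ext_iff]
  simp [cr]
  constructor
  · rintro ⟨-, h⟩; linarith
  · intro h; constructor <;> linarith

lemma bal_cls {N : ℕ} {w : Fin N → Fin 3 → ℂ} {W : Fin 3 → ℂ} (hw : ∀ i, Pos (w i)) (hW : Pos W) (hc : Cov w W) (G : ℂ → ℂ → ℝ) :
    ∑ i, ∑ j, (G (w i (j + 2)) (cls (w i (j + 2) - w i (j + 1))) - G (w i (j + 1)) (cls (w i (j + 2) - w i (j + 1)))) =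
    ∑ j, (G (W (j + 2)) (cls (W (j + 2) - W (j + 1))) - G (W (j + 1)) (cls (W (j + 2) - W (j + 1)))) := by
  classical
  let φ : (Fin 3 → ℂ) → (ℂ × ℂ →₀ ℝ) := fun w => ∑ j, (Finsupp.single (w (j + 2), cls (w (j + 2) - w (j + 1))) 1 - Finsupp.single (w (j + 1), cls (w (j + 2) - w (j + 1))) 1)
  have h1 : ∀ w, Finsupp.linearCombination ℝ (fun p : ℂ × ℂ => G p.1 p.2) (φ w) = ∑ j, (G (w (j + 2)) (cls (w (j + 2) - w (j + 1))) - G (w (j + 1)) (cls (w (j + 2) - w (j + 1)))) := by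
    intro w
    simp [φ, map_sum, map_sub, Finsupp.linearCombination_single]
  simp only [← h1]
  rw [← map_sum]
  congr 1
  have h2 : ∀ w, Pos w → ∀ x u, u ≠ 0 → φ w (x, cls u) = - FF w x u := by
    intro w hw x u hu
    simp only [φ, Finsupp.coe_finsetSum, Finset.sum_apply, Finsupp.coe_sub, Pi.sub_apply, Finsupp.single_apply, FF]
    rw [← Finset.sum_neg_distrib]
    apply Finset.sum_congr rfl
    intro j _
    simp only [Prod.mk.injEq, cls_eq (hw.ne j) hu]
    by_cases h : cr (w (j + 2) - w (j + 1)) u = 0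
    · simp [h, Bc]
    · simp [h, Bc]
  have h3 : ∀ w, Pos w → ∀ x c, (∀ u, u ≠ 0 → cls u ≠ c) → φ w (x, c) = 0 := by
    intro w hw x c hc
    simp only [φ, Finsupp.coe_finsetSum, Finset.sum_apply, Finsupp.coe_sub, Pi.sub_apply, Finsupp.single_apply]
    apply Finset.sum_eq_zero
    intro j _
    simp [hc _ (hw.ne j)]
  ext ⟨x, c⟩
  rw [Finsupp.coe_finsetSum, Finset.sum_apply]
  by_cases hcc : ∃ u, u ≠ 0 ∧ cls u = c
  · obtain ⟨u, hu, rfl⟩ := hcc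
    rw [h2 W hW x u hu, ← star hw hW hc x u hu, ← Finset.sum_neg_distrib]
    exact Finset.sum_congr rfl fun i _ => h2 _ (hw i) x u hu
  · push Not at hcc
    rw [h3 W hW x c hcc]
    exact Finset.sum_eq_zero fun i _ => h3 _ (hw i) x c hcc

lemma sin_law {A B C : ℝ} (h : A + B + C = π) : sin C ^ 2 = sin A ^ 2 + sin B ^ 2 - 2 * sin A * sin B * cos C := by
  have : C = π - (A + B) := by linarith
  rw [this, sin_pi_sub, cos_pi_sub, sin_add, cos_add]
  have h1 := sin_sq_add_cos_sq A
  have h2 := sin_sq_add_cos_sq B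
  linear_combination (sin B ^ 2) * h1 + (sin A ^ 2) * h2

lemma edge_sum (w : Fin 3 → ℂ) (j : Fin 3) : w (j + 1) - w j = -((w (j + 2) - w (j + 1)) + (w j - w (j + 2))) := by ring

/-- consecutive edges of a tile -/
lemma tile_turn {n : ℕ} (hn : 0 < n) {w : Fin 3 → ℂ} (hw : Pos w) {μ : Fin 3 → ℕ} (hμ : ∀ t, 0 < μ t) (hs : ∑ t, μ t = n)
    {D : ℝ} (hD : 0 < D) (hl : ∀ j, ‖w (j + 2) - w (j + 1)‖ = D * sin (μ j * π / n)) (j : Fin 3) :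
    (w j - w (j + 2)) * zeta n ^ (μ (j + 2)) = - ((sin (μ (j + 1) * π / n) / sin (μ j * π / n) : ℝ) : ℂ) * (w (j + 2) - w (j + 1)) := by
  have hn' : (0:ℝ) < n := by exact_mod_cast hn
  have hlt : ∀ t, μ t < n := by
    intro t
    have h1 : μ t + μ (t + 1) + μ (t + 2) = n := by
      rw [← hs, Fin.sum_univ_three]; fin_cases t <;> simp <;> ring
    have := hμ (t + 1); omega
  have hsum : (μ j : ℝ) + μ (j + 1) + μ (j + 2) = n := by
    have h1 : μ j + μ (j + 1) + μ (j + 2) = n := by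
      rw [← hs, Fin.sum_univ_three]; fin_cases j <;> simp <;> ring
    exact_mod_cast h1
  have hang : μ j * π / n + μ (j + 1) * π / n + μ (j + 2) * π / n = π := by
    rw [← add_div, ← add_div, ← add_mul, ← add_mul, hsum]; field_simp
  have law := sin_law hang
  have s0 := sin_pos_nat (hμ j) (hlt j)
  have s1 := sin_pos_nat (hμ (j + 1)) (hlt (j + 1))
  have s2 := sin_pos_nat (hμ (j + 2)) (hlt (j + 2))
  have l0 := hl j
  have l1 := hl (j + 1)
  have l2 := hl (j + 2)
  rw [f12, f11] at l1
  rw [f22, f21] at l2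
  have pos := hw
  unfold Pos at pos
  rw [← pos_rot w j] at pos
  set A := sin (μ j * π / n)
  set B := sin (μ (j + 1) * π / n)
  set C := sin (μ (j + 2) * π / n) with hC
  set c := cos (μ (j + 2) * π / n) with hc
  have hCc : C ^ 2 + c ^ 2 = 1 := sin_sq_add_cos_sq _
  have key : zeta n ^ (μ (j + 2)) = (c : ℂ) + C * Complex.I := by
    apply Complex.ext
    · rw [zeta_re, ← hc]; simp
    · rw [zeta_im, ← hC]; simp
  rw [edge_sum] at l2
  have pos' : 0 < cr (w (j + 2) - w (j + 1)) (w j - w (j + 2)) := by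
    have : cr (w (j + 2) - w (j + 1)) (w j - w (j + 2)) = cr (w (j + 2) - w (j + 1)) (w j - w (j + 1)) := by simp [cr]; ring
    rw [this]; exact pos
  rw [key]
  generalize w (j + 2) - w (j + 1) = E at *
  generalize w j - w (j + 2) = F at *
  have n0 : E.re ^ 2 + E.im ^ 2 = D ^ 2 * A ^ 2 := by
    have := Complex.sq_norm E; rw [l0, Complex.normSq_apply] at this; linarith
  have n1 : F.re ^ 2 + F.im ^ 2 = D ^ 2 * B ^ 2 := by
    have := Complex.sq_norm F; rw [l1, Complex.normSq_apply] at this; linarith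
  have n2 : (E.re + F.re) ^ 2 + (E.im + F.im) ^ 2 = D ^ 2 * C ^ 2 := by
    have := Complex.sq_norm (-(E + F)); rw [l2, Complex.normSq_apply] at this; simp at this; linarith
  have d1 : E.re * F.re + E.im * F.im = - D ^ 2 * (A * B * c) := by
    linear_combination (n2 - n0 - n1) / 2 + D ^ 2 / 2 * law
  have d2 : E.re * F.im - E.im * F.re = D ^ 2 * (A * B * C) := by
    unfold cr at pos'
    have h1 : (E.re * F.im - E.im * F.re) ^ 2 = (D ^ 2 * (A * B * C)) ^ 2 := by
      have : (E.re * F.im - E.im * F.re) ^ 2 = (E.re ^ 2 + E.im ^ 2) * (F.re ^ 2 + F.im ^ 2) - (E.re * F.re + E.im * F.im) ^ 2 := by ring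
      rw [this, n0, n1, d1]
      linear_combination -(D ^ 4 * A ^ 2 * B ^ 2) * hCc
    exact (sq_eq_sq₀ pos'.le (by positivity)).1 h1
  have hDA : D ^ 2 * A ^ 2 ≠ 0 := by positivity
  have r1 : F.re * (D ^ 2 * A ^ 2) = D ^ 2 * A * B * (-E.re * c - E.im * C) := by
    rw [← n0]; linear_combination E.re * d1 - E.im * d2
  have r2 : F.im * (D ^ 2 * A ^ 2) = D ^ 2 * A * B * (E.re * C - E.im * c) := by
    rw [← n0]; linear_combination E.im * d1 + E.re * d2
  have q1 : F.re = B / A * (-E.re * c - E.im * C) := by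
    field_simp; apply mul_left_cancel₀ (by positivity : D ^ 2 * A ≠ 0); linear_combination r1
  have q2 : F.im = B / A * (E.re * C - E.im * c) := by
    field_simp; apply mul_left_cancel₀ (by positivity : D ^ 2 * A ≠ 0); linear_combination r2
  apply Complex.ext
  · simp only [Complex.mul_re, Complex.mul_im, Complex.add_re, Complex.add_im, Complex.ofReal_re, Complex.ofReal_im, Complex.I_re, Complex.I_im, Complex.neg_re, Complex.neg_im]
    rw [q1, q2]; linear_combination (-(B / A) * E.re) * hCc
  · simp only [Complex.mul_re, Complex.mul_im, Complex.add_re, Complex.add_im, Complex.ofReal_re, Complex.ofReal_im, Complex.I_re, Complex.I_im, Complex.neg_re, Complex.neg_im]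
    rw [q1, q2]; linear_combination (-(B / A) * E.im) * hCc

lemma cls_mul (a b : ℂ) : cls (a * b) = cls a * cls b := by
  unfold cls; rw [map_mul, mul_div_mul_comm]

lemma cls_real {x : ℝ} (hx : x ≠ 0) : cls (x : ℂ) = 1 := by
  unfold cls; rw [Complex.conj_ofReal, div_self (by exact_mod_cast hx)]

lemma cls_zeta {n : ℕ} (e : ℕ) : cls (zeta n ^ e) = zeta n ^ (2 * e) := by
  unfold cls
  have h := zeta_mul_conj (n := n) e
  rw [div_eq_iff (right_ne_zero_of_mul_eq_one h), pow_mul', sq]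
  linear_combination (- zeta n ^ e) * h

lemma tile_cls {n : ℕ} (hn : 0 < n) {w : Fin 3 → ℂ} (hw : Pos w) {μ : Fin 3 → ℕ} (hμ : ∀ t, 0 < μ t) (hs : ∑ t, μ t = n)
    {D : ℝ} (hD : 0 < D) (hl : ∀ j, ‖w (j + 2) - w (j + 1)‖ = D * sin (μ j * π / n)) (j : Fin 3) :
    cls (w (j + 2) - w (j + 1)) ^ n = cls (w 2 - w 1) ^ n := by
  have step : ∀ j, cls (w j - w (j + 2)) ^ n = cls (w (j + 2) - w (j + 1)) ^ n := by
    intro j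
    have hlt : ∀ t, μ t < n := by
      intro t
      have h1 : μ t + μ (t + 1) + μ (t + 2) = n := by
        rw [← hs, Fin.sum_univ_three]; fin_cases t <;> simp <;> ring
      have := hμ (t + 1); omega
    have h := congrArg (fun z => cls z ^ n) (tile_turn hn hw hμ hs hD hl j)
    have s0 := sin_pos_nat (hμ j) (hlt j)
    have s1 := sin_pos_nat (hμ (j + 1)) (hlt (j + 1))
    rw [cls_mul, cls_mul, cls_zeta, ← Complex.ofReal_neg, cls_real (neg_ne_zero.2 (div_pos s1 s0).ne'), one_mul, mul_pow, ← pow_mul,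
      mul_right_comm, pow_mul, zeta_2n hn, one_pow, mul_one] at h
    exact h
  have a0 := step 0
  have a1 := step 1
  simp at a0
  rw [z12, z11] at a1
  fin_cases j
  · rfl
  · simp [z12, z11]; exact a0
  · simp [z22, z21]; rw [a1, a0]

lemma area_cls {w : Fin 3 → ℂ} (hw : Pos w) :
    ∑ j, (((w (j + 2)) ^ 2 * (starRingEnd ℂ) (cls (w (j + 2) - w (j + 1)))).im - ((w (j + 1)) ^ 2 * (starRingEnd ℂ) (cls (w (j + 2) - w (j + 1)))).im)
     = -2 * cr (w 1 - w 0) (w 2 - w 0) := by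
  have key : ∀ j, (((w (j + 2)) ^ 2 * (starRingEnd ℂ) (cls (w (j + 2) - w (j + 1)))).im - ((w (j + 1)) ^ 2 * (starRingEnd ℂ) (cls (w (j + 2) - w (j + 1)))).im) = ((w (j + 2) + w (j + 1)) * (starRingEnd ℂ) (w (j + 2) - w (j + 1))).im := by
    intro j
    have h0 := hw.ne j
    rw [← Complex.sub_im, ← sub_mul]
    congr 1
    unfold cls
    rw [map_div₀, Complex.conj_conj]
    rw [show w (j + 2) ^ 2 - w (j + 1) ^ 2 = (w (j + 2) + w (j + 1)) * (w (j + 2) - w (j + 1)) by ring]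
    generalize (starRingEnd ℂ) (w (j + 2) - w (j + 1)) = z
    field_simp
  rw [Finset.sum_congr rfl (fun j _ => key j), Fin.sum_univ_three]
  simp [z12, z22, z21, z11, cr]
  ring

lemma abc_cls {n N : ℕ} {w : Fin N → Fin 3 → ℂ} {W : Fin 3 → ℂ} (hw : ∀ i, Pos (w i)) (hW : Pos W) (hc : Cov w W)
    (ht : ∀ i j, cls (w i (j + 2) - w i (j + 1)) ^ n = cls (w i 2 - w i 1) ^ n) :
    (∀ j, cls (W (j + 2) - W (j + 1)) ^ n = cls (W 2 - W 1) ^ n) ∧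
    (∀ i j, cls (w i (j + 2) - w i (j + 1)) ^ n = cls (W 2 - W 1) ^ n) := by
  classical
  have tz : ∀ (f : ℂ → ℝ) (x : Fin 3 → ℂ), ∑ j, (f (x (j + 2)) - f (x (j + 1))) = 0 := by
    intro f x
    rw [Fin.sum_univ_three]
    simp [z12, z22, z21, z11]
  have b : ∀ f : ℂ → ℝ, ∑ j, (if cls (W (j + 2) - W (j + 1)) ^ n = cls (W 2 - W 1) ^ n then f (W (j + 2)) - f (W (j + 1)) else 0) = 0 := by
    intro f
    have b := bal_cls hw hW hc (fun y c => if c ^ n = cls (W 2 - W 1) ^ n then f y else 0)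
    have h1 : ∀ j, (if cls (W (j + 2) - W (j + 1)) ^ n = cls (W 2 - W 1) ^ n then f (W (j + 2)) - f (W (j + 1)) else 0) =
       ((if cls (W (j + 2) - W (j + 1)) ^ n = cls (W 2 - W 1) ^ n then f (W (j + 2)) else 0) - (if cls (W (j + 2) - W (j + 1)) ^ n = cls (W 2 - W 1) ^ n then f (W (j + 1)) else 0)) := by
      intro j; split_ifs <;> simp
    rw [Finset.sum_congr rfl (fun j _ => h1 j), ← b]
    apply Finset.sum_eq_zero
    intro i _
    simp only [ht i]
    by_cases h : cls (w i 2 - w i 1) ^ n = cls (W 2 - W 1) ^ n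
    · simp only [h, if_true]; exact tz f (w i)
    · simp [h]
  have all : ∀ j, cls (W (j + 2) - W (j + 1)) ^ n = cls (W 2 - W 1) ^ n := by
    have b1 := b Complex.re
    have b2 := b Complex.im
    have n0 := hW.ne 0
    have n1 := hW.ne 1
    have n2 := hW.ne 2
    rw [Fin.sum_univ_three] at b1 b2
    simp [z12, z22, z21, z11] at b1 b2 n0 n1 n2
    by_cases p1 : cls (W 0 - W 2) ^ n = cls (W 2 - W 1) ^ n <;> by_cases p2 : cls (W 1 - W 0) ^ n = cls (W 2 - W 1) ^ n
    · intro j; fin_cases j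
      · rfl
      · exact p1
      · exact p2
    · exfalso; simp [p1, p2] at b1 b2
      apply n2; apply Complex.ext <;> simp <;> linarith
    · exfalso; simp [p1, p2] at b1 b2
      apply n1; apply Complex.ext <;> simp <;> linarith
    · exfalso; simp [p1, p2] at b1 b2
      apply n0; apply Complex.ext <;> simp <;> linarith
  refine ⟨all, ?_⟩
  intro i0 j0
  rw [ht i0 j0]
  by_contra hne
  have b := bal_cls hw hW hc (fun y c => if c ^ n = cls (w i0 2 - w i0 1) ^ n then (y ^ 2 * (starRingEnd ℂ) c).im else 0)
  simp only [all, ht] at b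
  simp only [Ne.symm hne, if_false, sub_self, Finset.sum_const_zero] at b
  have h1 : ∀ i, ∑ j, ((if cls (w i 2 - w i 1) ^ n = cls (w i0 2 - w i0 1) ^ n then ((w i (j + 2)) ^ 2 * (starRingEnd ℂ) (cls (w i (j + 2) - w i (j + 1)))).im else 0) -
     (if cls (w i 2 - w i 1) ^ n = cls (w i0 2 - w i0 1) ^ n then ((w i (j + 1)) ^ 2 * (starRingEnd ℂ) (cls (w i (j + 2) - w i (j + 1)))).im else 0)) =
     if cls (w i 2 - w i 1) ^ n = cls (w i0 2 - w i0 1) ^ n then -2 * cr (w i 1 - w i 0) (w i 2 - w i 0) else 0 := by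
    intro i
    split_ifs with h
    · exact area_cls (hw i)
    · simp
  rw [Finset.sum_congr rfl (fun i _ => h1 i)] at b
  have h2 : ∀ i ∈ Finset.univ, (if cls (w i 2 - w i 1) ^ n = cls (w i0 2 - w i0 1) ^ n then -2 * cr (w i 1 - w i 0) (w i 2 - w i 0) else 0) ≤ 0 := by
    intro i _
    have := hw i
    unfold Pos at this
    split_ifs <;> linarith
  rw [Finset.sum_eq_zero_iff_of_nonpos h2] at b
  have := b i0 (Finset.mem_univ _)
  have h3 := hw i0
  unfold Pos at h3
  simp at this
  linarith

lemma zeta_pow_inj {n a b : ℕ} (hn : 0 < n) (h : zeta n ^ a = zeta n ^ b) : a ≡ b [MOD 2 * n] := by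
  rw [pow_eq_pow_mod a (zeta_2n hn), pow_eq_pow_mod b (zeta_2n hn)] at h
  exact (zeta_prim hn.ne').pow_inj (Nat.mod_lt _ (by omega)) (Nat.mod_lt _ (by omega)) h

lemma exists_dir {n : ℕ} (hn : 0 < n) {F : ℂ} (hF : F ≠ 0) (h : cls F ^ n = 1) : ∃ e : ℕ, F = ‖F‖ * zeta n ^ e := by
  have hp : IsPrimitiveRoot (zeta n ^ 2) n := (zeta_prim hn.ne').pow (by omega) rfl
  have : NeZero n := ⟨hn.ne'⟩
  obtain ⟨a, -, ha⟩ := hp.eq_pow_of_pow_eq_one h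
  have hn0 : (‖F‖ : ℂ) ≠ 0 := by simpa using hF
  have hc : (starRingEnd ℂ) F ≠ 0 := by simpa using hF
  unfold cls at ha
  rw [eq_div_iff hc] at ha
  have h2 : F ^ 2 = (‖F‖ * zeta n ^ a) ^ 2 := by
    have h3 := Complex.mul_conj F
    rw [Complex.normSq_eq_norm_sq] at h3
    push_cast at h3
    rw [mul_pow, ← h3, ← pow_mul, mul_comm a 2, pow_mul]
    linear_combination (-F) * ha
  rcases sq_eq_sq_iff_eq_or_eq_neg.1 h2 with h | h
  · exact ⟨a, h⟩
  · exact ⟨a + n, by rw [pow_add, zeta_n hn]; linear_combination h⟩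

open Classical in
noncomputable def dec (n : ℕ) (c : ℂ) : ℕ := if h : ∃ a, a < n ∧ zeta n ^ (2 * a) = c then h.choose else 0

lemma dec_zeta {n : ℕ} (hn : 0 < n) (e : ℕ) : dec n (zeta n ^ (2 * e)) = e % n := by
  have hex : ∃ a, a < n ∧ zeta n ^ (2 * a) = zeta n ^ (2 * e) := by
    refine ⟨e % n, Nat.mod_lt _ hn, ?_⟩
    apply zeta_modEq hn
    exact (Nat.mod_modEq e n).mul_left' 2
  unfold dec
  rw [dif_pos hex]
  have h1 := hex.choose_spec.1
  have h2 := zeta_pow_inj hn hex.choose_spec.2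
  have h3 : hex.choose ≡ e [MOD n] := Nat.ModEq.mul_left_cancel' (by norm_num) h2
  have h4 : hex.choose % n = e % n := h3
  rwa [Nat.mod_eq_of_lt h1] at h4

lemma cls_dir {n : ℕ} {r : ℝ} (hr : 0 < r) (e : ℕ) : cls (r * zeta n ^ e) = zeta n ^ (2 * e) := by
  rw [cls_mul, cls_real hr.ne', one_mul, cls_zeta]

lemma abc_turn {n : ℕ} (hn : 0 < n) {W : Fin 3 → ℂ} (hW : Pos W) {X : Fin 3 → ℝ} {e : Fin 3 → ℕ} (hX : ∀ j, 0 < X j)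
    (hE : ∀ j, W (j + 2) - W (j + 1) = X j * zeta n ^ e j) :
    TPoly n W X e (fun t => (e (t + 1) + n + (2 * n - 1) * e (t + 2)) % (2 * n)) := by
  have t0 : ∀ t, e (t + 2) + (e (t + 1) + n + (2 * n - 1) * e (t + 2)) % (2 * n) ≡ e (t + 1) + n [MOD 2 * n] := by
    intro t
    have h1 : e (t + 2) + (e (t + 1) + n + (2 * n - 1) * e (t + 2)) % (2 * n) ≡ e (t + 2) + (e (t + 1) + n + (2 * n - 1) * e (t + 2)) [MOD 2 * n] :=
      (Nat.mod_modEq _ _).add_left _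
    refine h1.trans ?_
    have : e (t + 2) + (e (t + 1) + n + (2 * n - 1) * e (t + 2)) = e (t + 1) + n + 2 * n * e (t + 2) := by
      obtain ⟨q, hq⟩ : ∃ q, 2 * n = q + 1 := ⟨2 * n - 1, by omega⟩
      rw [hq]; simp; ring
    rw [this]
    exact (Nat.modEq_iff_dvd' (by omega)).2 ⟨e (t + 2), by omega⟩ |>.symm
  have key : ∀ t, 0 < (e (t + 1) + n + (2 * n - 1) * e (t + 2)) % (2 * n) ∧ (e (t + 1) + n + (2 * n - 1) * e (t + 2)) % (2 * n) < n := by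
    intro t
    have h1 := zeta_modEq hn (t0 t)
    have hlt : (e (t + 1) + n + (2 * n - 1) * e (t + 2)) % (2 * n) < 2 * n := Nat.mod_lt _ (by omega)
    generalize (e (t + 1) + n + (2 * n - 1) * e (t + 2)) % (2 * n) = M at *
    rw [pow_add, pow_add, zeta_n hn] at h1
    have c2 := zeta_mul_conj (n := n) (e (t + 2))
    have h2 : zeta n ^ M = - (zeta n ^ e (t + 1) * (starRingEnd ℂ) (zeta n ^ e (t + 2))) := by
      linear_combination (starRingEnd ℂ) (zeta n ^ e (t + 2)) * h1 - zeta n ^ M * c2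
    have e1 := hE (t + 1)
    have e2 := hE (t + 2)
    rw [f12, f11] at e1
    rw [f22, f21] at e2
    have p := hW
    unfold Pos at p
    rw [← pos_rot W (t + 1), f12, f11] at p
    have p2 : cr (W t - W (t + 2)) (W (t + 1) - W (t + 2)) = cr (W t - W (t + 2)) (W (t + 1) - W t) := by simp [cr]; ring
    rw [p2, e1, e2] at p
    have p3 : cr (X (t + 1) * zeta n ^ e (t + 1)) (X (t + 2) * zeta n ^ e (t + 2)) = X (t + 1) * X (t + 2) * (zeta n ^ M).im := by
      rw [h2]; simp [cr, -map_pow]; ring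
    rw [p3] at p
    have p4 := (mul_pos_iff_of_pos_left (mul_pos (hX _) (hX _))).1 p
    rw [zeta_im] at p4
    have hn' : (0:ℝ) < n := by exact_mod_cast hn
    constructor
    · rcases Nat.eq_zero_or_pos M with h | h
      · rw [h] at p4; simp at p4
      · exact h
    · by_contra hc
      push Not at hc
      have h3 : sin (M * π / n) = - sin (M * π / n - π) := by rw [sin_sub_pi]; ring
      have hc' : (n:ℝ) ≤ M := by exact_mod_cast hc
      have hlt' : (M:ℝ) < 2 * n := by exact_mod_cast hlt
      have h4 : 0 ≤ sin (M * π / n - π) := by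
        apply sin_nonneg_of_nonneg_of_le_pi
        · rw [sub_nonneg, le_div_iff₀ hn']; nlinarith [pi_pos]
        · rw [sub_le_iff_le_add, div_le_iff₀ hn']; nlinarith [pi_pos]
      linarith
  refine ⟨hE, hX, fun j => ?_, fun j => (key j).1, fun j => (key j).2⟩
  have := t0 (j + 2)
  simp only [f22, f21] at this ⊢
  exact this

lemma good_of_cov {n N : ℕ} {m : Fin 3 → ℕ} (h720 : 720 ∣ n) (hn : 0 < n) (hN : 0 < N) (hm : ∀ t, 0 < m t) (hs : ∑ t, m t = n)
    {w : Fin N → Fin 3 → ℂ} {W : Fin 3 → ℂ} (hw : ∀ i, Pos (w i)) (hW : Pos W) (hc : Cov w W) {D : ℝ} (hD : 0 < D)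
    (τ : Fin N → Equiv.Perm (Fin 3)) (hl : ∀ i j, ‖w i (j + 2) - w i (j + 1)‖ = D * sin (m (τ i j) * π / n)) : Good N := by
  have hs' : ∀ i, ∑ j, m (τ i j) = n := fun i => by rw [← hs]; exact Equiv.sum_comp (τ i) m
  have hlt : ∀ t, m t < n := by
    intro t
    have h1 : m t + m (t + 1) + m (t + 2) = n := by
      rw [← hs, Fin.sum_univ_three]; fin_cases t <;> simp <;> ring
    have := hm (t + 1); omega
  obtain ⟨hA, hT⟩ := abc_cls (n := n) hw hW hc (fun i j => tile_cls hn (hw i) (μ := fun j => m (τ i j)) (fun t => hm _) (hs' i) hD (hl i) j)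
  have hW0 : W 2 - W 1 ≠ 0 := hW.ne 0
  set v : ℂ := (starRingEnd ℂ) (W 2 - W 1) * ((1 / (‖W 2 - W 1‖ * D) : ℝ) : ℂ) with hv
  have hr : 0 < 1 / (‖W 2 - W 1‖ * D) := by have := norm_pos_iff.2 hW0; positivity
  have hv0 : v ≠ 0 := mul_ne_zero ((map_ne_zero (starRingEnd ℂ)).2 hW0) (by exact_mod_cast hr.ne')
  have hvn : ‖v‖ * D = 1 := by
    have := norm_pos_iff.2 hW0
    rw [hv, norm_mul, Complex.norm_real, RCLike.norm_conj, norm_of_nonneg hr.le]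
    field_simp
  have hvc : ∀ F, cls F ^ n = cls (W 2 - W 1) ^ n → cls (v * F) ^ n = 1 := by
    intro F hF
    rw [cls_mul, mul_pow, hF, ← mul_pow, hv, cls_mul, cls_real hr.ne', mul_one]
    unfold cls
    rw [Complex.conj_conj, div_mul_div_comm, mul_comm, div_self, one_pow]
    exact mul_ne_zero hW0 ((map_ne_zero (starRingEnd ℂ)).2 hW0)
  have hve : ∀ F, F ≠ 0 → cls F ^ n = cls (W 2 - W 1) ^ n → ∃ e : ℕ, v * F = ‖v * F‖ * zeta n ^ e := fun F h0 hF =>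
    exists_dir hn (mul_ne_zero hv0 h0) (hvc F hF)
  choose e he using fun i j => hve _ ((hw i).ne j) (hT i j)
  choose eW heW using fun j => hve _ (hW.ne j) (hA j)
  have hnt : ∀ i j, ‖v * (w i (j + 2) - w i (j + 1))‖ = sin (m (τ i j) * π / n) := by
    intro i j
    rw [norm_mul, hl, ← mul_assoc, hvn, one_mul]
  have tile : ∀ i, TPoly n (fun j => v * w i j) (fun j => sin (m (τ i j) * π / n)) (e i) (fun j => m (τ i j)) := by
    intro i
    refine ⟨fun j => ?_, fun j => sin_pos_nat (hm _) (hlt _), fun j => ?_, fun j => hm _, fun j => hlt _⟩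
    · rw [← mul_sub, ← hnt]; exact he i j
    · apply zeta_pow_inj hn
      have t := tile_turn hn (hw i) (μ := fun j => m (τ i j)) (fun t => hm _) (hs' i) hD (hl i) j
      have e1 := he i j
      have e2 := he i (j + 1)
      rw [hnt] at e1 e2
      rw [f12, f11] at e2
      have s0 := sin_pos_nat (hm (τ i j)) (hlt (τ i j))
      have s1 := sin_pos_nat (hm (τ i (j + 1))) (hlt (τ i (j + 1)))
      rw [pow_add, pow_add, zeta_n hn]
      set A := sin (m (τ i j) * π / n)
      set B := sin (m (τ i (j + 1)) * π / n)
      have hA : (A:ℂ) ≠ 0 := by exact_mod_cast s0.ne'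
      have hB : (B:ℂ) ≠ 0 := by exact_mod_cast s1.ne'
      apply mul_left_cancel₀ hB
      rw [← mul_assoc, ← e2, mul_assoc, t]
      push_cast
      field_simp
      linear_combination -e1
  have hXp : ∀ j, 0 < ‖v * (W (j + 2) - W (j + 1))‖ := fun j => norm_pos_iff.2 (mul_ne_zero hv0 (hW.ne j))
  have hWv : Pos (fun j => v * W j) := by
    have h1 : cr (v * W 1 - v * W 0) (v * W 2 - v * W 0) = Complex.normSq v * cr (W 1 - W 0) (W 2 - W 0) := by
      rw [Complex.normSq_apply]; simp [cr]; ring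
    unfold Pos
    rw [h1]
    exact mul_pos (Complex.normSq_pos.2 hv0) hW
  have abc := abc_turn (e := eW) hn hWv hXp (fun j => by rw [← mul_sub]; exact heW j)
  refine Cfg.good (τ := τ) (w := fun i j => v * w i j) ⟨h720, hn, hN, hm, hs, tile, abc, ?_⟩
  intro G
  have b := bal_cls hw hW hc (fun y c => G (v * y) (dec n (cls v * c)))
  have d1 : ∀ i j, dec n (cls v * cls (w i (j + 2) - w i (j + 1))) = e i j % n := by
    intro i j
    rw [← cls_mul, congrArg cls (he i j), cls_dir (norm_pos_iff.2 (mul_ne_zero hv0 ((hw i).ne j))), dec_zeta hn]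
  have d2 : ∀ j, dec n (cls v * cls (W (j + 2) - W (j + 1))) = eW j % n := by
    intro j
    rw [← cls_mul, congrArg cls (heW j), cls_dir (hXp j), dec_zeta hn]
  simp only [d1, d2] at b
  exact b

def toC (p : Pt) : ℂ := ⟨p 0, p 1⟩
def ofC (z : ℂ) : Pt := !₂[z.re, z.im]

lemma toC_ofC (z : ℂ) : toC (ofC z) = z := by
  apply Complex.ext <;> simp [toC, ofC]

lemma toC_norm (p q : Pt) : ‖toC p - toC q‖ = dist p q := by
  rw [EuclideanSpace.dist_eq, Complex.norm_eq_sqrt_sq_add_sq]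
  simp [toC, Real.dist_eq, sq_abs]

lemma toC_ne {T : Tri} (hT : IsTriangle T) : cr (toC (T 1) - toC (T 0)) (toC (T 2) - toC (T 0)) ≠ 0 := by
  intro h
  have key := affineIndependent_iff.1 hT Finset.univ
  simp only [cr, toC, Complex.sub_re, Complex.sub_im] at h
  have kk : ∀ x y : ℝ, x * (T 1 0 - T 0 0) + y * (T 2 0 - T 0 0) = 0 → x * (T 1 1 - T 0 1) + y * (T 2 1 - T 0 1) = 0 → x = 0 ∧ y = 0 := by
    intro x y h0 h1
    have := key ![-x - y, x, y] (by simp [Fin.sum_univ_three]; ring) (by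
      ext k
      simp only [Fin.sum_univ_three, Fin.isValue, Matrix.cons_val_zero, Matrix.cons_val_one, Matrix.cons_val]
      fin_cases k <;> simp <;> linarith)
    exact ⟨by simpa using this 1 (Finset.mem_univ _), by simpa using this 2 (Finset.mem_univ _)⟩
  have h1 := kk (T 2 0 - T 0 0) (-(T 1 0 - T 0 0)) (by ring) (by linarith)
  have h2 := kk (T 2 1 - T 0 1) (-(T 1 1 - T 0 1)) (by linarith) (by ring)
  have h3 := kk 1 0 (by linarith [h1.2]) (by linarith [h2.2])
  exact one_ne_zero h3.1

lemma heron (w : Fin 3 → ℂ) : 4 * cr (w 1 - w 0) (w 2 - w 0) ^ 2 =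
    (∑ j, ‖w (j + 2) - w (j + 1)‖ ^ 2) ^ 2 - 2 * ∑ j, (‖w (j + 2) - w (j + 1)‖ ^ 2) ^ 2 := by
  simp only [← Complex.normSq_eq_norm_sq, Complex.normSq_apply, Fin.sum_univ_three]
  simp [cr]
  ring

lemma perm3 : ∀ (σ : Equiv.Perm (Fin 3)) (j : Fin 3), (σ (j + 2) = σ j + 2 ∧ σ (j + 1) = σ j + 1) ∨ (σ (j + 2) = σ j + 1 ∧ σ (j + 1) = σ j + 2) := by
  decide

lemma perm_dist (T : Tri) (σ : Equiv.Perm (Fin 3)) (j : Fin 3) : dist (T (σ (j + 2))) (T (σ (j + 1))) = sideLen T (σ j) := by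
  unfold sideLen
  rcases perm3 σ j with ⟨h1, h2⟩ | ⟨h1, h2⟩ <;> rw [h1, h2]
  rw [dist_comm]

lemma heron_pt (T : Tri) : 4 * cr (toC (T 1) - toC (T 0)) (toC (T 2) - toC (T 0)) ^ 2 =
    (∑ j, sideLen T j ^ 2) ^ 2 - 2 * ∑ j, (sideLen T j ^ 2) ^ 2 := by
  have := heron (fun j => toC (T j))
  simp only [toC_norm] at this
  rw [this]
  simp only [sideLen, dist_comm]

lemma congr_side {T S : Tri} {σ : Equiv.Perm (Fin 3)} (h : ∀ i j, dist (S i) (S j) = dist (T (σ i)) (T (σ j))) (j : Fin 3) :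
    sideLen S j = sideLen T (σ j) := by
  rw [← perm_dist, ← h, sideLen, dist_comm]

lemma congr_ne {T S : Tri} (hT : IsTriangle T) (h : CongruentTri S T) : cr (toC (S 1) - toC (S 0)) (toC (S 2) - toC (S 0)) ≠ 0 := by
  obtain ⟨σ, h⟩ := h
  have h1 := heron_pt S
  have h2 := heron_pt T
  simp only [congr_side h] at h1
  rw [Equiv.sum_comp σ (fun j => sideLen T j ^ 2), Equiv.sum_comp σ (fun j => (sideLen T j ^ 2) ^ 2), ← h2] at h1
  have := toC_ne hT
  intro h0
  rw [h0] at h1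
  apply this
  have : cr (toC (T 1) - toC (T 0)) (toC (T 2) - toC (T 0)) ^ 2 = 0 := by linarith
  exact pow_eq_zero_iff (by norm_num) |>.1 this

lemma orient {S : Tri} (h : cr (toC (S 1) - toC (S 0)) (toC (S 2) - toC (S 0)) ≠ 0) :
    ∃ ρ : Equiv.Perm (Fin 3), Pos (fun j => toC (S (ρ j))) := by
  rcases lt_or_gt_of_ne h with h | h
  · refine ⟨Equiv.swap 1 2, ?_⟩
    unfold Pos
    have e0 : Equiv.swap (1 : Fin 3) 2 0 = 0 := by decide
    simp only [e0, Equiv.swap_apply_left, Equiv.swap_apply_right]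
    unfold cr at h ⊢
    linarith
  · exact ⟨Equiv.refl _, h⟩

lemma triSet_perm (S : Tri) (ρ : Equiv.Perm (Fin 3)) : triSet (fun j => S (ρ j)) = triSet S := by
  unfold triSet
  rw [show (fun j => S (ρ j)) = S ∘ ρ from rfl, EquivLike.range_comp]

lemma Ln_sum (w : Fin 3 → ℂ) (z : ℂ) : Ln w 0 z + Ln w 1 z + Ln w 2 z = cr (w 1 - w 0) (w 2 - w 0) := by
  simp [Ln, cr]; ring

lemma Ln_vert {w : Fin 3 → ℂ} (hw : Pos w) (j k : Fin 3) : 0 ≤ Ln w j (w k) := by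
  unfold Pos cr at hw
  simp at hw
  fin_cases j <;> fin_cases k <;> simp [Ln, cr] <;> linarith

lemma mem_tri {S : Tri} (hw : Pos (fun j => toC (S j))) (p : Pt) : p ∈ triSet S ↔ ∀ j, 0 ≤ Ln (fun j => toC (S j)) j (toC p) := by
  constructor
  · have hcv : Convex ℝ {p : Pt | ∀ j, 0 ≤ Ln (fun j => toC (S j)) j (toC p)} := by
      intro x hx y hy a b ha hb hab j
      have h1 := hx j
      have h2 := hy j
      have : Ln (fun j => toC (S j)) j (toC (a • x + b • y)) = a * Ln (fun j => toC (S j)) j (toC x) + b * Ln (fun j => toC (S j)) j (toC y) := by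
        obtain rfl : a = 1 - b := by linarith
        simp [Ln, cr, toC]; ring
      rw [this]
      positivity
    have := convexHull_min (s := Set.range S) (by
      rintro _ ⟨k, rfl⟩
      exact fun j => Ln_vert hw j k) hcv
    exact fun h => this h
  · intro h
    set c := cr (toC (S 1) - toC (S 0)) (toC (S 2) - toC (S 0)) with hc
    have c0 : 0 < c := hw
    have hs := Ln_sum (fun j => toC (S j)) (toC p)
    simp only [← hc] at hs
    refine mem_convexHull_of_exists_fintype (fun j => Ln (fun j => toC (S j)) j (toC p) / c) S (fun j => div_nonneg (h j) c0.le) ?_ (fun j => ⟨j, rfl⟩) ?_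
    · rw [← Finset.sum_div, Fin.sum_univ_three, hs, div_self c0.ne']
    · have : ∀ k, (∑ j, (Ln (fun j => toC (S j)) j (toC p)) * S j k) = c * p k := by
        intro k
        rw [Fin.sum_univ_three, hc]
        fin_cases k <;> simp [Ln, cr, toC] <;> ring
      ext k
      have := this k
      simp only [Fin.sum_univ_three] at this
      simp only [Fin.sum_univ_three, PiLp.add_apply, PiLp.smul_apply, smul_eq_mul]
      field_simp
      linarith

lemma mem_int {S : Tri} (hw : Pos (fun j => toC (S j))) (p : Pt) (h : ∀ j, 0 < Ln (fun j => toC (S j)) j (toC p)) : p ∈ interior (triSet S) := by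
  rw [mem_interior]
  refine ⟨{p : Pt | ∀ j, 0 < Ln (fun j => toC (S j)) j (toC p)}, fun q hq => (mem_tri hw q).2 fun j => (hq j).le, ?_, h⟩
  rw [Set.ofPred_forall]
  refine isOpen_iInter_of_finite fun j => isOpen_lt continuous_const ?_
  simp only [Ln, cr, toC, Complex.sub_re, Complex.sub_im]
  fun_prop

lemma cov_of {N : ℕ} {S : Fin N → Tri} {A : Tri} (hw : ∀ i, Pos (fun j => toC (S i j))) (hA : Pos (fun j => toC (A j)))
    (hd : ∀ i j, i ≠ j → interior (triSet (S i)) ∩ interior (triSet (S j)) = ∅) (hcov : (⋃ i, triSet (S i)) = triSet A) :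
    Cov (fun i j => toC (S i j)) (fun j => toC (A j)) := by
  intro z h1 h2
  have hz := toC_ofC z
  by_cases hin : ∀ j, 0 < Ln (fun j => toC (A j)) j z
  · have hp : ofC z ∈ triSet A := (mem_tri hA _).2 (fun j => by rw [hz]; exact (hin j).le)
    rw [← hcov, Set.mem_iUnion] at hp
    obtain ⟨i, hi⟩ := hp
    have hi' : ∀ j, 0 < Ln (fun j => toC (S i j)) j z := fun j => by
      have := (mem_tri (hw i) _).1 hi j
      rw [hz] at this
      exact lt_of_le_of_ne this (h1 i j).symm
    rw [Finset.sum_eq_single i]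
    · unfold ind; rw [if_pos hi', if_pos hin]
    · intro k _ hk
      unfold ind
      rw [if_neg]
      intro hk'
      have m1 := mem_int (hw i) (ofC z) (by rwa [hz])
      have m2 := mem_int (hw k) (ofC z) (by rwa [hz])
      have : ofC z ∈ interior (triSet (S k)) ∩ interior (triSet (S i)) := ⟨m2, m1⟩
      rw [hd k i hk] at this
      exact this
    · intro h; exact absurd (Finset.mem_univ _) h
  · conv_rhs => unfold ind
    rw [if_neg hin]
    apply Finset.sum_eq_zero
    intro i _
    unfold ind
    rw [if_neg]
    intro hk
    apply hin
    intro j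
    have hm : ofC z ∈ triSet A := by
      rw [← hcov, Set.mem_iUnion]
      exact ⟨i, (mem_tri (hw i) _).2 (fun j => by rw [hz]; exact (hk j).le)⟩
    have := (mem_tri hA _).1 hm j
    rw [hz] at this
    exact lt_of_le_of_ne this (h2 j).symm

lemma tri_sin_pos {T : Tri} (hT : IsTriangle T) (k : Fin 3) : 0 < sin (triAngle T k) := by
  apply sin_pos_of_not_collinear
  have := affineIndependent_iff_not_collinear.1 hT
  intro h
  apply this
  refine h.subset ?_
  rintro _ ⟨j, rfl⟩
  fin_cases k <;> fin_cases j <;> simp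

lemma tri_law (T : Tri) (k : Fin 3) : sin (triAngle T (k + 1)) * sideLen T k = sin (triAngle T k) * sideLen T (k + 1) := by
  have := law_sin (T k) (T (k + 1)) (T (k + 2))
  unfold triAngle sideLen
  rw [f11, f12, angle_comm, dist_comm (T (k+2)) (T k), angle_comm (T (k + 1)) (T k)]
  rw [dist_comm (T (k+2)) (T k)] at this
  exact this

lemma tri_D {T : Tri} (hT : IsTriangle T) : ∃ D : ℝ, 0 < D ∧ ∀ k, sideLen T k = D * sin (triAngle T k) := by
  have s := tri_sin_pos hT
  have hne : T 1 ≠ T 2 := fun h => by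
    have := hT.injective h
    revert this; decide
  have hd : 0 < sideLen T 0 := dist_pos.2 hne
  have l0 := tri_law T 0
  have l1 := tri_law T 1
  simp only [zero_add, z11] at l0 l1
  have s0 := s 0
  have s1 := s 1
  refine ⟨sideLen T 0 / sin (triAngle T 0), div_pos hd s0, fun k => ?_⟩
  have e1 : sideLen T 1 = sideLen T 0 / sin (triAngle T 0) * sin (triAngle T 1) := by field_simp; linarith
  have e2 : sideLen T 2 = sideLen T 0 / sin (triAngle T 0) * sin (triAngle T 2) := by
    have : sideLen T 2 = sideLen T 1 / sin (triAngle T 1) * sin (triAngle T 2) := by field_simp; linarith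
    rw [this, e1]; field_simp
  fin_cases k
  · show sideLen T 0 = sideLen T 0 / sin (triAngle T 0) * sin (triAngle T 0)
    field_simp
  · exact e1
  · exact e2

lemma tri_pos {T : Tri} (hT : IsTriangle T) (k : Fin 3) : 0 < triAngle T k := by
  have h0 : 0 ≤ triAngle T k := angle_nonneg _ _ _
  rcases h0.eq_or_lt with h | h
  · have := tri_sin_pos hT k
    rw [← h] at this; simp at this
  · exact h

lemma tri_sum {T : Tri} (hT : IsTriangle T) : triAngle T 0 + triAngle T 1 + triAngle T 2 = π := by
  have hne : T 1 ≠ T 0 := fun h => by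
    have := hT.injective h
    revert this; decide
  have := angle_add_angle_add_angle_eq_pi (T 2) hne
  unfold triAngle
  simp only [zero_add, z11, z12, z21, z22]
  rw [angle_comm (T 1) (T 0), angle_comm (T 2) (T 1), angle_comm (T 0) (T 2)]
  linarith

lemma exists_nm {q : Fin 3 → ℚ} (hq : ∀ t, 0 < q t) (hs : ∑ t, q t = 1) :
    ∃ (n : ℕ) (m : Fin 3 → ℕ), 720 ∣ n ∧ 0 < n ∧ (∀ t, 0 < m t) ∧ ∑ t, m t = n ∧ ∀ t, (q t : ℝ) = m t / n := by
  have hP : 0 < ∏ t, (q t).den := Finset.prod_pos fun t _ => (q t).den_pos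
  have : ∀ t, ∃ k : ℕ, (q t) * (720 * ∏ t, (q t).den : ℕ) = k := by
    intro t
    obtain ⟨c, hc⟩ := Finset.dvd_prod_of_mem (fun t => (q t).den) (Finset.mem_univ t)
    refine ⟨(q t).num.toNat * 720 * c, ?_⟩
    have hnum : (((q t).num.toNat : ℕ) : ℚ) = (q t).num := by
      exact_mod_cast Int.toNat_of_nonneg (Rat.num_pos.2 (hq t)).le
    rw [hc]
    push_cast
    rw [hnum]
    have := Rat.mul_den_eq_num (q t)
    linear_combination (720 * c : ℚ) * this
  choose m hm using this
  have hn : 0 < 720 * ∏ t, (q t).den := by positivity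
  have hn' : (0:ℚ) < ((720 * ∏ t, (q t).den : ℕ) : ℚ) := by exact_mod_cast hn
  refine ⟨720 * ∏ t, (q t).den, m, ⟨_, rfl⟩, hn, fun t => ?_, ?_, fun t => ?_⟩
  · have : (0:ℚ) < m t := by rw [← hm]; exact mul_pos (hq t) hn'
    exact_mod_cast this
  · have : ((∑ t, m t : ℕ) : ℚ) = (720 * ∏ t, (q t).den : ℕ) := by
      rw [Nat.cast_sum, ← Finset.sum_congr rfl (fun t _ => hm t), ← Finset.sum_mul, hs, one_mul]
    exact_mod_cast this
  · have h1 : (q t) = m t / ((720 * ∏ t, (q t).den : ℕ) : ℚ) := by rw [← hm]; field_simp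
    have h2 : ((q t : ℚ) : ℝ) = ((m t / ((720 * ∏ t, (q t).den : ℕ) : ℚ) : ℚ) : ℝ) := congrArg _ h1
    rw [h2, Rat.cast_div, Rat.cast_natCast, Rat.cast_natCast]

lemma good_of_tiling {N : ℕ} {A T : Tri} (hA : IsTriangle A) (hT : IsTriangle T) (hq : ∀ k, ∃ q : ℚ, triAngle T k = q * π)
    {tiles : Fin N → Tri} (ht : IsTiling N A T tiles) : Good N := by
  choose q hq using hq
  have q0 : ∀ k, 0 < q k := by
    intro k
    have := tri_pos hT k
    rw [hq, mul_pos_iff_of_pos_right pi_pos] at this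
    exact_mod_cast this
  have q1 : ∑ k, q k = 1 := by
    have h := tri_sum hT
    rw [hq, hq, hq] at h
    have : ((∑ k, q k : ℚ) : ℝ) = 1 := by
      rw [Fin.sum_univ_three]; push_cast
      apply mul_right_cancel₀ pi_pos.ne'
      linarith
    exact_mod_cast this
  obtain ⟨n, m, h720, hn, hm, hs, hqm⟩ := exists_nm q0 q1
  obtain ⟨D, hD, hside⟩ := tri_D hT
  choose σ hσ using ht.congr
  choose ρ hρ using fun i => orient (congr_ne hT (ht.congr i))
  obtain ⟨ρA, hρA⟩ := orient (toC_ne hA)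
  have hc := cov_of (S := fun i j => tiles i (ρ i j)) (A := fun j => A (ρA j)) hρ hρA
    (by intro i j hij; rw [triSet_perm (tiles i) (ρ i), triSet_perm (tiles j) (ρ j)]; exact ht.disj i j hij)
    (by rw [triSet_perm A ρA, ← ht.cover]; exact Set.iUnion_congr fun i => triSet_perm (tiles i) (ρ i))
  have hN : 0 < N := by
    rcases Nat.eq_zero_or_pos N with h | h
    · subst h
      have h1 : A 0 ∈ triSet A := subset_convexHull ℝ _ ⟨0, rfl⟩
      rw [← ht.cover, Set.mem_iUnion] at h1
      exact h1.choose.elim0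
    · exact h
  refine good_of_cov h720 hn hN hm hs hρ hρA hc hD (fun i => (ρ i).trans (σ i)) ?_
  intro i j
  rw [toC_norm, perm_dist, congr_side (hσ i), hside, hq, hqm, Equiv.trans_apply]
  congr 2
  ring

lemma not_good {N : ℕ} (hN : N = 7 ∨ N = 11 ∨ N = 14 ∨ N = 19 ∨ N = 31) : ¬ Good N := by
  have hb : ∀ x c : ℕ, x ^ 2 + c ≤ 31 → x < 6 := fun x c h => by nlinarith
  rintro (⟨x, h⟩ | ⟨x, y, h⟩ | ⟨x, h⟩ | ⟨x, h⟩ | ⟨x, h⟩)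
  · have := hb x 0 (by omega)
    interval_cases x <;> omega
  · have := hb x (y ^ 2) (by omega)
    have := hb y (x ^ 2) (by omega)
    interval_cases x <;> interval_cases y <;> omega
  all_goals
    have := hb x 0 (by omega)
    interval_cases x <;> omega

/-- If some triangle `ABC` is `N`-tiled by a tile whose three angles are all
rational multiples of `π`, then `N` is a perfect square, or a sum of two
perfect squares, or `2`, `3`, or `6` times a perfect square.  In particular
`N` is not `7`, `11`, `14`, `19`, or `31`. -/
theorem tiling_commensurable_angles (N : ℕ) (ABC T : Tri)
    (hABC : IsTriangle ABC) (hT : IsTriangle T)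
    (α β γ : ℝ) (hangles : HasAngles T α β γ)
    (hα : ∃ q : ℚ, α = (q : ℝ) * π)
    (hβ : ∃ q : ℚ, β = (q : ℝ) * π)
    (hγ : ∃ q : ℚ, γ = (q : ℝ) * π)
    (tiles : Fin N → Tri) (ht : IsTiling N ABC T tiles) :
    ((∃ n : ℕ, N = n ^ 2) ∨ (∃ e f : ℕ, N = e ^ 2 + f ^ 2) ∨
      (∃ n : ℕ, N = 2 * n ^ 2) ∨ (∃ n : ℕ, N = 3 * n ^ 2) ∨ (∃ n : ℕ, N = 6 * n ^ 2)) ∧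
    N ≠ 7 ∧ N ≠ 11 ∧ N ≠ 14 ∧ N ≠ 19 ∧ N ≠ 31 := by
  obtain ⟨ha, hb, hc⟩ := hangles
  have hg : Good N := good_of_tiling hABC hT (by
    intro k
    fin_cases k
    · show ∃ q : ℚ, triAngle T 0 = q * π
      rw [ha]; exact hα
    · show ∃ q : ℚ, triAngle T 1 = q * π
      rw [hb]; exact hβ
    · show ∃ q : ℚ, triAngle T 2 = q * π
      rw [hc]; exact hγ) ht
  have hk : ¬ (N = 7 ∨ N = 11 ∨ N = 14 ∨ N = 19 ∨ N = 31) := fun h => not_good h hg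
  exact ⟨hg, by tauto⟩
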